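/- For every integer n ≥ 12 and every integer r with 3 ≤ r ≤ ⌊(n−1)/2⌋, the alternating group A_n has at least one string C-group representation of rank r. -/

import Mathlib

/-- A string C-group representation of rank `n` of a group `G`: a family of `n`
involutions generating `G`, satisfying the commuting (string) property and the
intersection property. -/
def IsStringCGroupRep {G : Type*} [Group G] {n : ℕ} (ρ : Fin n → G) : Prop :=
  (∀ i, orderOf (ρ i) = 2) ∧
  Subgroup.closure (Set.range ρ) = ⊤ ∧
  (∀ i j : Fin n, i.val + 1 < j.val → Commute (ρ i) (ρ j)) ∧
  (∀ I J : Set (Fin n),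
    Subgroup.closure (ρ '' I) ⊓ Subgroup.closure (ρ '' J) = Subgroup.closure (ρ '' (I ∩ J)))

open Equiv Equiv.Perm

section StringGroups

variable {G : Type*} [Group G]

/-- The subgroup generated by the `ρ k` with `i ≤ k < j`. -/
def itv (ρ : ℕ → G) (i j : ℕ) : Subgroup G := Subgroup.closure (ρ '' Set.Ico i j)

/-- `ρ 0, …, ρ (r - 1)` are commuting-string involutions satisfying the intersection property on
consecutive intervals. -/
structure IsStringC (ρ : ℕ → G) (r : ℕ) : Prop where
  sq : ∀ i < r, ρ i * ρ i = 1
  ne_one : ∀ i < r, ρ i ≠ 1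
  comm : ∀ i j, i + 1 < j → j < r → Commute (ρ i) (ρ j)
  inter : ∀ i j, i < j → j < r → itv ρ i j ⊓ itv ρ (i + 1) (j + 1) ≤ itv ρ (i + 1) j

theorem mem_itv {ρ : ℕ → G} {i j k : ℕ} (hi : i ≤ k) (hj : k < j) : ρ k ∈ itv ρ i j :=
  Subgroup.subset_closure ⟨k, ⟨hi, hj⟩, rfl⟩

theorem itv_le {ρ : ℕ → G} {i j : ℕ} {H : Subgroup G} (h : ∀ k, i ≤ k → k < j → ρ k ∈ H) :
    itv ρ i j ≤ H := by
  rw [itv, Subgroup.closure_le]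
  rintro _ ⟨k, hk, rfl⟩
  exact h k hk.1 hk.2

theorem itv_mono {ρ : ℕ → G} {i j k l : ℕ} (hi : k ≤ i) (hj : j ≤ l) : itv ρ i j ≤ itv ρ k l :=
  itv_le fun _ h1 h2 => mem_itv (hi.trans h1) (h2.trans_le hj)

theorem itv_shift (ρ : ℕ → G) (s i j : ℕ) :
    itv (fun k => ρ (k + s)) i j = itv ρ (i + s) (j + s) := by
  apply le_antisymm
  · exact itv_le fun k h1 h2 => mem_itv (by omega) (by omega)
  · refine itv_le fun k h1 h2 => ?_
    have := mem_itv (ρ := fun k => ρ (k + s)) (i := i) (j := j) (k := k - s) (by omega) (by omega)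
    simpa [Nat.sub_add_cancel (show s ≤ k by omega)] using this

theorem itv_eq_bot {ρ : ℕ → G} {i j : ℕ} (h : j ≤ i) : itv ρ i j = ⊥ :=
  le_bot_iff.1 (itv_le fun k h1 h2 => by omega)

theorem mem_itv_one {ρ : ℕ → G} {i : ℕ} (h : ρ i * ρ i = 1) {g : G} :
    g ∈ itv ρ i (i + 1) ↔ g = 1 ∨ g = ρ i := by
  constructor
  · intro hg
    refine Subgroup.closure_induction (p := fun g _ => g = 1 ∨ g = ρ i) ?_ (Or.inl rfl) ?_ ?_ hg
    · rintro _ ⟨k, ⟨h1, h2⟩, rfl⟩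
      exact Or.inr (by rw [show k = i by omega])
    · rintro a b - - (rfl | rfl) (rfl | rfl) <;> simp [h]
    · rintro a - (rfl | rfl)
      · simp
      · exact Or.inr (inv_eq_of_mul_eq_one_left h)
  · rintro (rfl | rfl)
    · exact one_mem _
    · exact mem_itv le_rfl (Nat.lt_succ_self _)

theorem commute_of_mem_closure {S T : Set G} (h : ∀ s ∈ S, ∀ t ∈ T, Commute s t) {g k : G}
    (hg : g ∈ Subgroup.closure S) (hk : k ∈ Subgroup.closure T) : Commute g k := by
  have h1 : T ⊆ Subgroup.centralizer S := fun t ht s hs => h s hs t ht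
  have h2 : Subgroup.closure T ≤ Subgroup.centralizer S := (Subgroup.closure_le _).2 h1
  have h3 : Subgroup.closure S ≤ Subgroup.centralizer (Subgroup.closure T) :=
    (Subgroup.closure_le _).2 fun s hs t ht => (h2 ht s hs).symm
  exact (h3 hg k hk).symm

namespace IsStringC

variable {ρ : ℕ → G} {r : ℕ}

theorem inter_le (h : IsStringC ρ r) {i k j l : ℕ} (hik : i ≤ k) (hjl : j ≤ l) (hl : l ≤ r) :
    itv ρ i j ⊓ itv ρ k l ≤ itv ρ k j := by
  suffices ∀ n i k j l, l ≤ i + n → i ≤ k → j ≤ l → l ≤ r →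
      itv ρ i j ⊓ itv ρ k l ≤ itv ρ k j from
    this l i k j l (by omega) hik hjl hl
  intro n
  induction n with
  | zero =>
    intro i k j l h1 _ h2 h3 g hg
    have := hg.1
    rw [SetLike.mem_coe, itv_eq_bot (by omega)] at this
    exact Subgroup.mem_bot.1 this ▸ one_mem _
  | succ n ih =>
    intro i k j l h1 hik h2 h3 g hg
    rcases hik.eq_or_lt with rfl | hd
    · exact hg.1
    rcases h2.eq_or_lt with rfl | hjl
    · exact hg.2
    by_cases hij : j ≤ i
    · have := hg.1
      rw [SetLike.mem_coe, itv_eq_bot (by omega)] at this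
      exact Subgroup.mem_bot.1 this ▸ one_mem _
    have e := h.inter i (l - 1) (by omega) (by omega)
    rw [Nat.sub_add_cancel (by omega)] at e
    have g1 : g ∈ itv ρ (i + 1) (l - 1) :=
      e ⟨itv_mono le_rfl (by omega) hg.1, itv_mono (by omega) le_rfl hg.2⟩
    have g2 := ih i (i + 1) j (l - 1) (by omega) (by omega) (by omega) (by omega) ⟨hg.1, g1⟩
    exact ih (i + 1) k j l (by omega) (by omega) (by omega) h3 ⟨g2, hg.2⟩

theorem disjoint (h : IsStringC ρ r) {i j k l : ℕ} (hik : i ≤ k) (hjl : j ≤ l) (hl : l ≤ r)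
    (hjk : j ≤ k) {g : G} (h1 : g ∈ itv ρ i j) (h2 : g ∈ itv ρ k l) : g = 1 := by
  have : g ∈ itv ρ k j := h.inter_le hik hjl hl (Subgroup.mem_inf.2 ⟨h1, h2⟩)
  rwa [itv_eq_bot hjk, Subgroup.mem_bot] at this

/-- Factor an element of a standard subgroup missing the generator `ρ p`. -/
theorem exists_mul (h : IsStringC ρ r) {I : Set ℕ} (hI : I ⊆ Set.Iio r) {p : ℕ} (hp : p ∉ I)
    {g : G} (hg : g ∈ Subgroup.closure (ρ '' I)) :
    ∃ u ∈ Subgroup.closure (ρ '' (I ∩ Set.Iio p)), ∃ v ∈ Subgroup.closure (ρ '' (I ∩ Set.Ioi p)),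
      g = u * v := by
  refine Subgroup.closure_induction (p := fun g _ =>
    ∃ u ∈ Subgroup.closure (ρ '' (I ∩ Set.Iio p)), ∃ v ∈ Subgroup.closure (ρ '' (I ∩ Set.Ioi p)),
      g = u * v) ?_ ⟨1, one_mem _, 1, one_mem _, by simp⟩ ?_ ?_ hg
  · rintro _ ⟨k, hk, rfl⟩
    rcases lt_trichotomy k p with hkp | rfl | hkp
    · exact ⟨ρ k, Subgroup.subset_closure ⟨k, ⟨hk, hkp⟩, rfl⟩, 1, one_mem _, by simp⟩
    · exact absurd hk hp
    · exact ⟨1, one_mem _, ρ k, Subgroup.subset_closure ⟨k, ⟨hk, hkp⟩, rfl⟩, by simp⟩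
  all_goals
    have hc : ∀ {u v}, u ∈ Subgroup.closure (ρ '' (I ∩ Set.Iio p)) →
        v ∈ Subgroup.closure (ρ '' (I ∩ Set.Ioi p)) → Commute u v := by
      refine fun hu hv => commute_of_mem_closure ?_ hu hv
      rintro _ ⟨k, hk, rfl⟩ _ ⟨l, hl, rfl⟩
      have h1 : k < p := hk.2
      have h2 : p < l := hl.2
      exact h.comm k l (by omega) (hI hl.1)
  · rintro a b - - ⟨u, hu, v, hv, rfl⟩ ⟨u', hu', v', hv', rfl⟩
    refine ⟨u * u', mul_mem hu hu', v * v', mul_mem hv hv', ?_⟩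
    rw [mul_assoc, ← mul_assoc v, (hc hu' hv).symm.eq]
    simp [mul_assoc]
  · rintro a - ⟨u, hu, v, hv, rfl⟩
    exact ⟨u⁻¹, inv_mem hu, v⁻¹, inv_mem hv, by rw [← mul_inv_rev, (hc hu hv).eq]⟩

theorem closure_le_itv {I : Set ℕ} {a b : ℕ} (hI : I ⊆ Set.Ico a b) :
    Subgroup.closure (ρ '' I) ≤ itv ρ a b :=
  Subgroup.closure_mono (Set.image_mono hI)

set_option maxHeartbeats 1000000 in
theorem closure_inter (h : IsStringC ρ r) : ∀ n a b, b ≤ a + n → b ≤ r →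
    ∀ I J : Set ℕ, I ⊆ Set.Ico a b → J ⊆ Set.Ico a b →
    Subgroup.closure (ρ '' I) ⊓ Subgroup.closure (ρ '' J) ≤ Subgroup.closure (ρ '' (I ∩ J)) := by
  intro n
  induction n with
  | zero =>
    intro a b h1 h2 I J hI hJ
    have : I ⊆ I ∩ J := fun k hk => by have := hI hk; simp only [Set.mem_Ico] at this; omega
    exact inf_le_left.trans (Subgroup.closure_mono (Set.image_mono this))
  | succ n ih =>
    intro a b hab hb
    suffices ∀ I J : Set ℕ, I ⊆ Set.Ico a b → J ⊆ Set.Ico a b → ∀ p q, p ∈ Set.Ico a b →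
        q ∈ Set.Ico a b → p ≤ q → p ∉ I → q ∉ J →
        Subgroup.closure (ρ '' I) ⊓ Subgroup.closure (ρ '' J) ≤
          Subgroup.closure (ρ '' (I ∩ J)) by
      intro I J hI hJ
      by_cases h1 : Set.Ico a b ⊆ I
      · rw [Set.inter_eq_right.2 (hJ.trans h1)]; exact inf_le_right
      by_cases h2 : Set.Ico a b ⊆ J
      · rw [Set.inter_eq_left.2 (hI.trans h2)]; exact inf_le_left
      obtain ⟨p, hp, hpI⟩ := Set.not_subset.1 h1
      obtain ⟨q, hq, hqJ⟩ := Set.not_subset.1 h2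
      rcases le_total p q with hpq | hpq
      · exact this I J hI hJ p q hp hq hpq hpI hqJ
      · rw [inf_comm, Set.inter_comm]
        exact this J I hJ hI q p hq hp hpq hqJ hpI
    intro I J hI hJ p q hp hq hpq hpI hqJ g hg
    obtain ⟨hp1, hp2⟩ := hp
    obtain ⟨hq1, hq2⟩ := hq
    obtain ⟨u, hu, v, hv, e⟩ := h.exists_mul (fun k hk => (hI hk).2.trans_le hb) hpI hg.1
    obtain ⟨u', hu', v', hv', e'⟩ := h.exists_mul (fun k hk => (hJ hk).2.trans_le hb) hqJ hg.2
    have bd : ∀ {K : Set ℕ} {x}, K ⊆ Set.Ico a b → x ∈ K → a ≤ x ∧ x < b := fun hK hx => hK hx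
    have ew : u'⁻¹ * u = v' * v⁻¹ := by
      rw [eq_mul_inv_iff_mul_eq, mul_assoc, ← e, e']; group
    have hua : u ∈ itv ρ a p := closure_le_itv (fun k hk => ⟨(hI hk.1).1, hk.2⟩) hu
    have hua' : u' ∈ itv ρ a q := closure_le_itv (fun k hk => ⟨(hJ hk.1).1, hk.2⟩) hu'
    have hva : v ∈ itv ρ (p + 1) b := closure_le_itv (fun k hk => ⟨hk.2, (hI hk.1).2⟩) hv
    have hva' : v' ∈ itv ρ (q + 1) b := closure_le_itv (fun k hk => ⟨hk.2, (hJ hk.1).2⟩) hv'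
    have hw : u'⁻¹ * u ∈ itv ρ (p + 1) q := by
      refine h.inter_le (i := a) (l := b) (by omega) hq2.le hb (Subgroup.mem_inf.2 ⟨?_, ?_⟩)
      · exact Subgroup.mul_mem _ (Subgroup.inv_mem _ hua') (itv_mono le_rfl hpq hua)
      · rw [ew]
        exact Subgroup.mul_mem _ (itv_mono (by omega) le_rfl hva') (Subgroup.inv_mem _ hva)
    set w := u'⁻¹ * u with hwdef
    have hwc : itv ρ (p + 1) q = Subgroup.closure (ρ '' Set.Ico (p + 1) q) := rfl
    -- `u'` lies in `⟨I ∩ J below p⟩ * ⟨J between⟩`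
    have h1 : u' ∈ Subgroup.closure (ρ '' (((I ∩ Set.Iio p) ∪ Set.Ico (p + 1) q) ∩
        (J ∩ Set.Iio q))) := by
      refine ih a q (by omega) (by omega) _ _ ?_ ?_ ⟨?_, hu'⟩
      · rintro k (hk | hk)
        · exact ⟨(hI hk.1).1, lt_of_lt_of_le hk.2 hpq⟩
        · exact ⟨by have := hk.1; omega, hk.2⟩
      · exact fun k hk => ⟨(hJ hk.1).1, hk.2⟩
      · have : u' = u * w⁻¹ := by rw [hwdef]; group
        rw [this]
        exact Subgroup.mul_mem _ (Subgroup.closure_mono (Set.image_mono Set.subset_union_left) hu)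
          (Subgroup.inv_mem _ (Subgroup.closure_mono (Set.image_mono Set.subset_union_right) hw))
    have h2 : v ∈ Subgroup.closure (ρ '' ((I ∩ Set.Ioi p) ∩
        (Set.Ico (p + 1) q ∪ (J ∩ Set.Ioi q)))) := by
      refine ih (p + 1) b (by omega) (by omega) _ _ ?_ ?_ ⟨hv, ?_⟩
      · exact fun k hk => ⟨hk.2, (hI hk.1).2⟩
      · rintro k (hk | hk)
        · exact ⟨hk.1, by have := hk.2; omega⟩
        · refine ⟨?_, (hJ hk.1).2⟩
          have : q < k := hk.2
          omega
      · have : v = w⁻¹ * v' := by rw [ew]; group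
        rw [this]
        exact Subgroup.mul_mem _ (Subgroup.inv_mem _ (Subgroup.closure_mono (Set.image_mono Set.subset_union_left) hw))
          (Subgroup.closure_mono (Set.image_mono Set.subset_union_right) hv')
    obtain ⟨x, hx, y, hy, exy⟩ := h.exists_mul (p := p) (fun k hk => (hJ hk.2.1).2.trans_le hb)
      (fun hk => hk.1.elim (fun hk => hpI hk.1) (fun hk => by have := hk.1; omega)) h1
    obtain ⟨x', hx', y', hy', exy'⟩ := h.exists_mul (p := q) (fun k hk => (hI hk.1.1).2.trans_le hb)
      (fun hk => hk.2.elim (fun hk => by have := hk.2; omega) (fun hk => hqJ hk.1)) h2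
    have hIJ : ∀ k, k ∈ I → k ∈ J → k ∈ I ∩ J := fun k h1 h2 => ⟨h1, h2⟩
    have hx1 : x ∈ Subgroup.closure (ρ '' (I ∩ J ∩ Set.Iio p)) := by
      refine Subgroup.closure_mono (Set.image_mono ?_) hx
      rintro k ⟨⟨hk | hk, hk2⟩, hk3⟩
      · exact ⟨⟨hk.1, hk2.1⟩, hk3⟩
      · have := hk.1
        have : k < p := hk3
        omega
    have hy1 : y ∈ Subgroup.closure (ρ '' (J ∩ Set.Ico (p + 1) q)) := by
      refine Subgroup.closure_mono (Set.image_mono ?_) hy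
      rintro k ⟨⟨hk | hk, hk2⟩, hk3⟩
      · have : k < p := hk.2
        have : p < k := hk3
        omega
      · exact ⟨hk2.1, hk⟩
    have hy1' : y' ∈ Subgroup.closure (ρ '' (I ∩ J ∩ Set.Ioi q)) := by
      refine Subgroup.closure_mono (Set.image_mono ?_) hy'
      rintro k ⟨⟨hk2, hk | hk⟩, hk3⟩
      · have := hk.2
        have : q < k := hk3
        omega
      · exact ⟨⟨hk2.1, hk.1⟩, hk3⟩
    have hx1' : x' ∈ Subgroup.closure (ρ '' (I ∩ Set.Ico (p + 1) q)) := by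
      refine Subgroup.closure_mono (Set.image_mono ?_) hx'
      rintro k ⟨⟨hk2, hk | hk⟩, hk3⟩
      · exact ⟨hk2.1, hk⟩
      · have : q < k := hk.2
        have : k < q := hk3
        omega
    -- the two halves give `w⁻¹ = y = x'`
    have ey : y = w⁻¹ := by
      have h3 : x⁻¹ * u = y * w := by
        rw [inv_mul_eq_iff_eq_mul, ← mul_assoc, ← exy, hwdef]; group
      have : x⁻¹ * u = 1 := by
        refine h.disjoint (i := a) (j := p) (k := p + 1) (l := q + 1) (by omega) (by omega)
          (by omega) (by omega) (Subgroup.mul_mem _ (Subgroup.inv_mem _ ?_) hua)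
          (h3 ▸ Subgroup.mul_mem _ ?_ ?_)
        · exact closure_le_itv (fun k hk => ⟨(hI hk.1.1).1, hk.2⟩) hx1
        · exact closure_le_itv (fun k hk => ⟨hk.2.1, by have := hk.2.2; omega⟩) hy1
        · exact itv_mono le_rfl (by omega) hw
      rw [this] at h3
      exact eq_inv_of_mul_eq_one_left h3.symm
    have ex' : x' = w⁻¹ := by
      have h3 : w * x' = v' * y'⁻¹ := by
        rw [eq_mul_inv_iff_mul_eq, mul_assoc, ← exy', ew]; group
      have : w * x' = 1 := by
        refine h.disjoint (i := p) (j := q) (k := q + 1) (l := b) (by omega) (by omega)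
          (by omega) (by omega) (Subgroup.mul_mem _ ?_ ?_)
          (h3 ▸ Subgroup.mul_mem _ hva' (Subgroup.inv_mem _ ?_))
        · exact itv_mono (by omega) le_rfl hw
        · exact closure_le_itv (fun k hk => ⟨by have := hk.2.1; omega, hk.2.2⟩) hx1'
        · exact closure_le_itv (fun k hk => ⟨hk.2, (hJ hk.1.2).2⟩) hy1'
      exact eq_inv_of_mul_eq_one_right this
    have hwin : w⁻¹ ∈ Subgroup.closure (ρ '' ((I ∩ Set.Ico (p + 1) q) ∩
        (J ∩ Set.Ico (p + 1) q))) :=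
      ih (p + 1) q (by omega) (by omega) _ _ Set.inter_subset_right Set.inter_subset_right
        ⟨ex' ▸ hx1', ey ▸ hy1⟩
    have : g = x * w⁻¹ * (w * w⁻¹ * y') := by
      rw [e', exy, ey]
      have : v' = y' := by
        have : v' = w * v := by rw [ew]; group
        rw [this, exy', ex']; group
      rw [this]; group
    rw [this, mul_inv_cancel, one_mul]
    refine Subgroup.mul_mem _ (Subgroup.mul_mem _ ?_ ?_) ?_
    · exact Subgroup.closure_mono (Set.image_mono Set.inter_subset_left) hx1
    · refine Subgroup.closure_mono (Set.image_mono ?_) hwin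
      exact fun k hk => ⟨hk.1.1, hk.2.1⟩
    · exact Subgroup.closure_mono (Set.image_mono Set.inter_subset_left) hy1'

end IsStringC

end StringGroups

section Reduction

variable {G : Type*} [Group G]

namespace IsStringC

variable {ρ : ℕ → G} {r : ℕ}

theorem closure_le (h : IsStringC ρ r) {I J K : Set ℕ} (hI : I ⊆ Set.Iio r) (hJ : J ⊆ Set.Iio r)
    (hK : I ∩ J ⊆ K) :
    Subgroup.closure (ρ '' I) ⊓ Subgroup.closure (ρ '' J) ≤ Subgroup.closure (ρ '' K) :=
  (h.closure_inter r 0 r (by omega) le_rfl I J (fun _ hk => ⟨Nat.zero_le _, hI hk⟩)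
    (fun _ hk => ⟨Nat.zero_le _, hJ hk⟩)).trans (Subgroup.closure_mono (Set.image_mono hK))

end IsStringC

/-- Replace the first three generators `ρ 0, ρ 1, ρ 2` by `ρ 1, ρ 0 * ρ 2`. -/
def headRed (ρ : ℕ → G) : ℕ → G
  | 0 => ρ 1
  | 1 => ρ 0 * ρ 2
  | (k + 2) => ρ (k + 3)

theorem mem_closure_pair_dihedral {a b : G} (ha : a * a = 1) (hb : b * b = 1) {g : G}
    (hg : g ∈ Subgroup.closure {a, b}) :
    ∃ t : ℤ, g = (a * b) ^ t ∨ g = (a * b) ^ t * b := by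
  have hinv : ∀ t : ℤ, b * (a * b) ^ t = (a * b) ^ (-t) * b := by
    intro t
    have h1 : b * (a * b) * b⁻¹ = (a * b)⁻¹ := by
      rw [mul_inv_rev, inv_eq_of_mul_eq_one_left ha, inv_eq_of_mul_eq_one_left hb]
      rw [mul_assoc, mul_assoc, hb, mul_one]
    have h2 := congrArg (· ^ t) h1
    simp only [conj_zpow, inv_zpow', ] at h2
    rw [← h2]; group
  have hbi : b⁻¹ = b := inv_eq_of_mul_eq_one_left hb
  refine Subgroup.closure_induction (p := fun g _ => ∃ t : ℤ, g = (a * b) ^ t ∨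
    g = (a * b) ^ t * b) ?_ ⟨0, by simp⟩ ?_ ?_ hg
  · rintro x (rfl | rfl)
    · exact ⟨1, Or.inr (by rw [zpow_one, mul_assoc, hb, mul_one])⟩
    · exact ⟨0, Or.inr (by simp)⟩
  · rintro x y - - ⟨s, rfl | rfl⟩ ⟨t, rfl | rfl⟩
    · exact ⟨s + t, Or.inl (zpow_add _ _ _).symm⟩
    · exact ⟨s + t, Or.inr (by rw [zpow_add, mul_assoc])⟩
    · exact ⟨s - t, Or.inr (by rw [mul_assoc, hinv, ← mul_assoc, ← zpow_add, sub_eq_add_neg])⟩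
    · refine ⟨s - t, Or.inl ?_⟩
      rw [mul_assoc, ← mul_assoc b, hinv, mul_assoc _ b, hb, mul_one, ← zpow_add, sub_eq_add_neg]
  · rintro x - ⟨t, rfl | rfl⟩
    · exact ⟨-t, Or.inl (zpow_neg _ _).symm⟩
    · exact ⟨t, Or.inr (by rw [mul_inv_rev, hbi, ← zpow_neg, hinv, neg_neg])⟩

variable {ρ : ℕ → G} {r : ℕ}

theorem headRed_mem {k : ℕ} (h : Commute (ρ 0) (ρ 2)) (h03 : Commute (ρ 0) (ρ 3))
    (h0 : ρ 0 * ρ 0 = 1) (h23 : (ρ 2 * ρ 3) ^ (2 * k + 1) = 1) :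
    ρ 0 ∈ itv (headRed ρ) 1 3 := by
  have h1 : ρ 0 * ρ 2 ∈ itv (headRed ρ) 1 3 := mem_itv (ρ := headRed ρ) (k := 1) le_rfl (by omega)
  have h2 : ρ 3 ∈ itv (headRed ρ) 1 3 := mem_itv (ρ := headRed ρ) (k := 2) (by omega) (by omega)
  have h3 : ρ 0 = (ρ 0 * ρ 2 * ρ 3) ^ (2 * k + 1) := by
    rw [mul_assoc, (h.mul_right h03).mul_pow, h23, mul_one, pow_succ, pow_mul, pow_two, h0,
      one_pow, one_mul]
  rw [h3]
  exact Subgroup.pow_mem _ (Subgroup.mul_mem _ h1 h2) _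

theorem itv_headRed_le {i j : ℕ} (hi : 1 ≤ i) :
    itv (headRed ρ) i j ≤ Subgroup.closure (ρ '' {k | (k = 0 ∧ i = 1) ∨ (i + 1 ≤ k ∧ k ≤ j)}) := by
  refine itv_le fun k h1 h2 => ?_
  match k, h1, h2 with
  | 0, h1, _ => omega
  | 1, h1, h2 =>
    obtain rfl : i = 1 := by omega
    exact Subgroup.mul_mem _ (Subgroup.subset_closure ⟨0, by simp, rfl⟩)
      (Subgroup.subset_closure ⟨2, by simp; omega, rfl⟩)
  | k + 2, h1, h2 =>
    exact Subgroup.subset_closure ⟨k + 3, Or.inr ⟨by omega, by omega⟩, rfl⟩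

theorem itv_headRed_two_le {i j : ℕ} (hi : 2 ≤ i) :
    itv (headRed ρ) i j ≤ itv ρ (i + 1) (j + 1) := by
  refine itv_le fun k h1 h2 => ?_
  match k, h1, h2 with
  | 0, h1, _ => omega
  | 1, h1, h2 => omega
  | k + 2, h1, h2 => exact mem_itv (k := k + 3) (by omega) (by omega)

theorem itv_headRed_zero_le {j : ℕ} (hj : 2 ≤ j) : itv (headRed ρ) 0 j ≤ itv ρ 0 (j + 1) := by
  refine itv_le fun k h1 h2 => ?_
  match k, h1, h2 with
  | 0, _, _ => exact mem_itv (ρ := ρ) (k := 1) (by omega) (by omega)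
  | 1, _, _ =>
    exact Subgroup.mul_mem _ (mem_itv (ρ := ρ) (k := 0) (by omega) (by omega))
      (mem_itv (ρ := ρ) (k := 2) (by omega) (by omega))
  | k + 2, _, h2 => exact mem_itv (k := k + 3) (by omega) (by omega)

theorem mem_itv_headRed {j k : ℕ} (h0 : ρ 0 ∈ itv (headRed ρ) 1 3)
    (hj : 3 ≤ j) (hk : k ≤ j) (hk1 : k ≠ 1) : ρ k ∈ itv (headRed ρ) 1 j := by
  have h0' := itv_mono le_rfl hj h0
  match k, hk, hk1 with
  | 0, _, _ => exact h0'
  | 2, _, _ =>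
    have : ρ 0 * ρ 2 ∈ itv (headRed ρ) 1 j :=
      mem_itv (ρ := headRed ρ) (k := 1) le_rfl (by omega)
    exact (Subgroup.mul_mem_cancel_left _ h0').1 this
  | k + 3, hk, _ =>
    exact mem_itv (ρ := headRed ρ) (k := k + 2) (by omega) (by omega)

theorem itv_headRed_zero {j : ℕ} (h0 : ρ 0 ∈ itv (headRed ρ) 1 3) (hj : 3 ≤ j) :
    itv (headRed ρ) 0 j = itv ρ 0 (j + 1) := by
  refine le_antisymm (itv_headRed_zero_le (by omega)) (itv_le fun k _ h2 => ?_)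
  by_cases hk : k = 1
  · subst hk
    exact mem_itv (ρ := headRed ρ) (k := 0) le_rfl (by omega)
  · exact itv_mono (Nat.zero_le _) le_rfl (mem_itv_headRed h0 hj (by omega) hk)

theorem IsStringC.headRed (h : IsStringC ρ (r + 1)) (hr : 3 ≤ r)
    (h01 : ¬ Commute (ρ 0) (ρ 1)) (h12 : ¬ Commute (ρ 1) (ρ 2))
    (h0 : ρ 0 ∈ itv (headRed ρ) 1 3) : IsStringC (headRed ρ) r := by
  have c02 : Commute (ρ 0) (ρ 2) := h.comm 0 2 (by omega) (by omega)
  have s0 := h.sq 0 (by omega)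
  have s1 := h.sq 1 (by omega)
  have s2 := h.sq 2 (by omega)
  have sb : ρ 0 * ρ 2 * (ρ 0 * ρ 2) = 1 := by
    rw [mul_assoc, ← mul_assoc (ρ 2), ← c02.eq, mul_assoc, s2, mul_one, s0]
  have d : ∀ {i k : ℕ} {g : G}, i < k → k < r + 1 → g ∈ itv ρ i (i + 1) → g ∈ itv ρ k (k + 1) →
      g = 1 := fun h1 h2 h3 h4 => h.disjoint (by omega) (by omega) (by omega) (by omega) h3 h4
  have mm : ∀ i, ρ i ∈ itv ρ i (i + 1) := fun i => mem_itv le_rfl (by omega)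
  constructor
  · rintro (_ | _ | k) hk
    · exact s1
    · exact sb
    · exact h.sq _ (by omega)
  · rintro (_ | _ | k) hk
    · exact h.ne_one _ (by omega)
    · intro e
      have e2 : ρ 0 = ρ 2 := by
        have : ρ 0 * ρ 2 = 1 := e
        rw [eq_inv_of_mul_eq_one_left this, inv_eq_of_mul_eq_one_left s2]
      exact h.ne_one 0 (by omega) (d (i := 0) (k := 2) (by omega) (by omega) (mm 0) (e2 ▸ mm 2))
    · exact h.ne_one _ (by omega)
  · rintro (_ | _ | i) (_ | _ | j) hij hj <;> try omega
    · exact h.comm 1 (j + 3) (by omega) (by omega)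
    · exact (h.comm 0 (j + 3) (by omega) (by omega)).mul_left
        (h.comm 2 (j + 3) (by omega) (by omega))
    · exact h.comm (i + 3) (j + 3) (by omega) (by omega)
  · intro i j hij hj g hg
    obtain ⟨hg1, hg2⟩ := Subgroup.mem_inf.1 hg
    rcases Nat.lt_or_ge i 2 with hi | hi
    · rcases Nat.eq_zero_or_pos i with rfl | hi0
      · -- `i = 0`
        rcases Nat.lt_or_ge j 3 with hj3 | hj3
        · have h2' := itv_headRed_le (by omega) hg2
          obtain rfl | rfl : j = 1 ∨ j = 2 := by omega
          · have h1' : g ∈ Subgroup.closure (ρ '' {1}) := by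
              refine itv_le (fun k h1 h2 => ?_) hg1
              obtain rfl : k = 0 := by omega
              exact Subgroup.subset_closure ⟨1, rfl, rfl⟩
            have : g ∈ Subgroup.closure (ρ '' ∅) := h.closure_le (by simp; omega)
              (by intro k hk; simp at hk ⊢; omega) (by rintro k ⟨rfl, h⟩; simp at h)
              (Subgroup.mem_inf.2 ⟨h1', h2'⟩)
            rw [Set.image_empty, Subgroup.closure_empty, Subgroup.mem_bot] at this
            exact this ▸ one_mem _
          · have h1' : g ∈ Subgroup.closure {ρ 1, ρ 0 * ρ 2} := by
              refine itv_le (fun k h1 h2 => ?_) hg1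
              obtain rfl | rfl : k = 0 ∨ k = 1 := by omega
              · exact Subgroup.subset_closure (by simp [_root_.headRed])
              · exact Subgroup.subset_closure (by simp [_root_.headRed])
            have h3 : g ∈ Subgroup.closure (ρ '' {0, 2}) := by
              refine h.closure_le ?_ ?_ ?_ (Subgroup.mem_inf.2 ⟨itv_headRed_zero_le (by omega) hg1, h2'⟩)
              · intro k hk; simp at hk ⊢; omega
              · intro k hk; simp at hk ⊢; omega
              · intro k hk; simp at hk ⊢; omega
            have hb : ρ 0 * ρ 2 ∈ itv (_root_.headRed ρ) (0 + 1) 2 :=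
              mem_itv (ρ := _root_.headRed ρ) (k := 1) le_rfl (by omega)
            rw [Set.image_pair] at h3
            have key : ∀ x, Commute x (ρ 0 * ρ 2) → (∃ t : ℤ, x = (ρ 1 * (ρ 0 * ρ 2)) ^ t) →
                Commute x (ρ 1) := by
              rintro x hx ⟨t, rfl⟩
              have h4 : Commute ((ρ 1 * (ρ 0 * ρ 2)) ^ t) (ρ 1 * (ρ 0 * ρ 2)) :=
                Commute.zpow_self _ _
              have h5 := h4.mul_right hx
              rwa [mul_assoc, sb, mul_one] at h5
            have cb0 : Commute (ρ 0) (ρ 0 * ρ 2) := (Commute.refl _).mul_right c02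
            have cb2 : Commute (ρ 2) (ρ 0 * ρ 2) := c02.symm.mul_right (Commute.refl _)
            have no0 : ρ 0 ∉ Subgroup.closure {ρ 1, ρ 0 * ρ 2} := by
              intro hm
              obtain ⟨t, ht | ht⟩ := mem_closure_pair_dihedral s1 sb hm
              · exact h01 (key _ cb0 ⟨t, ht⟩)
              · refine h12 (key _ cb2 ⟨t, ?_⟩).symm
                rw [← mul_one ((ρ 1 * (ρ 0 * ρ 2)) ^ t), ← sb, ← mul_assoc, ← ht, ← mul_assoc, s0,
                  one_mul]
            have no2 : ρ 2 ∉ Subgroup.closure {ρ 1, ρ 0 * ρ 2} := by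
              intro hm
              refine no0 ?_
              have := Subgroup.mul_mem _ (Subgroup.subset_closure
                (show ρ 0 * ρ 2 ∈ ({ρ 1, ρ 0 * ρ 2} : Set G) by simp)) hm
              rwa [mul_assoc, s2, mul_one] at this
            obtain ⟨t, ht⟩ := mem_closure_pair_dihedral s0 s2 h3
            have e4 : ∀ t : ℤ, (ρ 0 * ρ 2) ^ t = 1 ∨ (ρ 0 * ρ 2) ^ t = ρ 0 * ρ 2 := by
              intro t
              have e : (ρ 0 * ρ 2) ^ (2 : ℤ) = 1 := by
                rw [zpow_two, sb]
              rcases Int.even_or_odd' t with ⟨m, rfl | rfl⟩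
              · left; rw [zpow_mul, e, one_zpow]
              · right; rw [zpow_add, zpow_mul, e, one_zpow, one_mul, zpow_one]
            have e5 := e4 t
            have e6 : g = 1 ∨ g = ρ 0 * ρ 2 ∨ g = ρ 2 ∨ g = ρ 0 := by
              rcases ht with ht | ht <;> rcases e5 with e5 | e5 <;> rw [e5] at ht
              · exact Or.inl ht
              · exact Or.inr (Or.inl ht)
              · exact Or.inr (Or.inr (Or.inl (by rw [ht, one_mul])))
              · exact Or.inr (Or.inr (Or.inr (by rw [ht, mul_assoc, s2, mul_one])))
            rcases e6 with rfl | rfl | rfl | rfl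
            · exact one_mem _
            · exact hb
            · exact absurd h1' no2
            · exact absurd h1' no0
        · have h1' := itv_headRed_zero_le (by omega) hg1
          have h2' := itv_headRed_le (by omega) hg2
          have h3 : g ∈ Subgroup.closure (ρ '' {k | k ≤ j ∧ k ≠ 1}) := by
            refine h.closure_le ?_ ?_ ?_ (Subgroup.mem_inf.2 ⟨h1', h2'⟩)
            · intro k hk; simp at hk ⊢; omega
            · intro k hk; simp at hk ⊢; omega
            · intro k hk; simp at hk ⊢; omega
          refine (Subgroup.closure_le _).2 ?_ h3
          rintro _ ⟨k, hk, rfl⟩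
          exact mem_itv_headRed h0 hj3 hk.1 hk.2
      · obtain rfl : i = 1 := by omega
        have h1' := itv_headRed_le (by omega) hg1
        have h2' := itv_headRed_two_le (by omega) hg2
        have h3 : g ∈ itv ρ 3 (j + 1) := by
          refine h.closure_le ?_ ?_ ?_ (Subgroup.mem_inf.2 ⟨h1', h2'⟩)
          · intro k hk; simp at hk ⊢; omega
          · intro k hk; simp at hk ⊢; omega
          · intro k hk; simp at hk ⊢; omega
        refine itv_le (fun k h1 h2 => ?_) h3
        obtain ⟨k, rfl⟩ := Nat.exists_eq_add_of_le' h1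
        exact mem_itv (ρ := _root_.headRed ρ) (k := k + 2) (by omega) (by omega)
    · have h3 := h.inter (i + 1) (j + 1) (by omega) (by omega)
        (Subgroup.mem_inf.2 ⟨itv_headRed_two_le hi hg1, itv_headRed_two_le (by omega) hg2⟩)
      refine itv_le (fun k h1 h2 => ?_) h3
      obtain ⟨k, rfl⟩ := Nat.exists_eq_add_of_le' (show 3 ≤ k by omega)
      exact mem_itv (ρ := _root_.headRed ρ) (k := k + 2) (by omega) (by omega)

/-- `ρ` generates `H` as a string C-group of rank `r`. -/
def StringCGen (H : Subgroup G) (r : ℕ) : Prop :=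
  ∃ ρ : ℕ → G, IsStringC ρ r ∧ itv ρ 0 r = H

theorem IsStringC.ne (h : IsStringC ρ r) {i j : ℕ} (hij : i < j) (hj : j < r) : ρ i ≠ ρ j :=
  fun e => h.ne_one i (by omega) (h.disjoint (i := i) (j := i + 1) (k := j) (l := j + 1)
    (by omega) (by omega) (by omega) (by omega) (mem_itv le_rfl (by omega))
    (e ▸ mem_itv le_rfl (by omega)))

theorem IsStringC.not_commute (h : IsStringC ρ r) {i j k : ℕ} (hij : i < j) (hj : j < r)
    (ho : (ρ i * ρ j) ^ (2 * k + 1) = 1) : ¬ Commute (ρ i) (ρ j) := by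
  intro hc
  refine h.ne hij hj ?_
  have h2 : (ρ i * ρ j) ^ 2 = 1 := by
    rw [hc.mul_pow, pow_two, pow_two, h.sq i (by omega), h.sq j hj, one_mul]
  rw [pow_succ, pow_mul, h2, one_pow, one_mul] at ho
  rw [eq_inv_of_mul_eq_one_left ho, inv_eq_of_mul_eq_one_left (h.sq j hj)]

theorem IsStringC.stringCGen_of_le (h : IsStringC ρ r)
    (h01 : ¬ Commute (ρ 0) (ρ 1)) (h12 : ¬ Commute (ρ 1) (ρ 2))
    (ho : ∀ i, 2 ≤ i → i + 1 < r → (ρ i * ρ (i + 1)) ^ 3 = 1) {s : ℕ} (hs : 3 ≤ s) (hsr : s ≤ r) :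
    StringCGen (itv ρ 0 r) s := by
  obtain ⟨d, rfl⟩ := Nat.exists_eq_add_of_le hsr
  clear hsr
  induction d generalizing ρ with
  | zero => exact ⟨ρ, h, rfl⟩
  | succ d ih =>
    have c02 := h.comm 0 2 (by omega) (by omega)
    have c03 := h.comm 0 3 (by omega) (by omega)
    have h0 := headRed_mem (k := 1) c02 c03 (h.sq 0 (by omega)) (ho 2 (by omega) (by omega))
    have h' := IsStringC.headRed (r := s + d) h (by omega) h01 h12 h0
    rw [show s + (d + 1) = s + d + 1 by omega, ← itv_headRed_zero h0 (by omega)]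
    refine ih ?_ ?_ h' ?_
    · intro hc
      have hc : Commute (ρ 1) (ρ 0 * ρ 2) := hc
      refine h01 ?_
      have e1 : ρ 1 * ρ 0 * ρ 1 * ρ 0 = ρ 1 * ρ 2 * ρ 1 * ρ 2 := by
        have s0 := h.sq 0 (by omega)
        have s1 := h.sq 1 (by omega)
        have s2 := h.sq 2 (by omega)
        have e : ρ 0 * ρ 1 * ρ 0 = ρ 2 * ρ 1 * ρ 2 := by
          calc ρ 0 * ρ 1 * ρ 0 = ρ 0 * (ρ 1 * (ρ 0 * ρ 2)) * ρ 2 := by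
                simp [mul_assoc, s2]
            _ = (ρ 0 * ρ 0) * ρ 2 * ρ 1 * ρ 2 := by rw [hc.eq]; simp only [mul_assoc]
            _ = _ := by rw [s0, one_mul]
        calc ρ 1 * ρ 0 * ρ 1 * ρ 0 = ρ 1 * (ρ 0 * ρ 1 * ρ 0) := by simp only [mul_assoc]
          _ = _ := by rw [e]; simp only [mul_assoc]
      have m1 : ρ 1 * ρ 0 * ρ 1 * ρ 0 ∈ itv ρ 0 2 := by
        have a0 : ρ 0 ∈ itv ρ 0 2 := mem_itv (by omega) (by omega)
        have a1 : ρ 1 ∈ itv ρ 0 2 := mem_itv (by omega) (by omega)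
        exact Subgroup.mul_mem _ (Subgroup.mul_mem _ (Subgroup.mul_mem _ a1 a0) a1) a0
      have m2 : ρ 1 * ρ 0 * ρ 1 * ρ 0 ∈ itv ρ 1 3 := by
        have a0 : ρ 2 ∈ itv ρ 1 3 := mem_itv (by omega) (by omega)
        have a1 : ρ 1 ∈ itv ρ 1 3 := mem_itv (by omega) (by omega)
        rw [e1]
        exact Subgroup.mul_mem _ (Subgroup.mul_mem _ (Subgroup.mul_mem _ a1 a0) a1) a0
      have m3 := h.inter 0 2 (by omega) (by omega) (Subgroup.mem_inf.2 ⟨m1, m2⟩)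
      have s0 := h.sq 0 (by omega)
      have s1 := h.sq 1 (by omega)
      rcases (mem_itv_one s1).1 m3 with e | e
      · have : ρ 0 * ρ 1 * ρ 0 * ρ 1 = 1 := by
          have : ρ 0 * ρ 1 * ρ 0 * ρ 1 = ρ 1 * (ρ 1 * ρ 0 * ρ 1 * ρ 0) * ρ 1 := by
            calc _ = (ρ 0 * ρ 1 * ρ 0) * ρ 1 := by group
              _ = (ρ 1 * ρ 1) * (ρ 0 * ρ 1 * ρ 0) * ρ 1 := by rw [s1, one_mul]
              _ = _ := by group
          rw [this, e, mul_one, s1]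
        have i0 : (ρ 0)⁻¹ = ρ 0 := inv_eq_of_mul_eq_one_left s0
        have i1 : (ρ 1)⁻¹ = ρ 1 := inv_eq_of_mul_eq_one_left s1
        change ρ 0 * ρ 1 = ρ 1 * ρ 0
        rw [mul_assoc] at this
        rw [eq_inv_of_mul_eq_one_left this, mul_inv_rev, i0, i1]
      · exfalso
        -- `ρ 0 * ρ 1 * ρ 0 = 1`
        have e : ρ 0 * ρ 1 * ρ 0 = 1 := by
          have : ρ 1 * (ρ 0 * ρ 1 * ρ 0) = ρ 1 := by rw [← mul_assoc, ← mul_assoc]; exact e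
          exact mul_eq_left.1 this
        have : ρ 1 = 1 := by
          have : ρ 1 = ρ 0 * (ρ 0 * ρ 1 * ρ 0) * ρ 0 := by
            calc ρ 1 = (ρ 0 * ρ 0) * ρ 1 * (ρ 0 * ρ 0) := by rw [s0]; simp
              _ = _ := by group
          rw [this, e, mul_one, s0]
        exact h.ne_one 1 (by omega) this
    · intro hc
      have hc : Commute (ρ 0 * ρ 2) (ρ 3) := hc
      refine h.not_commute (i := 2) (j := 3) (k := 1) (by omega) (by omega)
        (ho 2 (by omega) (by omega)) ?_
      have := c03.mul_left hc
      rwa [← mul_assoc, h.sq 0 (by omega), one_mul] at this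
    · intro i h1 h2
      obtain ⟨i, rfl⟩ := Nat.exists_eq_add_of_le' h1
      exact ho (i + 3) (by omega) (by omega)

theorem itv_reverse {i j : ℕ} (hj : j ≤ r) :
    itv (fun k => ρ (r - 1 - k)) i j = itv ρ (r - j) (r - i) := by
  apply le_antisymm
  · exact itv_le fun k h1 h2 => mem_itv (by omega) (by omega)
  · refine itv_le fun k h1 h2 => ?_
    have := mem_itv (ρ := fun k => ρ (r - 1 - k)) (i := i) (j := j) (k := r - 1 - k)
      (by omega) (by omega)
    simpa [show r - 1 - (r - 1 - k) = k by omega] using this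

theorem IsStringC.reverse (h : IsStringC ρ r) : IsStringC (fun k => ρ (r - 1 - k)) r where
  sq i hi := h.sq _ (by omega)
  ne_one i hi := h.ne_one _ (by omega)
  comm i j h1 h2 := (h.comm _ _ (by omega) (by omega)).symm
  inter i j h1 h2 := by
    rw [itv_reverse (by omega), itv_reverse (by omega), itv_reverse (by omega)]
    have := h.inter (r - (j + 1)) (r - (i + 1)) (by omega) (by omega)
    rw [show r - (j + 1) + 1 = r - j by omega, show r - (i + 1) + 1 = r - i by omega] at this
    rwa [inf_comm]

theorem IsStringC.tailRed (h : IsStringC ρ (r + 4))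
    (h01 : ¬ Commute (ρ (r + 3)) (ρ (r + 2))) (h12 : ¬ Commute (ρ (r + 2)) (ρ (r + 1))) {k : ℕ}
    (ho : (ρ (r + 1) * ρ r) ^ (2 * k + 1) = 1) : StringCGen (itv ρ 0 (r + 4)) (r + 3) := by
  have h' := h.reverse
  have h0 := headRed_mem (ρ := fun k => ρ (r + 4 - 1 - k)) (k := k) (h'.comm 0 2 (by omega) (by omega))
    (h'.comm 0 3 (by omega) (by omega)) (h'.sq 0 (by omega)) (by simpa using ho)
  refine ⟨_, IsStringC.headRed (r := r + 3) h' (by omega) (by simpa using h01)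
    (by simpa using h12) h0, ?_⟩
  rw [itv_headRed_zero h0 (by omega), itv_reverse (by omega)]
  simp

end Reduction

section Transport

variable {G : Type*} [Group G]

theorem StringCGen.exists_rep {H : Subgroup G} {r : ℕ} (h : StringCGen H r) {K : Type*} [Group K]
    (f : K ≃* H) : ∃ ρ : Fin r → K, IsStringCGroupRep ρ := by
  obtain ⟨ρ, h, rfl⟩ := h
  let σ : Fin r → itv ρ 0 r := fun i => ⟨ρ i, mem_itv (Nat.zero_le _) i.2⟩
  let φ : K →* G := (itv ρ 0 r).subtype.comp f.toMonoidHom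
  have hφ : Function.Injective φ := (itv ρ 0 r).subtype_injective.comp f.injective
  have hval : ∀ i, φ (f.symm (σ i)) = ρ i := fun i => by simp [φ, σ]
  have himg : ∀ I : Set (Fin r), φ '' ((fun i => f.symm (σ i)) '' I) = ρ '' (Fin.val '' I) := by
    intro I
    simp only [Set.image_image, hval]
  have hcl : ∀ I : Set (Fin r), (Subgroup.closure ((fun i => f.symm (σ i)) '' I)).map φ =
      Subgroup.closure (ρ '' (Fin.val '' I)) := by
    intro I
    rw [MonoidHom.map_closure, himg]
  refine ⟨fun i => f.symm (σ i), fun i => ?_, ?_, fun i j hij => ?_, fun I J => ?_⟩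
  · rw [← orderOf_injective φ hφ, hval]
    exact orderOf_eq_prime (by rw [pow_two, h.sq i i.2]) (h.ne_one i i.2)
  · apply Subgroup.map_injective hφ
    rw [← Set.image_univ, hcl, Set.image_univ, Fin.range_val, ← MonoidHom.range_eq_map]
    have : φ.range = itv ρ 0 r := by
      rw [MonoidHom.range_comp, MonoidHom.range_eq_top.2 (show Function.Surjective f.toMonoidHom from
        f.surjective), ← MonoidHom.range_eq_map, Subgroup.range_subtype]
    rw [this, itv]
    congr 2
    ext; simp
  · apply hφ
    simp only [map_mul, hval]
    exact h.comm i j hij j.2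
  · apply Subgroup.map_injective hφ
    rw [Subgroup.map_inf _ _ _ hφ, hcl, hcl, hcl]
    refine le_antisymm (h.closure_le ?_ ?_ ?_) (le_inf ?_ ?_)
    · rintro _ ⟨i, _, rfl⟩; exact i.2
    · rintro _ ⟨i, _, rfl⟩; exact i.2
    · rw [Set.image_inter Fin.val_injective]
    · exact Subgroup.closure_mono (Set.image_mono (Set.image_mono Set.inter_subset_left))
    · exact Subgroup.closure_mono (Set.image_mono (Set.image_mono Set.inter_subset_right))

theorem StringCGen.exists_rep_fin {α : Type*} [Fintype α] [DecidableEq α] {r n : ℕ}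
    (h : StringCGen (alternatingGroup α) r) (hn : Fintype.card α = n) :
    ∃ ρ : Fin r → alternatingGroup (Fin n), IsStringCGroupRep ρ :=
  h.exists_rep (Equiv.altCongrHom (Fintype.equivFinOfCardEq hn)).symm

end Transport

section Symmetric

/-- The transposition of the adjacent points `i - 1` and `i` of `Fin M`. -/
def adj (M i : ℕ) : Perm (Fin M) :=
  if h : 0 < i ∧ i < M then swap ⟨i - 1, by omega⟩ ⟨i, h.2⟩ else 1

variable {M : ℕ}

theorem adj_eq {i : ℕ} (h0 : 0 < i) (h : i < M) : adj M i = swap ⟨i - 1, by omega⟩ ⟨i, h⟩ :=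
  dif_pos ⟨h0, h⟩

theorem adj_mul_self (i : ℕ) : adj M i * adj M i = 1 := by
  unfold adj; split_ifs <;> simp

theorem adj_apply_of_ne {i : ℕ} {x : Fin M} (h1 : (x : ℕ) + 1 ≠ i) (h2 : (x : ℕ) ≠ i) :
    adj M i x = x := by
  unfold adj
  split_ifs with h
  · exact swap_apply_of_ne_of_ne (fun e => h1 (by rw [e]; simp; omega)) (fun e => h2 (by rw [e]))
  · rfl

theorem adj_commute {i j : ℕ} (h : i + 1 < j) : Commute (adj M i) (adj M j) := by
  by_cases hj : j < M
  · rcases Nat.eq_zero_or_pos i with rfl | hi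
    · rw [adj, dif_neg (by omega)]; exact Commute.one_left _
    · rw [adj_eq hi (by omega), adj_eq (by omega) hj]
      refine Disjoint.commute fun x => ?_
      by_cases hx : (x : ℕ) ≤ i
      · right; apply swap_apply_of_ne_of_ne <;> (intro e; subst e; simp at hx; omega)
      · left; apply swap_apply_of_ne_of_ne <;> (intro e; subst e; simp at hx; try omega)
  · rw [show adj M j = 1 from dif_neg (by omega)]; exact Commute.one_right _

theorem swap_mem_itv_adj {a b : ℕ} (x y : ℕ) (hx : x < M) (hy : y < M) (hxa : a ≤ x + 1) 
    (hxy : x < y) (hyb : y < b) :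
    swap (⟨x, hx⟩ : Fin M) ⟨y, hy⟩ ∈ itv (adj M) a b := by
  induction y, hxy using Nat.le_induction with
  | base =>
    have := mem_itv (ρ := adj M) (i := a) (j := b) (k := x + 1) (by omega) (by omega)
    rwa [adj_eq (by omega) hy] at this
  | succ y hxy ih =>
    have h1 := ih (by omega) (by omega)
    have h2 := mem_itv (ρ := adj M) (i := a) (j := b) (k := y + 1) (by omega) (by omega)
    rw [adj_eq (by omega) hy] at h2
    have := Subgroup.mul_mem _ (Subgroup.mul_mem _ h2 h1) (Subgroup.inv_mem _ h2)
    rw [← swap_apply_apply] at this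
    simp only [Nat.add_sub_cancel] at this
    rwa [swap_apply_left, swap_apply_of_ne_of_ne] at this
    · intro e; simp at e; omega
    · intro e; simp at e; omega

/-- A permutation fixing all points outside `[a - 1, b - 1]` is generated by the adjacent
transpositions within. -/
theorem mem_itv_adj {a b : ℕ} {σ : Perm (Fin M)} (h1 : ∀ x : Fin M, (x : ℕ) + 1 < a → σ x = x)
    (h2 : ∀ x : Fin M, b ≤ (x : ℕ) → σ x = x) : σ ∈ itv (adj M) a b := by
  induction hn : σ.support.card using Nat.strong_induction_on generalizing σ with
  | _ n ih =>
    by_cases hσ : σ = 1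
    · exact hσ ▸ one_mem _
    obtain ⟨x, hx⟩ : ∃ x, σ x ≠ x := by
      by_contra! h; exact hσ (Equiv.ext h)
    have hlt := card_support_swap_mul hx
    have hsw : ∀ x y : Fin M, σ x ≠ x → σ y ≠ y → x ≠ y → swap x y ∈ itv (adj M) a b := by
      intro x y hx hy hxy
      have hxa : ¬ (x : ℕ) + 1 < a := fun h => hx (h1 _ h)
      have hya : ¬ (y : ℕ) + 1 < a := fun h => hy (h1 _ h)
      have hxb : ¬ b ≤ (x : ℕ) := fun h => hx (h2 _ h)
      have hyb : ¬ b ≤ (y : ℕ) := fun h => hy (h2 _ h)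
      rcases lt_or_gt_of_ne (fun e : (x : ℕ) = y => hxy (Fin.ext e)) with h | h
      · exact swap_mem_itv_adj x y x.2 y.2 (by omega) h (by omega)
      · rw [swap_comm]; exact swap_mem_itv_adj y x y.2 x.2 (by omega) h (by omega)
    have hs := hsw x (σ x) hx (fun h => hx (σ.injective h)) (Ne.symm hx)
    have key : ∀ z, σ z = z → (swap x (σ x) * σ) z = z := by
      intro z hz
      rw [Perm.mul_apply, hz, swap_apply_of_ne_of_ne]
      · rintro rfl; exact hx hz
      · rintro rfl; exact hx (σ.injective hz)
    have := ih _ (hn ▸ hlt) (σ := swap x (σ x) * σ) (fun z hz => key z (h1 z hz))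
      (fun z hz => key z (h2 z hz)) rfl
    exact (Subgroup.mul_mem_cancel_left _ hs).1 this

theorem itv_adj_fix_ge {a b : ℕ} {σ : Perm (Fin M)} (h : σ ∈ itv (adj M) a b) (x : Fin M)
    (hx : b ≤ (x : ℕ)) : σ x = x := by
  have : itv (adj M) a b ≤ MulAction.stabilizer (Perm (Fin M)) x :=
    itv_le fun k h1 h2 => adj_apply_of_ne (by omega) (by omega)
  exact this h

theorem itv_adj_fix_lt {a b : ℕ} {σ : Perm (Fin M)} (h : σ ∈ itv (adj M) a b) (x : Fin M)
    (hx : (x : ℕ) + 1 < a) : σ x = x := by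
  have : itv (adj M) a b ≤ MulAction.stabilizer (Perm (Fin M)) x :=
    itv_le fun k h1 h2 => adj_apply_of_ne (by omega) (by omega)
  exact this h

theorem adj_braid {i : ℕ} (hi : 0 < i) (h : i + 1 < M) : (adj M i * adj M (i + 1)) ^ 3 = 1 := by
  have := (isThreeCycle_swap_mul_swap_same (a := (⟨i, by omega⟩ : Fin M)) (b := ⟨i - 1, by omega⟩)
    (c := ⟨i + 1, h⟩) ?_ ?_ ?_).orderOf
  · have e : adj M i * adj M (i + 1) = swap (⟨i, by omega⟩ : Fin M) ⟨i - 1, by omega⟩ *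
        swap ⟨i, by omega⟩ ⟨i + 1, h⟩ := by
      rw [adj_eq hi (by omega), adj_eq (by omega) h, swap_comm (⟨i, by omega⟩ : Fin M) ⟨i - 1, by omega⟩]
      rfl
    rw [e, ← this, pow_orderOf_eq_one]
  all_goals (intro e; simp at e; try omega)

end Symmetric

section Head

variable {G : Type*} [Group G] {M : ℕ} {φ : Perm (Fin M) →* G} {c : G} {ρ : ℕ → G}

/-- Symmetric-group generators, the first one twisted by a commuting involution `c`. -/
structure TwistedSym (φ : Perm (Fin M) →* G) (c : G) (ρ : ℕ → G) : Prop where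
  inj : Function.Injective φ
  three_le : 3 ≤ M
  sq : c * c = 1
  comm : ∀ σ, Commute c (φ σ)
  one : ρ 1 = φ (adj M 1) * c
  two : ∀ i, 2 ≤ i → i < M → ρ i = φ (adj M i)

namespace TwistedSym

variable (h : TwistedSym φ c ρ)
include h

theorem adj_one_ne_two : ¬ Commute (adj M 1) (adj M 2) := by
  have h3 := h.three_le
  intro hc
  have e := congrArg (fun f => f ⟨0, by omega⟩) hc.eq
  rw [adj_eq (by omega) (by omega), adj_eq (by omega) (by omega)] at e
  simp [swap_apply_def, Fin.ext_iff] at e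

theorem eq_one_of_central {σ : Perm (Fin M)} (hσ : ∀ τ, Commute (φ σ) (φ τ)) : σ = 1 := by
  have h3 := h.three_le
  have h1 : ∀ τ, σ * τ = τ * σ := fun τ => h.inj (by rw [map_mul, map_mul, (hσ τ).eq])
  ext x
  by_contra hne
  obtain ⟨y, hy1, hy2⟩ : ∃ y, y ≠ x ∧ y ≠ σ x := by
    have : (({x, σ x} : Finset (Fin M))ᶜ).Nonempty := by
      rw [← Finset.card_pos, Finset.card_compl, Fintype.card_fin]
      have := Finset.card_le_two (a := x) (b := σ x)
      omega
    obtain ⟨y, hy⟩ := this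
    simp at hy
    exact ⟨y, hy.1, hy.2⟩
  have e := congrArg (fun f => f x) (h1 (swap x y))
  simp only [Perm.mul_apply, swap_apply_left] at e
  rw [swap_apply_of_ne_of_ne (fun e => hne (by rw [e]; rfl)) hy2.symm] at e
  exact hy1 (σ.injective e)

theorem eq_one_of_twist {σ τ : Perm (Fin M)} (e : φ σ = φ τ * c) : σ = τ ∧ c = 1 := by
  have e1 : c = φ (τ⁻¹ * σ) := by rw [map_mul, e, map_inv, inv_mul_cancel_left]
  have e2 : τ⁻¹ * σ = 1 := h.eq_one_of_central fun τ' => by rw [← e1]; exact h.comm τ'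
  rw [e2, map_one] at e1
  exact ⟨(inv_mul_eq_one.1 e2).symm, e1⟩

theorem rho_sq {i : ℕ} (h1 : 1 ≤ i) (h2 : i < M) : ρ i * ρ i = 1 := by
  rcases h1.eq_or_lt with rfl | h1
  · rw [h.one, mul_assoc, ← mul_assoc c, (h.comm _).eq, mul_assoc, h.sq, mul_one, ← map_mul,
      adj_mul_self, map_one]
  · rw [h.two i h1 h2, ← map_mul, adj_mul_self, map_one]

theorem itv_two {i j : ℕ} (hi : 2 ≤ i) (hj : j ≤ M) : itv ρ i j = (itv (adj M) i j).map φ := by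
  rw [itv, itv, MonoidHom.map_closure, Set.image_image]
  congr 1
  exact Set.image_congr fun k hk => h.two k (by have := hk.1; omega) (by have := hk.2; omega)

theorem exists_of_mem {j : ℕ} (hj : j ≤ M) {g : G} (hg : g ∈ itv ρ 1 j) :
    ∃ σ ∈ itv (adj M) 1 j, g = φ σ ∨ g = φ σ * c := by
  have hci : c⁻¹ = c := inv_eq_of_mul_eq_one_left h.sq
  refine Subgroup.closure_induction (p := fun g _ =>
    ∃ σ ∈ itv (adj M) 1 j, g = φ σ ∨ g = φ σ * c) ?_ ⟨1, one_mem _, by simp⟩ ?_ ?_ hg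
  · rintro _ ⟨k, ⟨h1, h2⟩, rfl⟩
    refine ⟨adj M k, mem_itv h1 h2, ?_⟩
    rcases h1.eq_or_lt with rfl | h1
    · exact Or.inr h.one
    · exact Or.inl (h.two k h1 (by omega))
  · rintro a b - - ⟨σ, hσ, ha⟩ ⟨τ, hτ, hb⟩
    refine ⟨σ * τ, mul_mem hσ hτ, ?_⟩
    rw [map_mul]
    rcases ha with rfl | rfl <;> rcases hb with rfl | rfl
    · exact Or.inl rfl
    · exact Or.inr (mul_assoc _ _ _).symm
    · exact Or.inr (by rw [mul_assoc, (h.comm τ).eq, mul_assoc])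
    · exact Or.inl (by rw [mul_assoc, ← mul_assoc c, (h.comm τ).eq, mul_assoc, h.sq, mul_one])
  · rintro a - ⟨σ, hσ, ha⟩
    refine ⟨σ⁻¹, inv_mem hσ, ?_⟩
    rcases ha with rfl | rfl
    · exact Or.inl (map_inv _ _).symm
    · exact Or.inr (by rw [mul_inv_rev, hci, ← map_inv, (h.comm _).eq])

theorem c_mem {j : ℕ} (hj : 3 ≤ j) : c ∈ itv ρ 1 j := by
  have h3 := h.three_le
  have e : c = (ρ 1 * ρ 2) ^ 3 := by
    rw [h.one, h.two 2 le_rfl h3, mul_assoc, (h.comm _).eq, ← mul_assoc, ← map_mul,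
      (h.comm _).symm.mul_pow, ← map_pow, adj_braid one_pos h3, map_one, one_mul, pow_succ,
      pow_two, h.sq, one_mul]
  rw [e]
  exact Subgroup.pow_mem _ (Subgroup.mul_mem _ (mem_itv le_rfl (by omega))
    (mem_itv (by omega) (by omega))) _

theorem map_le {j : ℕ} (hj : 3 ≤ j) (hjM : j ≤ M) : (itv (adj M) 1 j).map φ ≤ itv ρ 1 j := by
  rw [Subgroup.map_le_iff_le_comap]
  refine itv_le fun k h1 h2 => Subgroup.mem_comap.2 ?_
  rcases h1.eq_or_lt with rfl | h1
  · have := mem_itv (ρ := ρ) (i := 1) (j := j) (k := 1) le_rfl h2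
    rw [h.one] at this
    exact (Subgroup.mul_mem_cancel_right _ (h.c_mem hj)).1 this
  · rw [← h.two k h1 (by omega)]
    exact mem_itv (by omega) h2

theorem inter_upper {i j : ℕ} (hi : 1 ≤ i) (hij : i < j) (hj : j < M) :
    itv ρ i j ⊓ itv ρ (i + 1) (j + 1) ≤ itv ρ (i + 1) j := by
  intro g hg
  obtain ⟨hg1, hg2⟩ := Subgroup.mem_inf.1 hg
  rw [h.itv_two (by omega) (by omega)] at hg2
  obtain ⟨τ, hτ, rfl⟩ := hg2
  rw [h.itv_two (by omega) (by omega)]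
  refine ⟨τ, ?_, rfl⟩
  have : τ ∈ itv (adj M) i j := by
    rcases hi.eq_or_lt with rfl | hi
    · obtain ⟨σ, hσ, e | e⟩ := h.exists_of_mem (by omega) hg1
      · rwa [h.inj e]
      · rwa [(h.eq_one_of_twist e).1]
    · rw [h.itv_two hi (by omega)] at hg1
      obtain ⟨σ, hσ, e⟩ := hg1
      rwa [← h.inj e]
  exact mem_itv_adj (fun x hx => itv_adj_fix_lt hτ x hx) (fun x hx => itv_adj_fix_ge this x hx)

theorem isStringC (s0 : ρ 0 * ρ 0 = 1) (n0 : ρ 0 ≠ 1)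
    (h0 : ∀ i, 2 ≤ i → i < M → Commute (ρ 0) (ρ i))
    (hne : ∀ j, 3 ≤ j → j < M → φ (adj M j) ∉ itv ρ 0 j)
    (h2 : itv ρ 0 2 ⊓ itv ρ 1 3 ≤ itv ρ 1 2) : IsStringC ρ M where
  sq i hi := by
    rcases Nat.eq_zero_or_pos i with rfl | h1
    · exact s0
    · exact h.rho_sq h1 hi
  ne_one i hi := by
    rcases Nat.eq_zero_or_pos i with rfl | h1
    · exact n0
    intro e
    have h3 := h.three_le
    rcases (show 1 ≤ i from h1).eq_or_lt with rfl | h1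
    · have := h.eq_one_of_twist (σ := 1) (τ := adj M 1) (by rw [map_one, ← h.one]; exact e.symm)
      apply h.adj_one_ne_two
      rw [← this.1]; exact Commute.one_left _
    · rw [h.two i h1 hi, ← φ.map_one] at e
      have := h.inj e
      rw [adj_eq (by omega) hi, swap_eq_one_iff] at this
      simp at this; omega
  comm i j hij hj := by
    rcases Nat.eq_zero_or_pos i with rfl | h1
    · exact h0 j (by omega) hj
    · rw [h.two j (by omega) hj]
      have := (adj_commute (M := M) hij).map φ
      rcases (show 1 ≤ i from h1).eq_or_lt with rfl | h1
      · rw [h.one]; exact this.mul_left (h.comm _)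
      · rwa [h.two i h1 (by omega)]
  inter i j hij hj := by
    have h3 := h.three_le
    rcases Nat.eq_zero_or_pos i with rfl | h1
    · obtain rfl | rfl | hj3 : j = 1 ∨ j = 2 ∨ 3 ≤ j := by omega
      · intro g hg
        obtain ⟨hg1, hg2⟩ := Subgroup.mem_inf.1 hg
        rcases (mem_itv_one s0).1 hg1 with rfl | rfl
        · exact one_mem _
        · rcases (mem_itv_one (h.rho_sq le_rfl (by omega))).1 hg2 with e | e
          · exact absurd e n0
          · exfalso
            have hc := h0 2 le_rfl (by omega)
            rw [e, h.one, h.two 2 le_rfl h3] at hc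
            have e2 : φ (adj M 1 * adj M 2) = φ (adj M 2 * adj M 1) := by
              rw [map_mul, map_mul]
              have : φ (adj M 1) = φ (adj M 1) * c * c := by rw [mul_assoc, h.sq, mul_one]
              rw [this]
              exact (hc.mul_left (h.comm _)).eq
            exact h.adj_one_ne_two (h.inj e2)
      · exact h2
      · intro g hg
        obtain ⟨hg1, hg2⟩ := Subgroup.mem_inf.1 hg
        obtain ⟨σ, hσ, e⟩ := h.exists_of_mem (by omega) hg2
        have hle : itv ρ 1 j ≤ itv ρ 0 j := itv_mono (by omega) le_rfl
        have hgσ : φ σ ∈ itv ρ 0 j ∧ (φ σ ∈ itv ρ (0 + 1) j → g ∈ itv ρ (0 + 1) j) := by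
          rcases e with rfl | rfl
          · exact ⟨hg1, id⟩
          · exact ⟨(Subgroup.mul_mem_cancel_right _ (hle (h.c_mem hj3))).1 hg1,
              fun h' => Subgroup.mul_mem _ h' (h.c_mem hj3)⟩
        refine hgσ.2 (h.map_le hj3 (by omega) ⟨σ, ?_, rfl⟩)
        by_cases hfix : σ ⟨j, hj⟩ = ⟨j, hj⟩
        · refine mem_itv_adj (fun x hx => by omega) fun x hx => ?_
          rcases hx.eq_or_lt with hx | hx
          · rwa [show x = ⟨j, hj⟩ from Fin.ext hx.symm]
          · exact itv_adj_fix_ge hσ x hx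
        · exfalso
          apply hne j hj3 hj
          -- conjugate a transposition of `Sym {0, …, j - 1}` by `σ`
          set J : Fin M := ⟨j, hj⟩
          have hlow : ∀ x : Fin M, x ≠ J → (x : ℕ) ≤ j → (x : ℕ) < j := fun x hx hx' =>
            lt_of_le_of_ne hx' fun e => hx (Fin.ext e)
          have hle' : ∀ x : Fin M, (x : ℕ) ≤ j → ((σ x : Fin M) : ℕ) ≤ j := by
            intro x hx
            by_contra hcon
            have := itv_adj_fix_ge hσ (σ x) (by omega)
            have := σ.injective this
            rw [this] at hcon
            omega
          have hle'' : ∀ x : Fin M, ((σ x : Fin M) : ℕ) ≤ j → (x : ℕ) ≤ j := by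
            intro x hx
            by_contra hcon
            rw [itv_adj_fix_ge hσ x (by omega)] at hx
            omega
          have hsw : ∀ x y : Fin M, (x : ℕ) < j → (y : ℕ) < j → φ (swap x y) ∈ itv ρ 0 j := by
            intro x y hx hy
            refine hle (h.map_le hj3 (by omega) ⟨_, ?_, rfl⟩)
            refine mem_itv_adj (fun x hx => by omega) fun z hz => swap_apply_of_ne_of_ne ?_ ?_
            · rintro rfl; omega
            · rintro rfl; omega
          set a := σ.symm J with ha
          have haJ : σ a = J := σ.apply_symm_apply J
          have ha1 : (a : ℕ) < j := by
            refine hlow a (fun e => hfix ?_) (hle'' a (by rw [haJ]))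
            rw [← e]; rw [haJ, e]
          obtain ⟨b, hb1, hb2⟩ : ∃ b : Fin M, (b : ℕ) < j ∧ b ≠ a := by
            by_cases h0 : (a : ℕ) = 0
            · exact ⟨⟨1, by omega⟩, by simp; omega, fun e => by rw [← e] at h0; simp at h0⟩
            · exact ⟨⟨0, by omega⟩, by simp; omega, fun e => h0 (by rw [← e])⟩
          have hd : (σ b : ℕ) < j := hlow _ (fun e => hb2 (σ.injective (e.trans haJ.symm)))
            (hle' b hb1.le)
          have m1 : φ (swap J (σ b)) ∈ itv ρ 0 j := by
            have := Subgroup.mul_mem _ (Subgroup.mul_mem _ hgσ.1 (hsw a b ha1 hb1))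
              (Subgroup.inv_mem _ hgσ.1)
            rwa [← map_inv, ← map_mul, ← map_mul, ← swap_apply_apply, haJ] at this
          have m2 := hsw (σ b) ⟨j - 1, by omega⟩ hd (by simp; omega)
          have m3 := Subgroup.mul_mem _ (Subgroup.mul_mem _ m2 m1) (Subgroup.inv_mem _ m2)
          rw [← map_inv, ← map_mul, ← map_mul, ← swap_apply_apply, swap_apply_left,
            swap_apply_of_ne_of_ne, swap_comm] at m3
          · rwa [adj_eq (by omega) hj]
          · intro e; rw [← e] at hd; simp [J] at hd
          · intro e; have := congrArg Fin.val e; simp [J] at this; omega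
    · exact h.inter_upper h1 hij hj

end TwistedSym

end Head

section Linked

variable {α : Type*} [DecidableEq α]

/-- The map `x ↦ y ↦ z ↦ x`. -/
def cyc (x y z : α) : Perm α := swap x y * swap y z

theorem conj_cyc (g : Perm α) (x y z : α) : g * cyc x y z * g⁻¹ = cyc (g x) (g y) (g z) := by
  unfold cyc
  rw [swap_apply_apply, swap_apply_apply]
  group

theorem cyc_apply_left {x y z : α} (hxy : x ≠ y) (hxz : x ≠ z) : cyc x y z x = y := by
  rw [cyc, Perm.mul_apply, swap_apply_of_ne_of_ne hxy hxz, swap_apply_left]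

theorem cyc_apply_mid {x y z : α} (hxz : x ≠ z) (hyz : y ≠ z) : cyc x y z y = z := by
  rw [cyc, Perm.mul_apply, swap_apply_left, swap_apply_of_ne_of_ne hxz.symm hyz.symm]

theorem cyc_apply_right {x y z : α} : cyc x y z z = x := by
  rw [cyc, Perm.mul_apply, swap_apply_right, swap_apply_right]

theorem cyc_apply_of_ne {x y z w : α} (hx : w ≠ x) (hy : w ≠ y) (hz : w ≠ z) : cyc x y z w = w := by
  rw [cyc, Perm.mul_apply, swap_apply_of_ne_of_ne hy hz, swap_apply_of_ne_of_ne hx hy]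

theorem cyc_rotate {x y z : α} (hxy : x ≠ y) (hxz : x ≠ z) (hyz : y ≠ z) :
    cyc x y z = cyc y z x := by
  ext w
  by_cases h1 : w = x
  · subst h1; rw [cyc_apply_left hxy hxz, cyc_apply_right]
  by_cases h2 : w = y
  · subst h2; rw [cyc_apply_mid hxz hyz, cyc_apply_left hyz hxy.symm]
  by_cases h3 : w = z
  · subst h3; rw [cyc_apply_right, cyc_apply_mid hxy.symm hxz.symm]
  rw [cyc_apply_of_ne h1 h2 h3, cyc_apply_of_ne h2 h3 h1]

theorem cyc_inv (x y z : α) : (cyc x y z)⁻¹ = cyc z y x := by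
  rw [cyc, cyc, mul_inv_rev, swap_inv, swap_inv, swap_comm y z, swap_comm x y]

/-- `x` and `y` are equal or lie in a common `3`-cycle of `H`. -/
def Linked (H : Subgroup (Perm α)) (x y : α) : Prop :=
  x = y ∨ ∃ z, x ≠ y ∧ x ≠ z ∧ y ≠ z ∧ cyc x y z ∈ H

variable {H K : Subgroup (Perm α)} {x y z w : α}

theorem Linked.mono (hHK : H ≤ K) : Linked H x y → Linked K x y :=
  Or.imp_right fun ⟨z, h1, h2, h3, h4⟩ => ⟨z, h1, h2, h3, hHK h4⟩

theorem Linked.of_cyc (hxy : x ≠ y) (hxz : x ≠ z) (hyz : y ≠ z) (h : cyc x y z ∈ H) :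
    Linked H x y := Or.inr ⟨z, hxy, hxz, hyz, h⟩

theorem Linked.of_cyc' (hxy : x ≠ y) (hxz : x ≠ z) (hyz : y ≠ z) (h : cyc x y z ∈ H) :
    Linked H y z := Or.inr ⟨x, hyz, hxy.symm, hxz.symm, cyc_rotate hxy hxz hyz ▸ h⟩

theorem Linked.symm (h : Linked H x y) : Linked H y x := by
  rcases h with rfl | ⟨z, h1, h2, h3, h⟩
  · exact Or.inl rfl
  · refine Or.inr ⟨z, h1.symm, h3, h2, ?_⟩
    rw [cyc_rotate h1 h2 h3, cyc_rotate h3 h1.symm h2.symm] at h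
    have := inv_mem h
    rwa [cyc_inv] at this

theorem Linked.map (h : Linked H x y) {g : Perm α} (hg : g ∈ H) : Linked H (g x) (g y) := by
  rcases h with rfl | ⟨z, h1, h2, h3, h⟩
  · exact Or.inl rfl
  · refine Or.inr ⟨g z, fun e => h1 (g.injective e), fun e => h2 (g.injective e),
      fun e => h3 (g.injective e), ?_⟩
    rw [← conj_cyc]
    exact mul_mem (mul_mem hg h) (inv_mem hg)

theorem Linked.trans (h : Linked H x y) (h' : Linked H y w) : Linked H x w := by
  rcases h with rfl | ⟨z, h1, h2, h3, h⟩
  · exact h'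
  by_cases hxw : x = w
  · exact Or.inl hxw
  rcases h' with rfl | ⟨u, k1, k2, k3, k⟩
  · exact Or.inr ⟨z, h1, h2, h3, h⟩
  by_cases hzw : z = w
  · subst hzw
    exact (Linked.of_cyc' h3 h1.symm h2.symm (cyc_rotate h1 h2 h3 ▸ h)).symm
  by_cases hux : u = x
  · subst hux
    exact (Linked.of_cyc' k1 k2 k3 k).symm
  by_cases hzu : z = u
  · subst hzu
    have := Linked.map (Linked.of_cyc' k1 k2 k3 k) h
    rw [cyc_apply_of_ne (Ne.symm hxw) k1.symm k3, cyc_apply_right] at this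
    exact this.symm
  · have := Linked.map (Or.inr ⟨z, h1, h2, h3, h⟩) k
    rwa [cyc_apply_of_ne h1 hxw (Ne.symm hux), cyc_apply_left k1 k2] at this

theorem cyc_mem_of_linked (hxy : x ≠ y) (hxz : x ≠ z) (hyz : y ≠ z) (h1 : Linked H x y)
    (h2 : Linked H y z) : cyc x y z ∈ H := by
  obtain ⟨a, -, k2, k3, k⟩ := h1.resolve_left hxy
  obtain ⟨b, -, l2, l3, l⟩ := h2.resolve_left hyz
  by_cases haz : a = z
  · rwa [← haz]
  by_cases hbx : b = x
  · subst hbx; rwa [cyc_rotate hxy hxz hyz]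
  have fin : cyc x z a ∈ H → cyc x y z ∈ H := by
    intro m
    have := mul_mem (mul_mem k m) (inv_mem k)
    rwa [conj_cyc, cyc_apply_left hxy k2, cyc_apply_of_ne hxz.symm hyz.symm (Ne.symm haz),
      cyc_apply_right, ← cyc_rotate hxy hxz hyz] at this
  apply fin
  by_cases hab : a = b
  · subst hab
    have := mul_mem (mul_mem k l) (inv_mem k)
    rw [conj_cyc, cyc_apply_mid k2 k3, cyc_apply_of_ne hxz.symm hyz.symm (Ne.symm haz),
      cyc_apply_right] at this
    have m4 := inv_mem this
    rwa [cyc_inv] at m4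
  · have := mul_mem (mul_mem l k) (inv_mem l)
    rwa [conj_cyc, cyc_apply_of_ne hxy hxz (Ne.symm hbx), cyc_apply_left hyz l2,
      cyc_apply_of_ne k3.symm haz hab] at this

variable [Fintype α]

theorem sign_cyc (hxy : x ≠ y) (hyz : y ≠ z) : sign (cyc x y z) = 1 := by
  rw [cyc, Perm.sign_mul, sign_swap hxy, sign_swap hyz]; rfl

/-- An even permutation supported on mutually linked points lies in `H`. -/
theorem mem_of_linked {O : Set α} {x₀ : α} (hO : ∀ x ∈ O, Linked H x₀ x) {g : Perm α}
    (hg : sign g = 1) (hs : ∀ x, x ∉ O → g x = x) : g ∈ H := by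
  have hO : ∀ x ∈ O, ∀ y ∈ O, Linked H x y := fun x hx y hy => (hO x hx).symm.trans (hO y hy)
  induction hn : g.support.card using Nat.strong_induction_on generalizing g with
  | _ n ih =>
    by_cases h1 : g = 1
    · exact h1 ▸ one_mem _
    obtain ⟨x, hx⟩ : ∃ x, g x ≠ x := by
      by_contra! h; exact h1 (Equiv.ext h)
    have hmem : ∀ u, g u ≠ u → u ∈ O := fun u hu => by_contra fun h => hu (hs u h)
    have hgx : g (g x) ≠ g x := fun h => hx (g.injective h)
    obtain ⟨w, hw, hwx, hwy⟩ : ∃ w, g w ≠ w ∧ w ≠ x ∧ w ≠ g x := by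
      by_contra! hcon
      have : g = swap x (g x) := by
        ext u
        by_cases hux : u = x
        · rw [hux, swap_apply_left]
        by_cases huy : u = g x
        · rw [huy, swap_apply_right]
          by_contra hne
          exact hgx (hcon (g (g x)) (fun h => hgx (g.injective h)) hne)
        · rw [swap_apply_of_ne_of_ne hux huy]
          by_contra hne
          exact huy (hcon u hne hux)
      rw [this, sign_swap hx.symm] at hg
      exact absurd hg (by decide)
    have hc : cyc (g x) x w ∈ H := cyc_mem_of_linked hx hwy.symm hwx.symm
      (hO _ (hmem _ hgx) _ (hmem _ hx)) (hO _ (hmem _ hx) _ (hmem _ hw))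
    have hfix : ∀ u, g u = u → (cyc (g x) x w * g) u = u := by
      intro u hu
      rw [Perm.mul_apply, hu, cyc_apply_of_ne]
      · rintro rfl; exact hgx hu
      · rintro rfl; exact hx hu
      · rintro rfl; exact hw hu
    have hlt : (cyc (g x) x w * g).support.card < n := by
      rw [← hn]
      apply Finset.card_lt_card
      refine ⟨fun u hu => ?_, fun hsub => ?_⟩
      · rw [mem_support] at hu ⊢
        exact fun h => hu (hfix u h)
      · have := hsub (mem_support.2 hx)
        rw [mem_support, Perm.mul_apply, cyc_apply_left hx hwy.symm] at this
        exact this rfl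
    have := ih _ hlt (g := cyc (g x) x w * g) (by rw [Perm.sign_mul, hg, sign_cyc hx hwx.symm, one_mul])
      (fun u hu => hfix u (hs u hu)) rfl
    exact (Subgroup.mul_mem_cancel_left _ hc).1 this

theorem eq_alternatingGroup {x₀ : α} (hH : ∀ x, Linked H x₀ x) (he : H ≤ alternatingGroup α) :
    H = alternatingGroup α :=
  le_antisymm he fun _ hg =>
    mem_of_linked (O := Set.univ) (fun x _ => hH x) hg fun x hx => absurd (Set.mem_univ x) hx

end Linked

section Columns

variable {α : Type*} {M : ℕ} {φ : Perm (Fin M) →* Perm α} {c u : Perm α}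

/-- The generators `u, φ (0 1) c, φ (1 2), φ (2 3), …`. -/
def twistSeq (φ : Perm (Fin M) →* Perm α) (c u : Perm α) (i : ℕ) : Perm α :=
  if i = 0 then u else if i = 1 then φ (adj M 1) * c else φ (adj M i)

/-- An action `φ` of the symmetric group on `Fin M` compatible with a family of relations `T i`, an
involution `c` preserving each of them, and an involution `u` preserving all but `T 0`. -/
structure ColumnData (φ : Perm (Fin M) →* Perm α) (c u : Perm α) (T : Fin M → α → α → Prop) :
    Prop where
  three_le : 3 ≤ M
  sq_c : ∀ x, c (c x) = x
  sq_u : ∀ x, u (u x) = x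
  comm_c : ∀ σ x, c (φ σ x) = φ σ (c x)
  comm_u : ∀ σ : Perm (Fin M), (∀ i : Fin M, (i : ℕ) = 0 → σ i = i) → ∀ x, u (φ σ x) = φ σ (u x)
  map_φ : ∀ σ i x y, T i x y → T (σ i) (φ σ x) (φ σ y)
  map_c : ∀ i x y, T i x y → T i (c x) (c y)
  map_u : ∀ (i : Fin M) x y, (i : ℕ) ≠ 0 → T i x y → T i (u x) (u y)
  sep : ∀ i j, (∀ x y, T i x y → T j x y) → i = j
  not_commute : ¬ Commute u (φ (adj M 1))
  twist : c = 1 ∨ ¬ Commute c u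

namespace ColumnData

variable {T : Fin M → α → α → Prop} (h : ColumnData φ c u T)
include h

theorem twistedSym : TwistedSym φ c (twistSeq φ c u) where
  inj := by
    rw [injective_iff_map_eq_one]
    intro σ hσ
    ext i
    refine congrArg _ (h.sep i (σ i) fun x y hx => ?_).symm
    have := h.map_φ σ i x y hx
    rwa [hσ] at this
  three_le := h.three_le
  sq := by ext x; exact h.sq_c x
  comm σ := by ext x; exact h.comm_c σ x
  one := rfl
  two i hi _ := by rw [twistSeq, if_neg (by omega), if_neg (by omega)]

theorem u_sq : u * u = 1 := by ext x; exact h.sq_u x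

theorem map_φ_iff {σ : Perm (Fin M)} {i : Fin M} (hσ : σ i = i) (x y : α) :
    T i x y ↔ T i (φ σ x) (φ σ y) := by
  refine ⟨fun hx => hσ ▸ h.map_φ σ i x y hx, fun hx => ?_⟩
  have := h.map_φ σ⁻¹ i _ _ hx
  rwa [inv_eq_iff_eq.2 hσ.symm, ← Perm.mul_apply, ← Perm.mul_apply, ← map_mul, inv_mul_cancel,
    map_one, Perm.one_apply, Perm.one_apply] at this

theorem map_c_iff {i : Fin M} (x y : α) : T i x y ↔ T i (c x) (c y) :=
  ⟨h.map_c i x y, fun hx => by simpa only [h.sq_c] using h.map_c i _ _ hx⟩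

theorem preserves {j : ℕ} (hj : 2 ≤ j) {g : Perm α} (hg : g ∈ itv (twistSeq φ c u) 0 j)
    (i : Fin M) (hi : j ≤ i) : ∀ x y, T i x y ↔ T i (g x) (g y) := by
  refine Subgroup.closure_induction (p := fun g _ => ∀ x y, T i x y ↔ T i (g x) (g y)) ?_
    (fun _ _ => Iff.rfl) (fun a b _ _ ha hb x y => (hb x y).trans (ha _ _))
    (fun a _ ha x y => ?_) hg
  · rintro _ ⟨k, ⟨-, hk⟩, rfl⟩ x y
    have hadj : adj M k i = i := adj_apply_of_ne (by omega) (by omega)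
    rw [twistSeq]
    split_ifs with h0 h1
    · exact ⟨h.map_u i x y (by omega), fun hx => by
        simpa only [h.sq_u] using h.map_u i _ _ (by omega) hx⟩
    · subst h1
      exact (h.map_c_iff x y).trans (h.map_φ_iff hadj _ _)
    · exact h.map_φ_iff hadj x y
  · rw [ha (a⁻¹ x), show a (a⁻¹ x) = x from a.apply_symm_apply x,
      show a (a⁻¹ y) = y from a.apply_symm_apply y]

theorem c_not_mem (hc : ¬ Commute c u) : c ∉ itv (twistSeq φ c u) 0 2 := by
  have ht := h.twistedSym
  intro hm
  have e : itv (twistSeq φ c u) 0 2 = Subgroup.closure {u, φ (adj M 1) * c} := by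
    rw [itv]
    congr 1
    ext g
    simp only [Set.mem_image, Set.mem_Ico, Set.mem_insert_iff, Set.mem_singleton_iff]
    constructor
    · rintro ⟨k, ⟨-, hk⟩, rfl⟩
      interval_cases k <;> simp [twistSeq]
    · rintro (rfl | rfl)
      · exact ⟨0, by omega, rfl⟩
      · exact ⟨1, by omega, rfl⟩
  have s1 : (φ (adj M 1) * c) * (φ (adj M 1) * c) = 1 := by
    have := ht.rho_sq (i := 1) le_rfl (by have := h.three_le; omega)
    rwa [ht.one] at this
  have c1 : Commute c (φ (adj M 1) * c) := (ht.comm _).mul_right (Commute.refl c)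
  rw [e] at hm
  obtain ⟨t, ht' | ht'⟩ := mem_closure_pair_dihedral h.u_sq s1 hm
  · refine hc ?_
    have h1 : Commute c (u * (φ (adj M 1) * c)) := by
      have := (Commute.refl (u * (φ (adj M 1) * c))).zpow_left t
      rwa [← ht'] at this
    have := h1.mul_right c1
    rwa [mul_assoc, s1, mul_one] at this
  · refine h.not_commute ?_
    have h0 : (u * (φ (adj M 1) * c)) ^ t = φ (adj M 1) := by
      have : (u * (φ (adj M 1) * c)) ^ t = c * (φ (adj M 1) * c) := by
        nth_rewrite 2 [ht']
        rw [mul_assoc, s1, mul_one]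
      rw [this, c1.eq, mul_assoc, ht.sq, mul_one]
    have h1 : Commute (φ (adj M 1)) (u * (φ (adj M 1) * c)) := by
      have := (Commute.refl (u * (φ (adj M 1) * c))).zpow_left t
      rwa [h0] at this
    have h2 : Commute (φ (adj M 1)) (φ (adj M 1) * c) :=
      (Commute.refl _).mul_right (ht.comm _).symm
    have := h1.mul_right h2
    rw [mul_assoc, s1, mul_one] at this
    exact this.symm

theorem isStringC : IsStringC (twistSeq φ c u) M := by
  have ht := h.twistedSym
  have h3 := h.three_le
  refine ht.isStringC h.u_sq ?_ ?_ ?_ ?_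
  · intro e
    exact h.not_commute ((show u = 1 from e) ▸ Commute.one_left _)
  · intro i hi hM
    rw [ht.two i hi hM]
    ext x
    exact h.comm_u _ (fun k hk => adj_apply_of_ne (by omega) (by omega)) x
  · intro j hj hM hm
    have hp := h.preserves (by omega) hm ⟨j, hM⟩ le_rfl
    have := h.sep ⟨j - 1, by omega⟩ ⟨j, hM⟩ fun x y hx => by
      rw [hp]
      have := h.map_φ (adj M j) _ x y hx
      rwa [adj_eq (by omega) hM, swap_apply_left, ← adj_eq (by omega) hM] at this
    simp only [Fin.mk.injEq] at this
    omega
  · rintro g ⟨hg1, hg2⟩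
    obtain ⟨σ, hσ, e⟩ := ht.exists_of_mem h3 hg2
    have hs2 : σ ⟨2, by omega⟩ = ⟨2, by omega⟩ := by
      refine h.sep _ _ fun y y' hy => ?_
      obtain ⟨x, rfl⟩ := g.surjective y
      obtain ⟨x', rfl⟩ := g.surjective y'
      have hp := h.preserves le_rfl hg1 ⟨2, by omega⟩ le_rfl
      rw [← hp]
      have := h.map_φ σ⁻¹ _ _ _ hy
      rw [show σ⁻¹ (σ ⟨2, by omega⟩) = ⟨2, by omega⟩ from σ.symm_apply_apply _, map_inv] at this
      rcases e with rfl | rfl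
      · simpa using this
      · rw [h.map_c_iff]
        simpa using this
    have hσ1 : σ ∈ itv (adj M) 1 2 := mem_itv_adj (fun x hx => by omega) fun x hx => by
      rcases hx.eq_or_lt with h' | h'
      · rw [show x = ⟨2, by omega⟩ from Fin.ext h'.symm, hs2]
      · exact itv_adj_fix_ge hσ x h'
    rw [mem_itv_one (adj_mul_self 1)] at hσ1
    have m1 : φ (adj M 1) * c ∈ itv (twistSeq φ c u) 1 2 := mem_itv (k := 1) le_rfl (by omega)
    have m1' := itv_mono (show 0 ≤ 1 by omega) (le_refl 2) m1
    rcases h.twist with hc | hc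
    · subst hc
      simp only [mul_one, or_self] at e m1
      rcases hσ1 with rfl | rfl
      · rw [e, map_one]; exact one_mem _
      · rwa [e]
    have hcn := h.c_not_mem hc
    rcases hσ1 with rfl | rfl <;> rcases e with rfl | rfl
    · rw [map_one]; exact one_mem _
    · rw [map_one, one_mul] at hg1
      exact absurd hg1 hcn
    · exact absurd ((Subgroup.mul_mem_cancel_left _ hg1).1 m1') hcn
    · exact m1

theorem u_mem : u ∈ itv (twistSeq φ c u) 0 M :=
  mem_itv (k := 0) le_rfl (by have := h.three_le; omega)

theorem c_mem : c ∈ itv (twistSeq φ c u) 0 M :=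
  itv_mono (Nat.zero_le 1) le_rfl (h.twistedSym.c_mem h.three_le)

theorem φ_mem (σ : Perm (Fin M)) : φ σ ∈ itv (twistSeq φ c u) 0 M :=
  itv_mono (Nat.zero_le 1) le_rfl (h.twistedSym.map_le h.three_le le_rfl
    ⟨σ, mem_itv_adj (fun x hx => by omega) (fun x hx => by omega), rfl⟩)

theorem stringCGen {s : ℕ} (h3 : 3 ≤ s) (hs : s ≤ M) :
    StringCGen (itv (twistSeq φ c u) 0 M) s := by
  have ht := h.twistedSym
  have h3' := h.three_le
  refine h.isStringC.stringCGen_of_le ?_ ?_ ?_ h3 hs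
  · intro hc
    rcases h.twist with e | hcu
    · subst e
      exact h.not_commute (by simpa [twistSeq] using hc)
    · refine hcu (commute_of_mem_closure (S := twistSeq φ c u '' Set.Ico 1 3) (T := {u}) ?_
        (ht.c_mem le_rfl) (Subgroup.subset_closure rfl))
      rintro _ ⟨k, ⟨hk1, hk3⟩, rfl⟩ _ rfl
      interval_cases k
      · exact hc.symm
      · rw [ht.two 2 le_rfl (by omega)]
        ext x
        exact (h.comm_u _ (fun k hk => adj_apply_of_ne (by omega) (by omega)) x).symm
  · intro hc
    rw [ht.one, ht.two 2 le_rfl (by omega)] at hc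
    refine ht.adj_one_ne_two (ht.inj ?_)
    have h1 := hc.mul_left (ht.comm (adj M 2))
    rw [mul_assoc, ht.sq, mul_one] at h1
    rw [map_mul, map_mul, h1.eq]
  · intro i hi hM
    rw [ht.two i hi (by omega), ht.two (i + 1) (by omega) hM, ← map_mul, ← map_pow,
      adj_braid (by omega) hM, map_one]

end ColumnData

theorem ColumnData.exists_rep [Fintype α] [DecidableEq α] {T : Fin M → α → α → Prop}
    (h : ColumnData φ c u T) {n s : ℕ} (hn : Fintype.card α = n) (h3 : 3 ≤ s) (hs : s ≤ M)
    (su : sign u = 1) (sc : sign c = 1) (sφ : ∀ σ, sign (φ σ) = 1)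
    (hl : ∀ H : Subgroup (Perm α), u ∈ H → c ∈ H → (∀ σ, φ σ ∈ H) → ∃ x₀, ∀ x, Linked H x₀ x) :
    ∃ ρ : Fin s → alternatingGroup (Fin n), IsStringCGroupRep ρ := by
  have hg := h.stringCGen h3 hs
  obtain ⟨x₀, hx⟩ := hl _ h.u_mem h.c_mem h.φ_mem
  rw [eq_alternatingGroup hx] at hg
  · exact hg.exists_rep_fin hn
  · refine itv_le fun k _ _ => ?_
    rw [mem_alternatingGroup, twistSeq]
    split_ifs
    · exact su
    · rw [Perm.sign_mul, sφ, sc, one_mul]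
    · exact sφ _

end Columns

section Handle

theorem sign_of_sq_eq_one {α : Type*} [Fintype α] [DecidableEq α] {f : Perm α} (hf : f * f = 1) :
    sign f = (-1) ^ (f.support.card / 2) := by
  have h2 : ∀ c ∈ f.cycleType, c = 2 := pow_prime_eq_one_iff.1 (by rw [pow_two, hf])
  have h := Multiset.eq_replicate_card.2 h2
  have hs := f.sum_cycleType
  rw [h, Multiset.sum_replicate, smul_eq_mul] at hs
  rw [sign_of_cycleType, f.sum_cycleType, ← hs, Nat.mul_div_cancel _ two_pos, pow_add, pow_mul',
    neg_one_sq, one_pow, one_mul]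

/-- The involution of `Fin k` exchanging `i` and `i + 1` for all `i` with the parity of `p`. -/
def zigzag (k p : ℕ) : Perm (Fin k) :=
  Function.Involutive.toPerm (fun i : Fin k =>
    if h : (i + p) % 2 = 0 ∧ (i : ℕ) + 1 < k then ⟨i + 1, h.2⟩
    else if (i + p) % 2 = 1 then ⟨i - 1, by omega⟩ else i) (by
      rintro ⟨i, hi⟩
      dsimp only
      split_ifs with h1 h2 h3 h4 h5 h6 <;> first
        | rfl
        | (simp only [Fin.mk.injEq]; dsimp only at *; omega))

variable {k p : ℕ}

theorem zigzag_apply_up {i : Fin k} (h : (i + p) % 2 = 0) (h' : (i : ℕ) + 1 < k) :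
    zigzag k p i = ⟨i + 1, h'⟩ := dif_pos ⟨h, h'⟩

theorem zigzag_apply_down {i : Fin k} (h : (i + p) % 2 = 1) :
    zigzag k p i = ⟨i - 1, by omega⟩ := by
  change dite _ _ _ = _
  rw [dif_neg (by omega), if_pos h]

theorem zigzag_apply_last {i : Fin k} (h : (i + p) % 2 = 0) (h' : (i : ℕ) + 1 = k) :
    zigzag k p i = i := by
  change dite _ _ _ = _
  rw [dif_neg (by omega), if_neg (by omega)]

theorem zigzag_zigzag (i : Fin k) : zigzag k p (zigzag k p i) = i :=
  (zigzag k p).symm_apply_apply i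

theorem sign_zigzag_zero : sign (zigzag k 0) = (-1) ^ (k / 2) := by
  rw [sign_of_sq_eq_one (by ext i; simp [zigzag_zigzag])]
  congr 1
  have : (zigzag k 0).support.map Fin.valEmbedding = Finset.range (2 * (k / 2)) := by
    ext j
    simp only [Finset.mem_map, mem_support, Fin.valEmbedding_apply, Finset.mem_range]
    constructor
    · rintro ⟨i, hi, rfl⟩
      by_contra hlt
      exact hi (zigzag_apply_last (by omega) (by omega))
    · intro hj
      refine ⟨⟨j, by omega⟩, ?_, rfl⟩
      rcases Nat.mod_two_eq_zero_or_one j with h | h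
      · rw [zigzag_apply_up h (by simp; omega)]; simp
      · rw [zigzag_apply_down h]; simp; omega
  rw [← Finset.card_map, this, Finset.card_range, Nat.mul_div_cancel_left _ two_pos]

theorem sign_zigzag_one : sign (zigzag k 1) = (-1) ^ ((k - 1) / 2) := by
  rw [sign_of_sq_eq_one (by ext i; simp [zigzag_zigzag])]
  congr 1
  have : (zigzag k 1).support.map Fin.valEmbedding = Finset.Ico 1 (2 * ((k - 1) / 2) + 1) := by
    ext j
    simp only [Finset.mem_map, mem_support, Fin.valEmbedding_apply, Finset.mem_Ico]
    constructor
    · rintro ⟨i, hi, rfl⟩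
      by_contra hlt
      refine hi ?_
      by_cases h0 : (i : ℕ) = 0
      · rw [zigzag_apply_down (by omega)]
        exact Fin.ext (by simp [h0])
      · exact zigzag_apply_last (by omega) (by omega)
    · intro hj
      refine ⟨⟨j, by omega⟩, ?_, rfl⟩
      rcases Nat.mod_two_eq_zero_or_one (j + 1) with h | h
      · rw [zigzag_apply_up h (by simp; omega)]; simp
      · rw [zigzag_apply_down h]; simp; omega
  rw [← Finset.card_map, this, Nat.card_Ico]
  omega

end Handle

section Transfer

variable {α β : Type*}

theorem viaEmbeddingHom_eq {ι : β ↪ α} {e : Perm β} {g : Perm α} (h1 : ∀ x, g (ι x) = ι (e x))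
    (h2 : ∀ y, y ∉ Set.range ι → g y = y) : viaEmbeddingHom ι e = g := by
  ext y
  rw [viaEmbeddingHom_apply]
  by_cases hy : y ∈ Set.range ι
  · obtain ⟨x, rfl⟩ := hy
    rw [viaEmbedding_apply, h1]
  · rw [viaEmbedding_apply_of_notMem _ _ _ hy, h2 y hy]

variable [DecidableEq α] [DecidableEq β]

theorem viaEmbeddingHom_swap (ι : β ↪ α) (x y : β) :
    viaEmbeddingHom ι (swap x y) = swap (ι x) (ι y) :=
  viaEmbeddingHom_eq (fun z => by rw [ι.injective.swap_apply]) fun z hz =>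
    swap_apply_of_ne_of_ne (fun e => hz ⟨x, e.symm⟩) fun e => hz ⟨y, e.symm⟩

theorem viaEmbeddingHom_cyc (ι : β ↪ α) (x y z : β) :
    viaEmbeddingHom ι (cyc x y z) = cyc (ι x) (ι y) (ι z) := by
  rw [cyc, cyc, map_mul, viaEmbeddingHom_swap, viaEmbeddingHom_swap]

theorem Linked.of_comap {ι : β ↪ α} {H : Subgroup (Perm α)} {x y : β}
    (h : Linked (H.comap (viaEmbeddingHom ι)) x y) : Linked H (ι x) (ι y) := by
  rcases h with rfl | ⟨z, h1, h2, h3, h⟩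
  · exact Or.inl rfl
  · rw [Subgroup.mem_comap, viaEmbeddingHom_cyc] at h
    exact Linked.of_cyc (ι.injective.ne h1) (ι.injective.ne h2) (ι.injective.ne h3) h

end Transfer

section Handle

variable {B : Type*} [DecidableEq B] {M k : ℕ} [NeZero k] {ψ : Perm (Fin M) →* Perm B}
  {c₀ u₀ : Perm B} {x₀ : B}

/-- A path attached to a base on which `ψ`, `c₀` and `u₀` act; the edges of the path belong
alternately to `u` and to `c`. The involution `c₀` preserves all sets `T i`, or takes each to its
complement. -/
structure HandleData (k : ℕ) (ψ : Perm (Fin M) →* Perm B) (c₀ u₀ : Perm B) (x₀ : B)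
    (T : Fin M → B → Prop) : Prop where
  three_le : 3 ≤ M
  sq_c : ∀ x, c₀ (c₀ x) = x
  sq_u : ∀ x, u₀ (u₀ x) = x
  comm_c : ∀ σ x, c₀ (ψ σ x) = ψ σ (c₀ x)
  comm_u : ∀ σ : Perm (Fin M), (∀ i : Fin M, (i : ℕ) = 0 → σ i = i) →
    ∀ x, u₀ (ψ σ x) = ψ σ (u₀ x)
  map_ψ : ∀ σ i x, T i x → T (σ i) (ψ σ x)
  map_c : (∀ i x, T i x → T i (c₀ x)) ∨ Even k ∧ ∀ i x, T i x ↔ ¬ T i (c₀ x)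
  map_u : ∀ (i : Fin M) x, (i : ℕ) ≠ 0 → T i x → T i (u₀ x)
  sep : ∀ i j, (∀ x y, (T i x ↔ T i y) → (T j x ↔ T j y)) → i = j
  u_base : u₀ x₀ = x₀
  fix_base : ∀ σ : Perm (Fin M), (∀ i : Fin M, (i : ℕ) = 0 → σ i = i) → ψ σ x₀ = x₀
  move_base : ψ (adj M 1) x₀ ≠ x₀
  not_mem_base : ∀ i : Fin M, (i : ℕ) ≠ 0 → ¬ T i x₀
  twist : k = 1 ∧ c₀ = 1 ∨ 2 ≤ k ∨ c₀ x₀ ≠ x₀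

/-- The involution given by `u₀` on the base and every other edge of the path, including the edge
joining the path to the base. -/
def attach (k : ℕ) [NeZero k] (u₀ : Perm B) (x₀ : B) : Perm (Fin k ⊕ B) :=
  swap (Sum.inr x₀) (Sum.inl 0) * Perm.sumCongr (zigzag k 1) u₀

theorem zigzag_one_zero : zigzag k 1 0 = 0 := by
  rw [zigzag_apply_down (by simp)]
  exact Fin.ext (by simp)

theorem attach_base (h : u₀ x₀ = x₀) : attach k u₀ x₀ (Sum.inr x₀) = Sum.inl 0 := by
  simp [attach, h]

theorem attach_zero : attach k u₀ x₀ (Sum.inl 0) = Sum.inr x₀ := by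
  simp [attach, zigzag_one_zero]

theorem attach_inl {i : Fin k} (hi : i ≠ 0) :
    attach k u₀ x₀ (Sum.inl i) = Sum.inl (zigzag k 1 i) := by
  have : zigzag k 1 i ≠ 0 := fun e => hi (by rw [← zigzag_zigzag (p := 1) i, e, zigzag_one_zero])
  simp only [attach, Perm.mul_apply, Perm.sumCongr_apply, Sum.map_inl]
  exact swap_apply_of_ne_of_ne (by simp) (by simpa using this)

theorem attach_inr (h : u₀ x₀ = x₀) {x : B} (hx : x ≠ x₀) :
    attach k u₀ x₀ (Sum.inr x) = Sum.inr (u₀ x) := by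
  have : u₀ x ≠ x₀ := fun e => hx (u₀.injective (e.trans h.symm))
  simp only [attach, Perm.mul_apply, Perm.sumCongr_apply, Sum.map_inr]
  exact swap_apply_of_ne_of_ne (by simpa using this) (by simp)

/-- Extend a family of sets in the base to the path, so that the complements are interchanged by
`c` if they are so in the base. -/
def side (c₀ : Perm B) (T : Fin M → B → Prop) (i : Fin M) : Fin k ⊕ B → Prop :=
  Sum.elim (fun j => (Even k ∧ ∀ i x, T i x ↔ ¬ T i (c₀ x)) ∧ Odd (((j : ℕ) + 1) / 2)) (T i)

/-- Extend an action on the base trivially to the path. -/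
def extendHom (k : ℕ) (ψ : Perm (Fin M) →* Perm B) : Perm (Fin M) →* Perm (Fin k ⊕ B) :=
  ((Perm.sumCongrHom (Fin k) B).comp (MonoidHom.inr _ _)).comp ψ

omit [DecidableEq B] [NeZero k] in
@[simp] theorem extendHom_inl (σ : Perm (Fin M)) (i : Fin k) :
    extendHom k ψ σ (Sum.inl i) = Sum.inl i := rfl

omit [DecidableEq B] [NeZero k] in
@[simp] theorem extendHom_inr (σ : Perm (Fin M)) (x : B) :
    extendHom k ψ σ (Sum.inr x) = Sum.inr (ψ σ x) := rfl

namespace HandleData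

variable {T : Fin M → B → Prop} (h : HandleData k ψ c₀ u₀ x₀ T)
include h

omit [DecidableEq B] [NeZero k] in
theorem side_ψ (σ : Perm (Fin M)) (i : Fin M) (x : B) : T i x ↔ T (σ i) (ψ σ x) := by
  refine ⟨h.map_ψ σ i x, fun hx => ?_⟩
  have := h.map_ψ σ⁻¹ _ _ hx
  rwa [show σ⁻¹ (σ i) = i from σ.symm_apply_apply i, ← Perm.mul_apply, ← map_mul, inv_mul_cancel,
    map_one, Perm.one_apply] at this

theorem side_u {i : Fin M} (hi : (i : ℕ) ≠ 0) (x : Fin k ⊕ B) :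
    side c₀ T i (attach k u₀ x₀ x) ↔ side c₀ T i x := by
  rcases x with j | x
  · by_cases hj : j = 0
    · rw [hj, attach_zero]
      exact iff_of_false (h.not_mem_base i hi) (by rintro ⟨-, h1⟩; simp at h1)
    · rw [attach_inl hj]
      refine and_congr_right fun _ => ?_
      have hj0 : (j : ℕ) ≠ 0 := fun e => hj (Fin.ext (by simpa using e))
      have := j.isLt
      rcases Nat.mod_two_eq_zero_or_one j with hp | hp
      · rw [zigzag_apply_down (by omega), Nat.odd_iff, Nat.odd_iff]
        simp only
        omega
      · by_cases hl : (j : ℕ) + 1 < k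
        · rw [zigzag_apply_up (by omega) hl, Nat.odd_iff, Nat.odd_iff]
          simp only
          omega
        · rw [zigzag_apply_last (by omega) (by omega)]
  · by_cases hx : x = x₀
    · rw [hx, attach_base h.u_base]
      exact iff_of_false (by rintro ⟨-, h1⟩; simp at h1) (h.not_mem_base i hi)
    · rw [attach_inr h.u_base hx]
      exact ⟨fun h1 => h.sq_u x ▸ h.map_u i _ hi h1, h.map_u i x hi⟩

omit [DecidableEq B] [NeZero k] in
theorem side_c :
    (∀ i x, side (k := k) c₀ T i (Perm.sumCongr (zigzag k 0) c₀ x) ↔ side c₀ T i x) ∨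
    ∀ i x, side (k := k) c₀ T i (Perm.sumCongr (zigzag k 0) c₀ x) ↔ ¬ side c₀ T i x := by
  by_cases hf : Even k ∧ ∀ i x, T i x ↔ ¬ T i (c₀ x)
  · right
    rintro i (j | x)
    · refine (and_iff_right hf).trans (Iff.trans ?_ (and_iff_right hf).not.symm)
      obtain ⟨l, hl⟩ := hf.1
      have := j.isLt
      rcases Nat.mod_two_eq_zero_or_one j with hp | hp
      · rw [zigzag_apply_up (by omega) (by omega), Nat.odd_iff, Nat.odd_iff]
        simp only
        omega
      · rw [zigzag_apply_down (by omega), Nat.odd_iff, Nat.odd_iff]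
        simp only
        omega
    · simp only [side, Perm.sumCongr_apply, Sum.map_inr, Sum.elim_inr]
      have := hf.2 i x
      tauto
  · left
    have h1 := h.map_c.resolve_right hf
    rintro i (j | x)
    · exact iff_of_false (fun h => hf h.1) fun h => hf h.1
    · exact ⟨fun h2 => h.sq_c x ▸ h1 i _ h2, h1 i x⟩

theorem columnData : ColumnData (extendHom k ψ) (Perm.sumCongr (zigzag k 0) c₀)
    (attach k u₀ x₀) (fun i x y => side c₀ T i x ↔ side c₀ T i y) where
  three_le := h.three_le
  sq_c := by
    rintro (i | x)
    · simp [zigzag_zigzag]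
    · simp [h.sq_c]
  sq_u := by
    rintro (i | x)
    · by_cases hi : i = 0
      · rw [hi, attach_zero, attach_base h.u_base]
      · have : zigzag k 1 i ≠ 0 := fun e =>
          hi (by rw [← zigzag_zigzag (p := 1) i, e, zigzag_one_zero])
        rw [attach_inl hi, attach_inl this, zigzag_zigzag]
    · by_cases hx : x = x₀
      · rw [hx, attach_base h.u_base, attach_zero]
      · have : u₀ x ≠ x₀ := fun e => hx (u₀.injective (e.trans h.u_base.symm))
        rw [attach_inr h.u_base hx, attach_inr h.u_base this, h.sq_u]
  comm_c σ := by
    rintro (i | x)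
    · simp
    · simp [h.comm_c]
  comm_u σ hσ := by
    rintro (i | x)
    · by_cases hi : i = 0
      · rw [hi, extendHom_inl, attach_zero, extendHom_inr, h.fix_base σ hσ]
      · rw [extendHom_inl, attach_inl hi, extendHom_inl]
    · by_cases hx : x = x₀
      · rw [hx, extendHom_inr, h.fix_base σ hσ, attach_base h.u_base, extendHom_inl]
      · have : ψ σ x ≠ x₀ := fun e => hx ((ψ σ).injective (e.trans (h.fix_base σ hσ).symm))
        rw [extendHom_inr, attach_inr h.u_base this, attach_inr h.u_base hx, extendHom_inr,
          h.comm_u σ hσ]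
  map_φ σ i x y := by
    have (x : Fin k ⊕ B) : side c₀ T i x ↔ side c₀ T (σ i) (extendHom k ψ σ x) := by
      rcases x with j | x
      · exact Iff.rfl
      · exact h.side_ψ σ i x
    rw [this x, this y]
    exact id
  map_c i x y := by
    rcases h.side_c with h1 | h1
    · rw [h1, h1]; exact id
    · rw [h1, h1, not_iff_not]; exact id
  map_u i x y hi := by
    rw [h.side_u hi, h.side_u hi]; exact id
  sep i j hij := h.sep i j fun x y => hij (Sum.inr x) (Sum.inr y)
  not_commute hc := by
    have := congrArg (fun f => f (Sum.inl 0)) hc.eq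
    simp only [Perm.mul_apply, extendHom_inl, attach_zero, extendHom_inr, Sum.inr.injEq] at this
    exact h.move_base this.symm
  twist := by
    have key : Commute (Perm.sumCongr (zigzag k 0) c₀) (attach k u₀ x₀) →
        zigzag k 0 0 = 0 ∧ c₀ x₀ = x₀ := by
      intro hc
      have e := congrArg (fun f => f (Sum.inl 0)) hc.eq
      simp only [Perm.mul_apply, attach_zero, Perm.sumCongr_apply, Sum.map_inl, Sum.map_inr] at e
      by_cases h0 : zigzag k 0 0 = 0
      · rw [h0, attach_zero, Sum.inr.injEq] at e
        exact ⟨h0, e⟩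
      · rw [attach_inl h0] at e
        simp at e
    rcases h.twist with ⟨rfl, rfl⟩ | h2 | h2
    · left
      ext (i | x)
      · simp [Subsingleton.elim (zigzag 1 0 i) i]
      · simp
    · refine Or.inr fun hc => ?_
      have := (key hc).1
      rw [zigzag_apply_up (by simp) (by simp; omega)] at this
      simp [Fin.ext_iff] at this
    · exact Or.inr fun hc => h2 (key hc).2

end HandleData
end Handle

section Handle

variable {B : Type*} [DecidableEq B] {M k : ℕ} [NeZero k] {ψ : Perm (Fin M) →* Perm B}
  {c₀ u₀ : Perm B} {x₀ : B}

/-- The involution given by `u₀` on the base and by the edge joining one more point to it. -/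
def tip (u₀ : Perm B) (x₀ : B) : Perm (Option B) :=
  swap (some x₀) none * Equiv.optionCongr u₀

/-- The base together with the first point of the path. -/
def tipEmb (k : ℕ) [NeZero k] (B : Type*) : Option B ↪ Fin k ⊕ B where
  toFun x := x.elim (Sum.inl 0) Sum.inr
  inj' := by rintro (_ | x) (_ | y) h <;> simp_all

theorem attach_tipEmb (h : u₀ x₀ = x₀) (x : Option B) :
    attach k u₀ x₀ (tipEmb k B x) = tipEmb k B (tip u₀ x₀ x) := by
  rcases x with _ | x
  · rw [show tipEmb k B none = Sum.inl 0 from rfl, attach_zero]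
    simp only [tip, Perm.mul_apply, Equiv.optionCongr_apply, Option.map_none, swap_apply_right]
    rfl
  · rw [show tipEmb k B (some x) = Sum.inr x from rfl]
    by_cases hx : x = x₀
    · rw [hx, attach_base h]
      simp only [tip, Perm.mul_apply, Equiv.optionCongr_apply, Option.map_some, h, swap_apply_left]
      rfl
    · have : u₀ x ≠ x₀ := fun e => hx (u₀.injective (e.trans h.symm))
      rw [attach_inr h hx]
      simp only [tip, Perm.mul_apply, Equiv.optionCongr_apply, Option.map_some]
      rw [swap_apply_of_ne_of_ne (by simpa using this) (by simp)]
      rfl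

omit [DecidableEq B] in
theorem extendHom_tipEmb (σ : Perm (Fin M)) (x : Option B) :
    extendHom k ψ σ (tipEmb k B x) = tipEmb k B (Equiv.optionCongr (ψ σ) x) := by
  rcases x with _ | x <;> rfl

theorem linked_handle {H : Subgroup (Perm (Fin k ⊕ B))} (hu : u₀ x₀ = x₀)
    (h1 : attach k u₀ x₀ ∈ H) (h2 : Perm.sumCongr (zigzag k 0) c₀ ∈ H)
    (hl : ∀ x, Linked H (Sum.inl 0) (Sum.inr x)) (y : Fin k ⊕ B) : Linked H (Sum.inl 0) y := by
  rcases y with ⟨i, hi⟩ | x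
  · induction i with
    | zero => exact Or.inl rfl
    | succ i ih =>
      have h0 := ((hl x₀).symm.trans (ih (by omega)))
      rcases Nat.mod_two_eq_zero_or_one i with hp | hp
      · have := h0.map h2
        simp only [Perm.sumCongr_apply, Sum.map_inl, Sum.map_inr] at this
        rw [zigzag_apply_up (by simpa using hp) (by simpa using hi)] at this
        exact (hl _).trans this
      · have := h0.map h1
        rwa [attach_base hu, attach_inl (by simp [Fin.ext_iff]; omega),
          zigzag_apply_up (by simp; omega) (by simpa using hi)] at this
  · exact hl x

/-- If the points of the base in some set are linked to the first point of the path, and this set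
and its image under `c₀` cover the base and meet each other, then the generators give all ranks up
to the number of columns. -/
theorem HandleData.exists_rep [Fintype B] {T : Fin M → B → Prop} (h : HandleData k ψ c₀ u₀ x₀ T)
    (S : B → Prop)
    {n s : ℕ} (hn : k + Fintype.card B = n) (h3 : 3 ≤ s) (hs : s ≤ M)
    (sc : (-1) ^ (k / 2) * sign c₀ = 1) (su : -((-1) ^ ((k - 1) / 2) * sign u₀) = 1)
    (sψ : ∀ σ, sign (ψ σ) = 1)
    (hl : ∀ H : Subgroup (Perm (Option B)), (∀ σ, Equiv.optionCongr (ψ σ) ∈ H) →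
      (∀ σ, tip u₀ x₀ * (Equiv.optionCongr (ψ σ) * tip u₀ x₀ * (Equiv.optionCongr (ψ σ))⁻¹) ∈ H) →
      ∀ x, S x → Linked H none (some x))
    (hS : ∀ x, S x ∨ S (c₀ x)) (hS' : ∃ x, S x ∧ S (c₀ x)) :
    ∃ ρ : Fin s → alternatingGroup (Fin n), IsStringCGroupRep ρ := by
  refine h.columnData.exists_rep (by simpa using hn) h3 hs ?_ ?_ (fun σ => ?_) ?_
  · rw [attach, Perm.sign_mul, sign_swap (by simp), sign_sumCongr, sign_zigzag_one, neg_one_mul, su]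
  · rw [sign_sumCongr, sign_zigzag_zero, sc]
  · change sign (Perm.sumCongr 1 (ψ σ)) = 1
    rw [sign_sumCongr, sψ, Perm.sign_one, one_mul]
  · intro H hu hc hφ
    suffices hH : ∀ x, S x → Linked H (Sum.inl 0) (Sum.inr x) by
      refine ⟨Sum.inl 0, linked_handle h.u_base hu hc fun x => ?_⟩
      rcases hS x with hx | hx
      · exact hH x hx
      · obtain ⟨y, hy, hy'⟩ := hS'
        refine (hH _ hy').trans ?_
        have := ((hH y hy).symm.trans (hH _ hx)).map hc
        simpa only [Perm.sumCongr_apply, Sum.map_inr, h.sq_c] using this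
    intro x hx
    refine (hl (H.comap (viaEmbeddingHom (tipEmb k B))) (fun σ => ?_) (fun σ => ?_) x hx).of_comap
    · rw [Subgroup.mem_comap, viaEmbeddingHom_eq (g := extendHom k ψ σ)
        (fun x => extendHom_tipEmb σ x)]
      · exact hφ σ
      · rintro (i | x) hx
        · rfl
        · exact absurd ⟨some x, rfl⟩ hx
    · have hinv : ∀ x, (extendHom k ψ σ)⁻¹ (tipEmb k B x) =
          tipEmb k B ((Equiv.optionCongr (ψ σ))⁻¹ x) := fun x => by
        rw [inv_eq_iff_eq, extendHom_tipEmb]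
        congr 1
        exact ((Equiv.optionCongr (ψ σ)).apply_symm_apply x).symm
      rw [Subgroup.mem_comap, viaEmbeddingHom_eq
        (g := attach k u₀ x₀ * (extendHom k ψ σ * attach k u₀ x₀ * (extendHom k ψ σ)⁻¹))]
      · exact Subgroup.mul_mem _ hu
          (Subgroup.mul_mem _ (Subgroup.mul_mem _ (hφ σ) hu) (Subgroup.inv_mem _ (hφ σ)))
      · intro x
        simp only [Perm.mul_apply]
        rw [hinv, attach_tipEmb h.u_base, extendHom_tipEmb, attach_tipEmb h.u_base]
      · rintro (i | x) hx
        · have hi : i ≠ 0 := fun e => hx ⟨none, by rw [e]; rfl⟩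
          simp only [Perm.mul_apply]
          rw [show (extendHom k ψ σ)⁻¹ (Sum.inl i) = Sum.inl i by rw [← map_inv, extendHom_inl],
            attach_inl hi, extendHom_inl, ← attach_inl hi]
          exact h.columnData.sq_u _
        · exact absurd ⟨some x, rfl⟩ hx

end Handle

section TwoRows

theorem exists_ne_ne {M : ℕ} (hM : 3 ≤ M) (i j : Fin M) : ∃ l, l ≠ i ∧ l ≠ j := by
  by_contra! hl
  have : (Finset.univ : Finset (Fin M)) ⊆ {i, j} := fun l _ => by
    have := hl l
    simp only [Finset.mem_insert, Finset.mem_singleton]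
    tauto
  have := (Finset.card_le_card this).trans Finset.card_le_two
  simp at this
  omega

/-- The symmetric group on the columns acting on two rows. -/
def colHom (M : ℕ) : Perm (Fin M) →* Perm (Fin M × Bool) where
  toFun σ := prodCongrLeft fun _ => σ
  map_one' := rfl
  map_mul' _ _ := rfl

@[simp] theorem colHom_apply {M : ℕ} (σ : Perm (Fin M)) (x : Fin M × Bool) :
    colHom M σ x = (σ x.1, x.2) := rfl

theorem sign_colHom {M : ℕ} (σ : Perm (Fin M)) : sign (colHom M σ) = 1 := by
  change sign (prodCongrLeft fun _ => σ) = 1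
  rw [sign_prodCongrLeft]
  simp

/-- The exchange of the two rows in all columns but the first. -/
def flipTail (M : ℕ) : Perm (Fin M × Bool) :=
  prodCongrRight fun i => if (i : ℕ) = 0 then 1 else Equiv.boolNot

theorem flipTail_zero {M : ℕ} {i : Fin M} (hi : (i : ℕ) = 0) (b : Bool) :
    flipTail M (i, b) = (i, b) := by
  simp [flipTail, prodCongrRight, hi]

theorem flipTail_pos {M : ℕ} {i : Fin M} (hi : (i : ℕ) ≠ 0) (b : Bool) :
    flipTail M (i, b) = (i, !b) := by
  simp [flipTail, prodCongrRight, hi]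

theorem sign_flipTail (m : ℕ) : sign (flipTail (m + 1)) = (-1) ^ m := by
  rw [flipTail, sign_prodCongrRight, Fin.prod_univ_succ]
  have : sign Equiv.boolNot = -1 := by decide
  simp [this]

variable {m : ℕ}

theorem handleData_twoRows {k : ℕ} [NeZero k] :
    HandleData k (colHom (m + 3)) 1 (flipTail (m + 3)) (0, false) (fun i x => x.1 = i) where
  three_le := by omega
  sq_c _ := rfl
  sq_u := by
    rintro ⟨i, b⟩
    by_cases hi : (i : ℕ) = 0
    · rw [flipTail_zero hi, flipTail_zero hi]
    · rw [flipTail_pos hi, flipTail_pos hi, Bool.not_not]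
  comm_c _ _ := rfl
  comm_u σ hσ := by
    rintro ⟨i, b⟩
    by_cases hi : (i : ℕ) = 0
    · rw [flipTail_zero hi, colHom_apply, hσ i hi, flipTail_zero hi]
    · have : (σ i : ℕ) ≠ 0 := fun e => hi (by
        rw [← σ.injective (hσ _ e)]; exact e)
      rw [flipTail_pos hi, colHom_apply, flipTail_pos this, colHom_apply]
  map_ψ σ i x hx := congrArg σ hx
  map_c := Or.inl fun _ _ => id
  map_u _ _ _ := id
  sep i j h := by
    by_contra hij
    obtain ⟨l, hi, hj⟩ := exists_ne_ne (by omega) i j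
    have := (h (j, false) (l, false) (iff_of_false (Ne.symm hij) hi)).1 rfl
    exact hj this
  u_base := flipTail_zero rfl _
  fix_base σ hσ := Prod.ext (hσ 0 rfl) rfl
  move_base := by
    rw [adj_eq (by omega) (by omega)]
    simp
  not_mem_base i hi e := hi (by rw [← e]; rfl)
  twist := by
    rcases Nat.lt_or_ge 1 k with hk | hk
    · exact Or.inr (Or.inl hk)
    · exact Or.inl ⟨le_antisymm hk (NeZero.pos k), rfl⟩

theorem tip_conj {s : Fin (m + 3)} (hs : (s : ℕ) ≠ 0) {σ : Perm (Fin (m + 3))} (hσ : σ = swap 0 s) :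
    tip (flipTail (m + 3)) (0, false) * (Equiv.optionCongr (colHom (m + 3) σ) *
      tip (flipTail (m + 3)) (0, false) * (Equiv.optionCongr (colHom (m + 3) σ))⁻¹) =
    swap (some (0, false)) none * swap (some (s, true)) none *
      swap (some (0, false)) (some (0, true)) * swap (some (s, false)) (some (s, true)) := by
  subst hσ
  have hs0 : s ≠ 0 := fun e => hs (by rw [e]; rfl)
  have t0 : ∀ i, tip (flipTail (m + 3)) (0, false) (some i) = if i = (0, false) then none
      else some (if i.1 = 0 then i else (i.1, !i.2)) := by
    rintro ⟨i, b⟩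
    rw [tip, Perm.mul_apply, Equiv.optionCongr_apply, Option.map_some]
    by_cases hi : i = 0
    · subst hi
      rw [flipTail_zero (by rfl)]
      cases b <;> simp [swap_apply_def]
    · rw [flipTail_pos (fun e => hi (Fin.ext e))]
      simp [swap_apply_def, hi]
  have t1 : tip (flipTail (m + 3)) (0, false) none = some (0, false) := by
    simp [tip]
  have hinv : (Equiv.optionCongr (colHom (m + 3) (swap 0 s)))⁻¹ =
      Equiv.optionCongr (colHom (m + 3) (swap 0 s)) := by
    rw [inv_eq_iff_mul_eq_one]
    ext1 x
    rcases x with _ | x <;> simp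
  refine Equiv.ext ?_
  rw [hinv]
  rintro (_ | ⟨i, b⟩)
  · simp [t0, t1, swap_apply_def, hs0]
  · by_cases h0 : i = 0
    · subst h0
      cases b <;> simp [t0, swap_apply_def, hs0, hs0.symm]
    · by_cases h1 : i = s
      · subst h1
        cases b <;> simp [t0, t1, swap_apply_def, hs0]
      · simp [t0, swap_apply_def, h0, h1]
  
theorem linked_twoRows {H : Subgroup (Perm (Option (Fin (m + 3) × Bool)))}
    (h1 : ∀ σ, Equiv.optionCongr (colHom (m + 3) σ) ∈ H)
    (h2 : ∀ σ, tip (flipTail (m + 3)) (0, false) * (Equiv.optionCongr (colHom (m + 3) σ) *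
      tip (flipTail (m + 3)) (0, false) * (Equiv.optionCongr (colHom (m + 3) σ))⁻¹) ∈ H)
    (x : Fin (m + 3) × Bool) : Linked H none (some x) := by
  let ι : Option (Fin 3 × Bool) ↪ Option (Fin (m + 3) × Bool) :=
    ((Fin.castLEEmb (by omega : 3 ≤ m + 3)).prodMap (.refl Bool)).optionMap
  have hW : ∀ s : Fin 3, (s : ℕ) ≠ 0 → swap (some (0, false)) none * swap (some (s, true)) none *
      swap (some (0, false)) (some (0, true)) * swap (some (s, false)) (some (s, true)) ∈
      H.comap (viaEmbeddingHom ι) := fun s hs => by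
    have := h2 (swap 0 (Fin.castLE (by omega) s))
    rw [tip_conj (by simpa using hs) rfl] at this
    rw [Subgroup.mem_comap, map_mul, map_mul, map_mul, viaEmbeddingHom_swap, viaEmbeddingHom_swap,
      viaEmbeddingHom_swap, viaEmbeddingHom_swap]
    exact this
  have hc : cyc (some (0, false)) (some (1, false)) (some (1, true)) ∈
      H.comap (viaEmbeddingHom ι) := by
    have h12 := Subgroup.mul_mem _ (hW 1 (by decide)) (Subgroup.mul_mem _ (hW 2 (by decide))
      (hW 2 (by decide)))
    convert Subgroup.mul_mem _ h12 h12 using 1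
    decide
  have l1 : Linked H (some (0, false)) (some (1, false)) :=
    (Linked.of_cyc (by decide) (by decide) (by decide) hc).of_comap
  have l2 : Linked H (some (1, false)) (some (1, true)) :=
    (Linked.of_cyc' (by decide) (by decide) (by decide) hc).of_comap
  have l3 : ∀ i, Linked H (some (i, false)) (some (i, true)) := fun i => by
    have := l2.map (h1 (swap 1 i))
    simpa using this
  have l4 : ∀ i, Linked H (some (0, false)) (some (i, false)) := fun i => by
    by_cases hi : i = 0
    · subst hi; exact Or.inl rfl
    · have := l1.map (h1 (swap 1 i))
      rwa [Equiv.optionCongr_apply, Equiv.optionCongr_apply, Option.map_some, Option.map_some,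
        colHom_apply, colHom_apply, swap_apply_left,
        swap_apply_of_ne_of_ne (by simp) (Ne.symm hi)] at this
  have l5 : Linked H (some (0, true)) none := by
    have := (l3 0).map (h2 (swap 0 1))
    rw [tip_conj (by simp) rfl] at this
    simpa [swap_apply_def] using this
  have l6 := l5.symm.trans (l3 0).symm
  obtain ⟨i, b⟩ := x
  cases b
  · exact l6.trans (l4 i)
  · exact (l6.trans (l4 i)).trans (l3 i)

/-- `n ≡ 1 [MOD 4]` with `k = 1`, and `n ≡ 2 [MOD 4]` with `k = 4`. -/
theorem exists_rep_twoRows {k n s : ℕ} [NeZero k] (hn : k + 2 * (m + 3) = n) (h3 : 3 ≤ s)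
    (hs : s ≤ m + 3) (hk : Even (k / 2)) (hm : Odd ((k - 1) / 2 + m)) :
    ∃ ρ : Fin s → alternatingGroup (Fin n), IsStringCGroupRep ρ := by
  refine (handleData_twoRows (k := k)).exists_rep (fun _ => True) ?_ h3 hs ?_ ?_ sign_colHom
    (fun H h1 h2 x _ => linked_twoRows h1 h2 x) (fun _ => Or.inl trivial) ⟨(0, false), trivial, trivial⟩
  · simp [← hn]; ring
  · rw [Perm.sign_one, mul_one, hk.neg_one_pow]
  · rw [sign_flipTail, ← pow_add, ← add_assoc, pow_add, hm.neg_one_pow]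
    rfl

end TwoRows

section Pairs

variable {M : ℕ}

/-- The symmetric group acting on unordered pairs. -/
def pairHom (M : ℕ) : Perm (Fin M) →* Perm (Sym2 (Fin M)) where
  toFun σ :=
    { toFun := Sym2.map σ
      invFun := Sym2.map σ.symm
      left_inv x := by induction x; simp
      right_inv x := by induction x; simp }
  map_one' := by ext x; induction x; rfl
  map_mul' σ τ := by ext x; induction x; rfl

@[simp] theorem pairHom_mk (σ : Perm (Fin M)) (a b : Fin M) :
    pairHom M σ s(a, b) = s(σ a, σ b) := rfl

/-- Exchange `s(i, i)` and `s(0, i)`. -/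
def hinge (M : ℕ) [NeZero M] : Perm (Sym2 (Fin M)) :=
  Function.Involutive.toPerm (Sym2.lift ⟨fun a b => if a = b then s(0, a) else
    if a = 0 then s(b, b) else if b = 0 then s(a, a) else s(a, b), fun a b => by
      grind [Sym2.eq_swap]⟩) (by
    intro x
    induction x with | _ a b
    simp only [Sym2.lift_mk]
    split_ifs <;> simp_all [Sym2.lift_mk, Sym2.eq_swap])

theorem hinge_mk [NeZero M] (a b : Fin M) : hinge M s(a, b) = if a = b then s(0, a) else
    if a = 0 then s(b, b) else if b = 0 then s(a, a) else s(a, b) := rfl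

theorem hinge_pairHom [NeZero M] {σ : Perm (Fin M)} (hσ : σ 0 = 0) (x : Sym2 (Fin M)) :
    hinge M (pairHom M σ x) = pairHom M σ (hinge M x) := by
  induction x with | _ a b
  have h0 (c : Fin M) : σ c = 0 ↔ c = 0 := by rw [← σ.injective.eq_iff (a := c), hσ]
  simp only [pairHom_mk, hinge_mk, σ.injective.eq_iff, h0]
  split_ifs <;> simp [hσ]

theorem mem_hinge [NeZero M] {i : Fin M} (hi : i ≠ 0) {x : Sym2 (Fin M)} (hx : i ∈ x) :
    i ∈ hinge M x := by
  induction x with | _ a b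
  rw [hinge_mk]
  simp only [Sym2.mem_iff] at hx
  split_ifs <;> simp only [Sym2.mem_iff] <;> grind

theorem mem_pairHom {σ : Perm (Fin M)} {i : Fin M} {x : Sym2 (Fin M)} (hx : i ∈ x) :
    σ i ∈ pairHom M σ x := by
  induction x with | _ a b
  simpa using hx

theorem eq_of_forall_mem_sym2 (hM : 3 ≤ M) {i j : Fin M}
    (h : ∀ x y : Sym2 (Fin M), (i ∈ x ↔ i ∈ y) → (j ∈ x ↔ j ∈ y)) : i = j := by
  by_contra hij
  obtain ⟨l, hi, hj⟩ := exists_ne_ne hM i j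
  have := (h s(j, j) s(l, l) (by simp [hij, hi.symm])).1 (by simp)
  simp [hj.symm] at this

end Pairs

section Pairs

theorem sign_map_eq_one {β : Type*} [Fintype β] [DecidableEq β] {M : ℕ}
    {ψ : Perm (Fin M) →* Perm β} (h : ∀ i j, i ≠ j → sign (ψ (swap i j)) = 1) (σ : Perm (Fin M)) :
    sign (ψ σ) = 1 := by
  induction σ using swap_induction_on with
  | one => rw [map_one, Perm.sign_one]
  | swap_mul σ i j hij ih => rw [map_mul, Perm.sign_mul, h i j hij, ih, one_mul]

variable {k : ℕ} [NeZero k]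

theorem handleData_pairs :
    HandleData k (pairHom 5) 1 (hinge 5) s(0, 0) (fun i x => i ∈ x) where
  three_le := by omega
  sq_c _ := rfl
  sq_u := (hinge 5).left_inv
  comm_c _ _ := rfl
  comm_u σ hσ x := hinge_pairHom (hσ 0 rfl) x
  map_ψ σ i x hx := mem_pairHom hx
  map_c := Or.inl fun _ _ => id
  map_u i x hi hx := mem_hinge (fun e => hi (by rw [e]; rfl)) hx
  sep i j h := eq_of_forall_mem_sym2 (by omega) h
  u_base := by decide
  fix_base σ hσ := by rw [pairHom_mk, hσ 0 rfl]
  move_base := by decide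
  not_mem_base := by decide
  twist := by
    rcases Nat.lt_or_ge 1 k with hk | hk
    · exact Or.inr (Or.inl hk)
    · exact Or.inl ⟨le_antisymm hk (NeZero.pos k), rfl⟩

theorem linked_sym2 {α : Type*} [DecidableEq α] {H : Subgroup (Perm α)} {M : ℕ}
    {f : Sym2 (Fin M) → α} (h1 : ∀ σ, ∃ g ∈ H, ∀ x, g (f x) = f (pairHom M σ x)) {i j : Fin M}
    (hij : i ≠ j) (h : Linked H (f s(i, i)) (f s(i, j))) (x : Sym2 (Fin M)) :
    Linked H (f s(i, i)) (f x) := by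
  have key (a b : Fin M) (hab : a ≠ b) : Linked H (f s(a, a)) (f s(a, b)) := by
    obtain ⟨σ, hσi, hσj⟩ : ∃ σ : Perm (Fin M), σ i = a ∧ σ j = b := by
      refine ⟨swap (swap i a j) b * swap i a, ?_, by simp⟩
      have h1 : swap i a j ≠ a := fun e => hij ((swap i a).injective (by rw [e, swap_apply_left]))
      rw [Perm.mul_apply, swap_apply_left, swap_apply_of_ne_of_ne h1.symm hab]
    obtain ⟨g, hg, e⟩ := h1 σ
    have := h.map hg
    rwa [e, e, pairHom_mk, pairHom_mk, hσi, hσj] at this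
  have diag (a : Fin M) : Linked H (f s(i, i)) (f s(a, a)) := by
    by_cases ha : i = a
    · exact Or.inl (by rw [ha])
    · have := key a i (Ne.symm ha)
      rw [Sym2.eq_swap (a := a) (b := i)] at this
      exact (key i a ha).trans this.symm
  induction x with | _ a b
  by_cases hab : a = b
  · rw [hab]; exact diag b
  · exact (diag a).trans (key a b hab)

set_option maxRecDepth 100000 in
theorem linked_pairs {H : Subgroup (Perm (Option (Sym2 (Fin 5))))}
    (h1 : ∀ σ, Equiv.optionCongr (pairHom 5 σ) ∈ H)
    (h2 : ∀ σ, tip (hinge 5) s(0, 0) * (Equiv.optionCongr (pairHom 5 σ) *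
      tip (hinge 5) s(0, 0) * (Equiv.optionCongr (pairHom 5 σ))⁻¹) ∈ H)
    (x : Sym2 (Fin 5)) : Linked H none (some x) := by
  have hg := Subgroup.mul_mem _ (h2 (swap 0 1)) (Subgroup.mul_mem _ (h1 (swap 0 2))
    (Subgroup.mul_mem _ (h2 (swap 0 1)) (Subgroup.mul_mem _ (h1 (swap 0 2)) (h2 (swap 0 4)))))
  have hc : cyc (some s(0, 0)) (some s(0, 2)) (some s(0, 4)) ∈ H := by
    convert Subgroup.mul_mem _ hg hg using 1
    decide +kernel
  have hl (y : Sym2 (Fin 5)) : Linked H (some s(0, 0)) (some y) :=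
    linked_sym2 (f := some) (fun σ => ⟨_, h1 σ, fun _ => rfl⟩) (by decide)
      (Linked.of_cyc (by decide) (by decide) (by decide) hc) y
  have h0 := ((hl s(1, 1)).symm.trans (hl s(0, 1))).map (h2 (swap 0 1))
  have e0 : (tip (hinge 5) s(0, 0) * (Equiv.optionCongr (pairHom 5 (swap 0 1)) *
      tip (hinge 5) s(0, 0) * (Equiv.optionCongr (pairHom 5 (swap 0 1)))⁻¹))
      (some s(0, 1)) = none := by decide +kernel
  have e1 : (tip (hinge 5) s(0, 0) * (Equiv.optionCongr (pairHom 5 (swap 0 1)) *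
      tip (hinge 5) s(0, 0) * (Equiv.optionCongr (pairHom 5 (swap 0 1)))⁻¹))
      (some s(1, 1)) = some s(0, 0) := by decide +kernel
  rw [e0, e1] at h0
  exact h0.symm.trans (hl x)

/-- `n ≡ 3 [MOD 4]`, `19 ≤ n`. -/
theorem exists_rep_pairs {n s : ℕ} (hn : n % 4 = 3) (hn' : 19 ≤ n) (h3 : 3 ≤ s) (hs : s ≤ 5) :
    ∃ ρ : Fin s → alternatingGroup (Fin n), IsStringCGroupRep ρ := by
  obtain ⟨q, rfl⟩ : ∃ q, n = 4 * (q + 1) + 15 := ⟨(n - 19) / 4, by omega⟩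
  have : NeZero (4 * (q + 1)) := ⟨by omega⟩
  have e1 : 4 * (q + 1) / 2 = 2 * (q + 1) := by omega
  have e2 : (4 * (q + 1) - 1) / 2 = 2 * q + 1 := by omega
  have e3 : sign (hinge 5) = 1 := by
    rw [sign_of_sq_eq_one (by ext1 x; exact (hinge 5).left_inv x)]
    decide +kernel
  refine (handleData_pairs (k := 4 * (q + 1))).exists_rep (fun _ => True) rfl h3 hs ?_ ?_
    (sign_map_eq_one ?_) (fun H h1 h2 x _ => linked_pairs h1 h2 x) (fun _ => Or.inl trivial)
    ⟨s(0, 0), trivial, trivial⟩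
  · rw [e1, pow_mul, Perm.sign_one]
    simp
  · rw [e2, e3, pow_succ, pow_mul]
    simp
  · intro i j _
    rw [sign_of_sq_eq_one (by rw [← map_mul, swap_mul_self, map_one])]
    revert i j
    decide +kernel

end Pairs

section PairsRow

/-- Equality in a sum type, decided without a cast, so that it evaluates on quotient types. -/
local instance decEqSum {α β : Type*} [DecidableEq α] [DecidableEq β] : DecidableEq (α ⊕ β)
  | Sum.inl _, Sum.inl _ => decidable_of_iff _ Sum.inl_injective.eq_iff.symm
  | Sum.inr _, Sum.inr _ => decidable_of_iff _ Sum.inr_injective.eq_iff.symm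
  | Sum.inl _, Sum.inr _ => isFalse Sum.inl_ne_inr
  | Sum.inr _, Sum.inl _ => isFalse Sum.inr_ne_inl

/-- The symmetric group acting on unordered pairs and on one more row. -/
def pairRowHom : Perm (Fin 4) →* Perm (Sym2 (Fin 4) ⊕ Fin 4) :=
  (Perm.sumCongrHom _ _).comp ((pairHom 4).prod (MonoidHom.id _))

@[simp] theorem pairRowHom_inl (σ : Perm (Fin 4)) (x : Sym2 (Fin 4)) :
    pairRowHom σ (Sum.inl x) = Sum.inl (pairHom 4 σ x) := rfl

@[simp] theorem pairRowHom_inr (σ : Perm (Fin 4)) (i : Fin 4) :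
    pairRowHom σ (Sum.inr i) = Sum.inr (σ i) := rfl

/-- Exchange the row of diagonal pairs and the other row, and take the other pairs to their
complements if `b` is true. -/
def rowSwap (b : Bool) : Perm (Sym2 (Fin 4) ⊕ Fin 4) :=
  swap (Sum.inl s(0, 0)) (Sum.inr 0) * swap (Sum.inl s(1, 1)) (Sum.inr 1) *
    swap (Sum.inl s(2, 2)) (Sum.inr 2) * swap (Sum.inl s(3, 3)) (Sum.inr 3) *
  if b then swap (Sum.inl s(0, 1)) (Sum.inl s(2, 3)) * swap (Sum.inl s(0, 2)) (Sum.inl s(1, 3)) *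
    swap (Sum.inl s(0, 3)) (Sum.inl s(1, 2)) else 1

theorem sign_rowSwap (b : Bool) : sign (rowSwap b) = if b then -1 else 1 := by
  cases b <;> simp [rowSwap]

set_option maxRecDepth 100000 in
theorem rowSwap_pairRowHom (b : Bool) (σ : Perm (Fin 4)) (x : Sym2 (Fin 4) ⊕ Fin 4) :
    rowSwap b (pairRowHom σ x) = pairRowHom σ (rowSwap b x) := by
  suffices Commute (rowSwap b) (pairRowHom σ) from congrArg (fun f => f x) this.eq
  induction σ using swap_induction_on with
  | one => rw [map_one]; exact Commute.one_right _
  | swap_mul σ i j hij ih =>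
    rw [map_mul]
    refine Commute.mul_right ?_ ih
    ext1 x
    clear hij ih
    revert b i j x
    decide +kernel

/-- The points of column `i`: a pair belongs to the columns of its members, and a point of the other
row belongs to its own column, or to all other columns if `b` is true. -/
def inCol (b : Bool) (i : Fin 4) (x : Sym2 (Fin 4) ⊕ Fin 4) : Bool :=
  x.elim (fun x => decide (i ∈ x)) (fun j => xor (decide (i = j)) b)

theorem inCol_rowSwap : ∀ (b : Bool) (i : Fin 4) (x : Sym2 (Fin 4) ⊕ Fin 4),
    inCol b i (rowSwap b x) = xor (inCol b i x) b := by
  decide +kernel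

theorem isLeft_or_isLeft_rowSwap : ∀ (b : Bool) (x : Sym2 (Fin 4) ⊕ Fin 4),
    x.isLeft ∨ (rowSwap b x).isLeft := by
  decide +kernel

theorem isLeft_rowSwap : ∀ b, (rowSwap b (Sum.inl s(0, 1))).isLeft := by
  decide +kernel

variable {k : ℕ}

theorem handleData_pairRow [NeZero k] {b : Bool} (hb : b = true → Even k) :
    HandleData k pairRowHom (rowSwap b) (Perm.sumCongr (hinge 4) 1) (Sum.inl s(0, 0))
      (fun i x => inCol b i x) where
  three_le := by omega
  sq_c := by clear hb; revert b; decide +kernel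
  sq_u := by decide +kernel
  comm_c := rowSwap_pairRowHom b
  comm_u σ hσ := by
    rintro (x | x)
    · simp [hinge_pairHom (hσ 0 rfl)]
    · simp
  map_ψ σ i := by
    rintro (x | x) hx
    · simp only [inCol, Sum.elim_inl, decide_eq_true_eq, pairRowHom_inl] at hx ⊢
      exact mem_pairHom hx
    · simpa [inCol] using hx
  map_c := by
    rcases b
    · exact Or.inl fun i x hx => by rw [inCol_rowSwap]; simpa using hx
    · exact Or.inr ⟨hb rfl, fun i x => by rw [inCol_rowSwap]; simp⟩
  map_u i := by
    rintro (x | x) hi hx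
    · simp only [inCol, Sum.elim_inl, decide_eq_true_eq, Perm.sumCongr_apply, Sum.map_inl] at hx ⊢
      exact mem_hinge (fun e => hi (by rw [e]; rfl)) hx
    · exact hx
  sep i j h := eq_of_forall_mem_sym2 (by omega) fun x y => by
    simpa [inCol] using h (Sum.inl x) (Sum.inl y)
  u_base := by decide
  fix_base σ hσ := by rw [pairRowHom_inl, pairHom_mk, hσ 0 rfl]
  move_base := by decide
  not_mem_base := by clear hb; revert b; decide +kernel
  twist := Or.inr (Or.inr (by clear hb; revert b; decide +kernel))

set_option maxRecDepth 100000 in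
theorem linked_pairRow {H : Subgroup (Perm (Option (Sym2 (Fin 4) ⊕ Fin 4)))}
    (h1 : ∀ σ, Equiv.optionCongr (pairRowHom σ) ∈ H)
    (h2 : ∀ σ, tip (Perm.sumCongr (hinge 4) 1) (Sum.inl s(0, 0)) *
      (Equiv.optionCongr (pairRowHom σ) * tip (Perm.sumCongr (hinge 4) 1) (Sum.inl s(0, 0)) *
      (Equiv.optionCongr (pairRowHom σ))⁻¹) ∈ H)
    (x : Sym2 (Fin 4)) : Linked H none (some (Sum.inl x)) := by
  have hg := Subgroup.mul_mem _ (h2 (swap 0 1)) (Subgroup.mul_mem _ (h1 (swap 0 1 * swap 0 2))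
    (Subgroup.mul_mem _ (h2 (swap 0 2)) (Subgroup.mul_mem _ (h1 (swap 0 2 * swap 0 1))
    (h2 (swap 0 3)))))
  have hc : cyc (some (Sum.inl s(0, 0))) (some (Sum.inl s(0, 2))) (some (Sum.inl s(0, 3))) ∈ H := by
    convert Subgroup.mul_mem _ hg hg using 1
    decide +kernel
  have hl (y : Sym2 (Fin 4)) : Linked H (some (Sum.inl s(0, 0))) (some (Sum.inl y)) :=
    linked_sym2 (f := fun y => some (Sum.inl y)) (fun σ => ⟨_, h1 σ, fun _ => rfl⟩) (by decide)
      (Linked.of_cyc (by decide) (by decide) (by decide) hc) y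
  have h0 := ((hl s(1, 1)).symm.trans (hl s(0, 1))).map (h2 (swap 0 1))
  have e0 : (show Perm (Option (Sym2 (Fin 4) ⊕ Fin 4)) from tip (Perm.sumCongr (hinge 4) 1) (Sum.inl s(0, 0)) *
      (Equiv.optionCongr (pairRowHom (swap 0 1)) *
      tip (Perm.sumCongr (hinge 4) 1) (Sum.inl s(0, 0)) *
      (Equiv.optionCongr (pairRowHom (swap 0 1)))⁻¹)) (some (Sum.inl s(0, 1))) = none := by decide +kernel
  have e1 : (show Perm (Option (Sym2 (Fin 4) ⊕ Fin 4)) from tip (Perm.sumCongr (hinge 4) 1) (Sum.inl s(0, 0)) *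
      (Equiv.optionCongr (pairRowHom (swap 0 1)) *
      tip (Perm.sumCongr (hinge 4) 1) (Sum.inl s(0, 0)) *
      (Equiv.optionCongr (pairRowHom (swap 0 1)))⁻¹)) (some (Sum.inl s(1, 1))) = some (Sum.inl s(0, 0)) := by decide +kernel
  rw [show _ = _ from e0, show _ = _ from e1] at h0
  exact h0.symm.trans (hl x)

/-- `n ≡ 3 [MOD 4]`, `15 ≤ n`, and `n ≡ 0 [MOD 4]`, `16 ≤ n`. -/
theorem exists_rep_pairRow {n s : ℕ} (hn : n % 4 = 3 ∨ n % 4 = 0) (hn' : 15 ≤ n) (h3 : 3 ≤ s)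
    (hs : s ≤ 4) : ∃ ρ : Fin s → alternatingGroup (Fin n), IsStringCGroupRep ρ := by
  have e3 : sign (Perm.sumCongr (hinge 4) (1 : Perm (Fin 4))) = -1 := by
    rw [sign_of_sq_eq_one (by decide +kernel)]
    decide +kernel
  obtain ⟨b, q, rfl⟩ : ∃ (b : Bool) (q : ℕ), n = (4 * q + (if b then 2 else 1)) + 14 := by
    rcases hn with hn | hn
    · exact ⟨false, (n - 15) / 4, by simp; omega⟩
    · exact ⟨true, (n - 16) / 4, by simp; omega⟩
  set k := 4 * q + (if b then 2 else 1) with hk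
  have : NeZero k := ⟨by split_ifs at hk <;> omega⟩
  have e2 : (k - 1) / 2 = 2 * q := by split_ifs at hk <;> omega
  refine (handleData_pairRow (k := k) (b := b) ?_).exists_rep (fun x => x.isLeft) rfl h3 hs ?_ ?_
    (sign_map_eq_one ?_) (fun H h1 h2 => ?_) (isLeft_or_isLeft_rowSwap b)
    ⟨Sum.inl s(0, 1), rfl, isLeft_rowSwap b⟩
  · rintro rfl
    exact ⟨2 * q + 1, by rw [hk]; simp; omega⟩
  · rw [sign_rowSwap]
    cases b
    · rw [show k / 2 = 2 * q by simp at hk; omega, pow_mul]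
      simp
    · rw [show k / 2 = 2 * q + 1 by simp at hk; omega, pow_succ, pow_mul]
      simp
  · rw [e2, e3, pow_mul]
    simp
  · intro i j _
    rw [sign_of_sq_eq_one (by rw [← map_mul, swap_mul_self, map_one])]
    revert i j
    decide +kernel
  · rintro (x | x) hx
    · exact linked_pairRow h1 h2 x
    · simp at hx

end PairsRow

section Agree

variable {α : Type*}

/-- If on a set `S` each generator acts as an element of a group preserving `S`, so does every
element. -/
theorem exists_agree {ρ : ℕ → Perm α} {i j : ℕ} {D : Subgroup (Perm α)} {S : Set α}
    (hD : ∀ d ∈ D, ∀ x ∈ S, d x ∈ S)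
    (h : ∀ k, i ≤ k → k < j → ∃ d ∈ D, ∀ x ∈ S, ρ k x = d x) {g : Perm α} (hg : g ∈ itv ρ i j) :
    ∃ d ∈ D, ∀ x ∈ S, g x = d x := by
  refine Subgroup.closure_induction (p := fun g _ => ∃ d ∈ D, ∀ x ∈ S, g x = d x) ?_
    ⟨1, one_mem _, fun _ _ => rfl⟩ ?_ ?_ hg
  · rintro _ ⟨k, hk, rfl⟩
    exact h k hk.1 hk.2
  · rintro a b - - ⟨d, hd, ha⟩ ⟨e, he, hb⟩
    refine ⟨d * e, Subgroup.mul_mem _ hd he, fun x hx => ?_⟩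
    rw [Perm.mul_apply, Perm.mul_apply, hb x hx, ha _ (hD e he x hx)]
  · rintro a - ⟨d, hd, ha⟩
    refine ⟨d⁻¹, Subgroup.inv_mem _ hd, fun x hx => ?_⟩
    rw [Perm.inv_eq_iff_eq, ha _ (hD _ (Subgroup.inv_mem _ hd) x hx)]
    exact (d.apply_symm_apply x).symm

open scoped Pointwise in
theorem mapsTo_itv {ρ : ℕ → Perm α} [Finite α] {i j : ℕ} {S : Set α}
    (h : ∀ k, i ≤ k → k < j → ∀ x ∈ S, ρ k x ∈ S) {g : Perm α} (hg : g ∈ itv ρ i j) {x : α}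
    (hx : x ∈ S) : g x ∈ S := by
  have : itv ρ i j ≤ MulAction.stabilizer (Perm α) S := itv_le fun k h1 h2 => by
    rw [MulAction.mem_stabilizer_set_iff_smul_set_subset S.toFinite]
    rintro _ ⟨x, hx, rfl⟩
    exact h k h1 h2 x hx
  have := MulAction.mem_stabilizer_iff.1 (this hg)
  rw [← this]
  exact ⟨x, hx, rfl⟩

theorem fix_itv {ρ : ℕ → Perm α} {i j : ℕ} {x : α} (h : ∀ k, i ≤ k → k < j → ρ k x = x)
    {g : Perm α} (hg : g ∈ itv ρ i j) : g x = x := by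
  have : itv ρ i j ≤ MulAction.stabilizer (Perm α) x := itv_le h
  exact this hg

theorem sign_itv [Fintype α] [DecidableEq α] {ρ : ℕ → Perm α} {i j : ℕ}
    (h : ∀ k, i ≤ k → k < j → sign (ρ k) = 1) {g : Perm α} (hg : g ∈ itv ρ i j) : sign g = 1 := by
  have : itv ρ i j ≤ alternatingGroup α := itv_le h
  exact this hg

/-- The generators from `i` to `j - 1` act on `S` as those from `a` to `b - 1`, or trivially. -/
structure ActsBy (ρ : ℕ → Perm α) (i j a b : ℕ) (S : Set α) : Prop where
  map : ∀ k, a ≤ k → k < b → ∀ x ∈ S, ρ k x ∈ S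
  fix : ∀ k, i ≤ k → k < j → ¬ (a ≤ k ∧ k < b) → ∀ x ∈ S, ρ k x = x

theorem ActsBy.exists_agree [Finite α] {ρ : ℕ → Perm α} {i j a b : ℕ} {S : Set α}
    (h : ActsBy ρ i j a b S) {g : Perm α} (hg : g ∈ itv ρ i j) :
    ∃ d ∈ itv ρ a b, ∀ x ∈ S, g x = d x := by
  refine _root_.exists_agree (fun d hd x hx => mapsTo_itv h.map hd hx) (fun k h1 h2 => ?_) hg
  by_cases hk : a ≤ k ∧ k < b
  · exact ⟨ρ k, mem_itv hk.1 hk.2, fun _ _ => rfl⟩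
  · exact ⟨1, one_mem _, h.fix k h1 h2 hk⟩

/-- An intersection condition, reduced to the permutations fixing two sets pointwise. -/
theorem inter_of_fix [Finite α] {ρ : ℕ → Perm α} {i j a b a' b' : ℕ}
    {S S' : Set α} (hS : ActsBy ρ i j a b S)
    (hS' : ActsBy ρ (i + 1) (j + 1) a' b' S') (ha : i + 1 ≤ a) (hb : b ≤ j) (ha' : i + 1 ≤ a')
    (hb' : b' ≤ j) (h1 : ∀ k, a ≤ k → k < b → ∀ x ∈ S', ρ k x = x)
    (h2 : ∀ k, a' ≤ k → k < b' → ∀ x ∈ S, ρ k x = x)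
    (hO : ∀ g ∈ itv ρ i j, (∀ x ∈ S, g x = x) → (∀ x ∈ S', g x = x) → g ∈ itv ρ (i + 1) j) :
    itv ρ i j ⊓ itv ρ (i + 1) (j + 1) ≤ itv ρ (i + 1) j := by
  intro g hg
  obtain ⟨hg1, hg2⟩ := Subgroup.mem_inf.1 hg
  obtain ⟨d, hd, hgd⟩ := hS.exists_agree hg1
  obtain ⟨d', hd', hgd'⟩ := hS'.exists_agree hg2
  have hc : d * d' ∈ itv ρ (i + 1) j :=
    Subgroup.mul_mem _ (itv_mono ha hb hd) (itv_mono ha' hb' hd')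
  have hlow := itv_mono (ρ := ρ) (show i ≤ i + 1 by omega) (le_refl j)
  rw [← Subgroup.mul_mem_cancel_left _ (Subgroup.inv_mem _ hc)]
  refine hO _ (Subgroup.mul_mem _ (Subgroup.inv_mem _ (hlow hc)) hg1) (fun x hx => ?_)
    fun x hx => ?_ <;> rw [Perm.mul_apply, Perm.inv_eq_iff_eq, Perm.mul_apply]
  · rw [hgd x hx, fix_itv (fun k hk hk' => h2 k hk hk' x hx) hd']
  · rw [hgd' x hx, fix_itv (fun k hk hk' => h1 k hk hk' _ (mapsTo_itv hS'.map hd' hx)) hd]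

/-- An intersection condition, from the actions on sets outside of which the smaller group contains
all even permutations. -/
theorem inter_of_actsBy [Fintype α] [DecidableEq α] {ρ : ℕ → Perm α} {i j a b a' b' : ℕ}
    {S S' : Set α} (he : ∀ k, i ≤ k → k < j + 1 → sign (ρ k) = 1) (hS : ActsBy ρ i j a b S)
    (hS' : ActsBy ρ (i + 1) (j + 1) a' b' S') (ha : i + 1 ≤ a) (hb : b ≤ j) (ha' : i + 1 ≤ a')
    (hb' : b' ≤ j) (h1 : ∀ k, a ≤ k → k < b → ∀ x ∈ S', ρ k x = x)
    (h2 : ∀ k, a' ≤ k → k < b' → ∀ x ∈ S, ρ k x = x) {x₀ : α}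
    (hO : ∀ x, x ∉ S → x ∉ S' → Linked (itv ρ (i + 1) j) x₀ x) :
    itv ρ i j ⊓ itv ρ (i + 1) (j + 1) ≤ itv ρ (i + 1) j := by
  refine inter_of_fix hS hS' ha hb ha' hb' h1 h2 fun g hg hgS hgS' => ?_
  refine mem_of_linked (O := {x | x ∉ S ∧ x ∉ S'}) (fun x hx => hO x hx.1 hx.2)
    (sign_itv (fun k hk hk' => he k hk (by omega)) hg) fun x hx => ?_
  by_cases h : x ∈ S
  · exact hgS x h
  · exact hgS' x (by_contra fun h' => hx ⟨h, h'⟩)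

theorem inter_pair {G : Type*} [Group G] {ρ : ℕ → G} {i : ℕ} (h1 : ρ i * ρ i = 1)
    (h2 : ρ (i + 1) * ρ (i + 1) = 1) (hne : ρ i ≠ ρ (i + 1)) :
    itv ρ i (i + 1) ⊓ itv ρ (i + 1) (i + 1 + 1) ≤ itv ρ (i + 1) (i + 1) := by
  intro g hg
  obtain ⟨hg1, hg2⟩ := Subgroup.mem_inf.1 hg
  rcases (mem_itv_one h1).1 hg1 with rfl | rfl
  · exact one_mem _
  · rcases (mem_itv_one h2).1 hg2 with e | e
    · exact e ▸ one_mem _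
    · exact absurd e hne

/-- An even permutation moving at most two points is trivial. -/
theorem eq_one_of_sign [Fintype α] [DecidableEq α] {g : Perm α} (hg : sign g = 1) {x y : α}
    (h : ∀ w, w ≠ x → w ≠ y → g w = w) : g = 1 := by
  by_contra hne
  have h2 : g.support ⊆ {x, y} := fun w hw => by
    by_contra hw'
    simp only [Finset.mem_insert, Finset.mem_singleton, not_or] at hw'
    exact (mem_support.1 hw) (h w hw'.1 hw'.2)
  have h3 := (Finset.card_le_card h2).trans Finset.card_le_two
  have h4 := two_le_card_support_of_ne_one hne
  have h5 := (card_support_eq_two.1 (le_antisymm h3 h4)).sign_eq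
  rw [hg] at h5
  exact absurd h5 (by decide)

/-- The action on an embedded set on which each generator acts as prescribed. -/
theorem exists_acts {β : Type*} (ι : β → α) {ρ : ℕ → Perm α} {r : ℕ → Perm β} {i j : ℕ}
    (h : ∀ k, i ≤ k → k < j → ∀ x, ρ k (ι x) = ι (r k x)) {g : Perm α} (hg : g ∈ itv ρ i j) :
    ∃ d ∈ itv r i j, ∀ x, g (ι x) = ι (d x) := by
  refine Subgroup.closure_induction (p := fun g _ => ∃ d ∈ itv r i j, ∀ x, g (ι x) = ι (d x)) ?_
    ⟨1, one_mem _, fun _ => rfl⟩ ?_ ?_ hg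
  · rintro _ ⟨k, hk, rfl⟩
    exact ⟨r k, mem_itv hk.1 hk.2, h k hk.1 hk.2⟩
  · rintro a b - - ⟨d, hd, ha⟩ ⟨e, he, hb⟩
    exact ⟨d * e, Subgroup.mul_mem _ hd he, fun x => by
      rw [Perm.mul_apply, Perm.mul_apply, hb x, ha]⟩
  · rintro a - ⟨d, hd, ha⟩
    refine ⟨d⁻¹, Subgroup.inv_mem _ hd, fun x => ?_⟩
    rw [Perm.inv_eq_iff_eq, ha]
    exact congrArg ι (d.apply_symm_apply x).symm

/-- Conversely, every element of the group prescribed on an embedded set is the action of one. -/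
theorem exists_lift {β : Type*} (ι : β → α) {ρ : ℕ → Perm α} {r : ℕ → Perm β} {i j : ℕ}
    (h : ∀ k, i ≤ k → k < j → ∀ x, ρ k (ι x) = ι (r k x)) {d : Perm β} (hd : d ∈ itv r i j) :
    ∃ g ∈ itv ρ i j, ∀ x, g (ι x) = ι (d x) := by
  refine Subgroup.closure_induction (p := fun d _ => ∃ g ∈ itv ρ i j, ∀ x, g (ι x) = ι (d x)) ?_
    ⟨1, one_mem _, fun _ => rfl⟩ ?_ ?_ hd
  · rintro _ ⟨k, hk, rfl⟩
    exact ⟨ρ k, mem_itv hk.1 hk.2, h k hk.1 hk.2⟩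
  · rintro a b - - ⟨d, hd, ha⟩ ⟨e, he, hb⟩
    exact ⟨d * e, Subgroup.mul_mem _ hd he, fun x => by
      rw [Perm.mul_apply, Perm.mul_apply, hb x, ha]⟩
  · rintro a - ⟨d, hd, ha⟩
    refine ⟨d⁻¹, Subgroup.inv_mem _ hd, fun x => ?_⟩
    rw [Perm.inv_eq_iff_eq, ha]
    exact congrArg ι (a.apply_symm_apply x).symm

end Agree

section Tail

/-- The exchange of two rows. -/
def rowFlip (M : ℕ) : Perm (Fin M × Bool) := prodCongrRight fun _ => Equiv.boolNot

@[simp] theorem rowFlip_apply {M : ℕ} (x : Fin M × Bool) : rowFlip M x = (x.1, !x.2) := rfl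

theorem rowFlip_mul_self {M : ℕ} : rowFlip M * rowFlip M = 1 := by
  ext1 x
  simp

theorem sign_rowFlip {M : ℕ} : sign (rowFlip M) = (-1) ^ M := by
  rw [rowFlip, sign_prodCongrRight]
  have : sign Equiv.boolNot = -1 := by decide
  simp [this]

/-- The action on the columns of two rows, next to a set `P` of fixed points. -/
def outHom (P : Type*) (M : ℕ) : Perm (Fin M) →* Perm (P ⊕ Fin M × Bool) :=
  ((Perm.sumCongrHom P _).comp (MonoidHom.inr _ _)).comp (colHom M)

@[simp] theorem outHom_inl {P : Type*} {M : ℕ} (σ : Perm (Fin M)) (x : P) :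
    outHom P M σ (Sum.inl x) = Sum.inl x := rfl

@[simp] theorem outHom_inr {P : Type*} {M : ℕ} (σ : Perm (Fin M)) (x : Fin M × Bool) :
    outHom P M σ (Sum.inr x) = Sum.inr (σ x.1, x.2) := rfl

variable {P : Type*} {m s : ℕ}

/-- Generators ending with the adjacent transpositions of the columns of two rows, the first of them
twisted by the exchange of the rows and by an involution `z` of the other points. -/
structure Tail [Fintype P] [DecidableEq P] (m s : ℕ) (z : Perm P)
    (ρ : ℕ → Perm (P ⊕ Fin (m + 3) × Bool)) : Prop where
  sq_z : z * z = 1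
  sign_z : sign z = (-1) ^ (m + 3)
  one : ρ (s + 1) = outHom P (m + 3) (adj (m + 3) 1) * Perm.sumCongr z (rowFlip (m + 3))
  two : ∀ i, 2 ≤ i → i < m + 3 → ρ (s + i) = outHom P (m + 3) (adj (m + 3) i)
  low : ∀ k < s, ∀ x, ρ k (Sum.inr x) = Sum.inr x
  head : ∀ x : Fin (m + 3) × Bool, (x.1 : ℕ) ≠ 0 → ρ s (Sum.inr x) = Sum.inr x
  sq : ∀ k ≤ s, ρ k * ρ k = 1
  ne_one : ∀ k ≤ s, ρ k ≠ 1
  even : ∀ k ≤ s, sign (ρ k) = 1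
  comm : ∀ i j, i + 1 < j → j ≤ s + 1 → Commute (ρ i) (ρ j)
  sep : ∃ (S : Set (P ⊕ Fin (m + 3) × Bool)) (q : Bool), (∀ x ∈ S, ρ s x ∈ S) ∧
    (∀ x ∈ S, ρ (s + 1) x ∈ S) ∧ Sum.inr (0, q) ∈ S ∧ Sum.inr (0, !q) ∉ S ∧ Sum.inr (1, q) ∉ S

theorem adj_not_commute {M i : ℕ} (hi : 0 < i) (hM : i + 1 < M) :
    ¬ Commute (adj M (i + 1)) (adj M i) := by
  intro hc
  have := congrArg (fun f => f ⟨i - 1, by omega⟩) hc.eq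
  rw [Perm.mul_apply, Perm.mul_apply, adj_apply_of_ne (x := ⟨i - 1, _⟩) (i := i + 1)
    (by simp; omega) (by simp), adj_eq hi (Nat.lt_of_succ_lt hM), adj_eq (by omega) hM] at this
  simp only [Nat.add_sub_cancel, swap_apply_left, Fin.mk.injEq] at this
  omega

theorem cases_col (x : Fin (m + 3) × Bool) : 2 ≤ (x.1 : ℕ) ∨ x = (0, false) ∨ x = (0, true) ∨
    x = (1, false) ∨ x = (1, true) := by
  obtain ⟨⟨c, hc⟩, b⟩ := x
  rcases c with _ | _ | c
  · cases b <;> simp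
  · cases b <;> simp
  · simp

namespace Tail

variable [Fintype P] [DecidableEq P] {z : Perm P} {ρ : ℕ → Perm (P ⊕ Fin (m + 3) × Bool)}
  (h : Tail m s z ρ)
include h

theorem apply_far {k d : ℕ} (hd : 0 < d) (hk : k < s + d)
    {x : Fin (m + 3) × Bool} (hx : d ≤ (x.1 : ℕ)) (hk1 : k ≠ s + 1) :
    ρ k (Sum.inr x) = Sum.inr x := by
  rcases lt_trichotomy k s with h1 | rfl | h1
  · exact h.low k h1 x
  · exact h.head x (by omega)
  · obtain ⟨e, rfl⟩ : ∃ e, k = s + e := ⟨k - s, by omega⟩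
    rw [h.two e (by omega) (by omega), outHom_inr]
    refine congrArg Sum.inr (Prod.ext ?_ rfl)
    exact adj_apply_of_ne (by omega) (by omega)

theorem apply_one_far {x : Fin (m + 3) × Bool} (hx : 2 ≤ (x.1 : ℕ)) :
    ρ (s + 1) (Sum.inr x) = Sum.inr (x.1, !x.2) := by
  rw [h.one, Perm.mul_apply, Perm.sumCongr_apply, Sum.map_inr, rowFlip_apply, outHom_inr]
  refine congrArg Sum.inr (Prod.ext ?_ rfl)
  exact adj_apply_of_ne (x := x.1) (by omega) (by omega)

theorem fst_far {d : ℕ} (hd : 2 ≤ d) {g : Perm (P ⊕ Fin (m + 3) × Bool)} {i : ℕ}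
    (hg : g ∈ itv ρ i (s + d)) {x : Fin (m + 3) × Bool} (hx : d ≤ (x.1 : ℕ)) :
    ∃ b, g (Sum.inr x) = Sum.inr (x.1, b) := by
  refine mapsTo_itv (S := {y | ∃ b, y = Sum.inr (x.1, b)}) ?_ hg ⟨x.2, rfl⟩
  rintro k - hk _ ⟨b, rfl⟩
  by_cases hk1 : k = s + 1
  · subst hk1
    exact ⟨!b, h.apply_one_far (x := (x.1, b)) (show 2 ≤ (x.1 : ℕ) by omega)⟩
  · exact ⟨b, h.apply_far (x := (x.1, b)) (by omega) hk hx hk1⟩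

theorem apply_inl {i : ℕ} (hi : 2 ≤ i) (hm : i < m + 3) (x : P) :
    ρ (s + i) (Sum.inl x) = Sum.inl x := by
  rw [h.two i hi hm, outHom_inl]

theorem apply_near {i : ℕ} (hi : 2 ≤ i) (hm : i < m + 3) {x : Fin (m + 3) × Bool}
    (hx : (x.1 : ℕ) + 1 < i) : ρ (s + i) (Sum.inr x) = Sum.inr x := by
  rw [h.two i hi hm, outHom_inr, adj_apply_of_ne (by omega) (by omega)]

theorem apply_pred {i : ℕ} (hi : 2 ≤ i) (hm : i < m + 3) (b : Bool) :
    ρ (s + i) (Sum.inr (⟨i - 1, by omega⟩, b)) = Sum.inr (⟨i, hm⟩, b) := by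
  rw [h.two i hi hm, outHom_inr, adj_eq (by omega) hm, swap_apply_left]

theorem sign_eq {k : ℕ} (hk : k < s + (m + 3)) : sign (ρ k) = 1 := by
  have hs : ∀ σ, sign (outHom P (m + 3) σ) = 1 := fun σ => by
    refine (Perm.sign_sumCongr _ _).trans ?_
    rw [MonoidHom.inr_apply, Perm.sign_one, one_mul, sign_colHom]
  rcases le_or_gt k s with h1 | h1
  · exact h.even k h1
  obtain ⟨e, rfl⟩ : ∃ e, k = s + e := ⟨k - s, by omega⟩
  rcases (show 1 ≤ e by omega).eq_or_lt with rfl | he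
  · rw [h.one, Perm.sign_mul, hs, Perm.sign_sumCongr, h.sign_z, sign_rowFlip, one_mul, ← mul_pow]
    simp
  · rw [h.two e he (by omega), hs]

theorem twistedSym : TwistedSym (outHom P (m + 3)) (Perm.sumCongr z (rowFlip (m + 3)))
    (fun k => ρ (k + s)) where
  inj σ τ e := by
    ext x
    have := congrArg (fun g => g (Sum.inr (x, false))) e
    simp only [outHom_inr, Sum.inr.injEq, Prod.mk.injEq] at this
    rw [this.1]
  three_le := by omega
  sq := by rw [Perm.sumCongr_mul, h.sq_z, rowFlip_mul_self, Perm.sumCongr_one]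
  comm σ := by
    ext1 x
    rcases x with x | x <;> simp
  one := by rw [add_comm 1 s, h.one]
  two i hi hm := by rw [add_comm i s, h.two i hi hm]

theorem commute_head {i : ℕ} (hi : 2 ≤ i) (hm : i < m + 3) {k : ℕ} (hk : k ≤ s) :
    Commute (ρ k) (ρ (s + i)) := by
  refine Disjoint.commute fun x => ?_
  rcases x with x | x
  · exact Or.inr (h.apply_inl hi hm x)
  · rcases Nat.eq_zero_or_pos (x.1 : ℕ) with hx | hx
    · exact Or.inr (h.apply_near hi hm (by omega))
    · exact Or.inl (h.apply_far one_pos (by omega) hx (by omega))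

theorem isStringC_shift : IsStringC (fun k => ρ (k + s)) (m + 3) := by
  have hs : ∀ i j, itv (fun k => ρ (k + s)) i j = itv ρ (s + i) (s + j) := fun i j => by
    rw [itv_shift, add_comm s, add_comm s]
  refine h.twistedSym.isStringC ?_ ?_ ?_ ?_ ?_
  · simpa using h.sq s le_rfl
  · simpa using h.ne_one s le_rfl
  · intro i hi hm
    simpa [add_comm i] using h.commute_head hi hm le_rfl
  · intro j hj hm hcon
    rw [hs] at hcon
    obtain ⟨b, hb⟩ := h.fst_far (by omega) hcon (x := (⟨j, hm⟩, false)) le_rfl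
    rw [outHom_inr, adj_eq (by omega) hm, swap_apply_right] at hb
    simp at hb
    omega
  · intro g hg
    obtain ⟨hg1, hg2⟩ := Subgroup.mem_inf.1 hg
    obtain ⟨σ, hσ, hgσ⟩ := h.twistedSym.exists_of_mem (by omega) hg2
    rw [hs] at hg1
    have hσ2 : ∀ x : Fin (m + 3), 2 ≤ (x : ℕ) → σ x = x := by
      intro x hx
      obtain ⟨b, hb⟩ := h.fst_far le_rfl hg1 (x := (x, false)) hx
      rcases hgσ with rfl | rfl <;> simp at hb <;> exact hb.1
    have hσ' : σ = 1 ∨ σ = adj (m + 3) 1 := by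
      refine (mem_itv_one (adj_mul_self 1)).1 (mem_itv_adj (fun x hx => absurd hx (by omega)) hσ2)
    obtain ⟨S, q, hS1, hS2, hq, hq1, hq2⟩ := h.sep
    have hgS : g (Sum.inr (0, q)) ∈ S := by
      refine mapsTo_itv (fun k hk hk' => ?_) hg1 hq
      obtain rfl | rfl : k = s ∨ k = s + 1 := by omega
      · exact hS1
      · exact hS2
    have h01 : adj (m + 3) 1 0 = 1 := by
      rw [adj_eq (by omega) (by omega)]; exact swap_apply_left _ _
    rcases hgσ with rfl | rfl <;> rcases hσ' with rfl | rfl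
    · exact map_one (outHom P (m + 3)) ▸ one_mem _
    · rw [outHom_inr, h01] at hgS
      exact absurd hgS hq2
    · rw [map_one, one_mul, Perm.sumCongr_apply, Sum.map_inr, rowFlip_apply] at hgS
      exact absurd hgS hq1
    · rw [← h.twistedSym.one]
      exact mem_itv le_rfl (by omega)

theorem isStringC (hi : ∀ i < s, ∀ j, i < j → j < s + (m + 3) →
    itv ρ i j ⊓ itv ρ (i + 1) (j + 1) ≤ itv ρ (i + 1) j) : IsStringC ρ (s + (m + 3)) where
  sq k hk := by
    rcases le_or_gt k s with h1 | h1
    · exact h.sq k h1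
    · simpa [Nat.sub_add_cancel h1.le] using h.isStringC_shift.sq (k - s) (by omega)
  ne_one k hk := by
    rcases le_or_gt k s with h1 | h1
    · exact h.ne_one k h1
    · simpa [Nat.sub_add_cancel h1.le] using h.isStringC_shift.ne_one (k - s) (by omega)
  comm i j hij hj := by
    rcases le_or_gt j (s + 1) with h1 | h1
    · exact h.comm i j hij h1
    rcases le_or_gt i s with h2 | h2
    · obtain ⟨e, rfl⟩ : ∃ e, j = s + e := ⟨j - s, by omega⟩
      exact h.commute_head (by omega) (by omega) h2
    · have := h.isStringC_shift.comm (i - s) (j - s) (by omega) (by omega)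
      simpa [Nat.sub_add_cancel h2.le, Nat.sub_add_cancel (show s ≤ j by omega)] using this
  inter i j hij hj := by
    rcases lt_or_ge i s with h1 | h1
    · exact hi i h1 j hij hj
    · have := h.isStringC_shift.inter (i - s) (j - s) (by omega) (by omega)
      simpa only [itv_shift, show i - s + 1 + s = i + 1 by omega, show j - s + 1 + s = j + 1 by omega,
        Nat.sub_add_cancel h1, Nat.sub_add_cancel (show s ≤ j by omega)] using this

theorem linked_near {i d : ℕ} (hi : i ≤ s + 1) (hd : 3 ≤ d)
    (hl : ∀ x : Fin (m + 3) × Bool, (x.1 : ℕ) < 2 →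
      Linked (itv ρ i (s + 3)) (Sum.inr (0, false)) (Sum.inr x))
    (x : Fin (m + 3) × Bool) (hx : (x.1 : ℕ) < d) :
    Linked (itv ρ i (s + d)) (Sum.inr (0, false)) (Sum.inr x) := by
  obtain ⟨⟨c, hc⟩, b⟩ := x
  induction c with
  | zero => exact (hl _ (by simp)).mono (itv_mono le_rfl (by omega))
  | succ c ih =>
    rcases Nat.eq_zero_or_pos c with rfl | hc0
    · exact (hl _ (by simp)).mono (itv_mono le_rfl (by omega))
    · have := (ih (by omega) (by simp at hx ⊢; omega)).map
        (mem_itv (ρ := ρ) (k := s + (c + 1)) (i := i) (j := s + d) (by omega)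
          (by simp at hx; omega))
      rw [h.apply_near (by omega) hc (by simp; omega)] at this
      exact (h.apply_pred (i := c + 1) (by omega) hc b) ▸ this

/-- The intersection conditions whose groups involve sufficiently many columns. -/
theorem inter_far {i d : ℕ} (hi : i < s) (hd : 3 ≤ d) (hdm : d < m + 3) (Q : Set P)
    (hz : ∀ p ∈ Q, z p = p)
    (hQ : ∀ k, i + 1 ≤ k → k ≤ s → ∀ p ∈ Q, ∃ p' ∈ Q, ρ k (Sum.inl p) = Sum.inl p')
    (hP : ∀ p ∉ Q, Linked (itv ρ (i + 1) (s + 3)) (Sum.inr (0, false)) (Sum.inl p))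
    (hl : ∀ x : Fin (m + 3) × Bool, (x.1 : ℕ) < 2 →
      Linked (itv ρ (i + 1) (s + 3)) (Sum.inr (0, false)) (Sum.inr x)) :
    itv ρ i (s + d) ⊓ itv ρ (i + 1) (s + d + 1) ≤ itv ρ (i + 1) (s + d) := by
  have hz' : ∀ p ∈ Q, ρ (s + 1) (Sum.inl p) = Sum.inl p := fun p hp => by
    rw [h.one, Perm.mul_apply, Perm.sumCongr_apply, Sum.map_inl, outHom_inl, hz p hp]
  refine inter_of_actsBy (a := s + 1) (b := s + 2) (a' := i + 1) (b' := s + 1)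
    (S := {y | ∃ x : Fin (m + 3) × Bool, d ≤ (x.1 : ℕ) ∧ y = Sum.inr x})
    (S' := {y | ∃ p ∈ Q, y = Sum.inl p})
    (fun k _ hk => h.sign_eq (by omega)) ⟨?_, ?_⟩ ⟨?_, ?_⟩ (by omega) (by omega) (by omega)
    (by omega) ?_ ?_ (x₀ := Sum.inr (0, false)) ?_
  · rintro k h1 h2 _ ⟨x, hx, rfl⟩
    obtain rfl : k = s + 1 := by omega
    exact ⟨(x.1, !x.2), hx, h.apply_one_far (by omega)⟩
  · rintro k h1 h2 h3 _ ⟨x, hx, rfl⟩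
    exact h.apply_far (by omega) h2 hx (by omega)
  · rintro k h1 h2 _ ⟨p, hp, rfl⟩
    obtain ⟨p', hp', e⟩ := hQ k h1 (by omega) p hp
    exact ⟨p', hp', e⟩
  · rintro k h1 h2 h3 _ ⟨p, hp, rfl⟩
    obtain ⟨e, rfl⟩ : ∃ e, k = s + e := ⟨k - s, by omega⟩
    rcases (show 1 ≤ e by omega).eq_or_lt with rfl | he
    · exact hz' p hp
    · exact h.apply_inl he (by omega) p
  · rintro k h1 h2 _ ⟨p, hp, rfl⟩
    obtain rfl : k = s + 1 := by omega
    exact hz' p hp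
  · rintro k h1 h2 _ ⟨x, hx, rfl⟩
    exact h.apply_far (d := d) (by omega) (by omega) hx (by omega)
  · rintro (p | x) h1 h2
    · exact (hP p fun hp => h2 ⟨p, hp, rfl⟩).mono (itv_mono le_rfl (by omega))
    · refine h.linked_near (by omega) hd hl x ?_
      by_contra! hx
      exact h1 ⟨x, hx, rfl⟩

theorem apply_zero (b : Bool) : ρ (s + 1) (Sum.inr (0, b)) = Sum.inr (1, !b) := by
  rw [h.one, Perm.mul_apply, Perm.sumCongr_apply, Sum.map_inr, rowFlip_apply, outHom_inr,
    adj_eq one_pos (by omega)]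
  exact congrArg (fun c => Sum.inr (c, !b)) (swap_apply_left _ _)

theorem apply_one (b : Bool) : ρ (s + 1) (Sum.inr (1, b)) = Sum.inr (0, !b) := by
  rw [h.one, Perm.mul_apply, Perm.sumCongr_apply, Sum.map_inr, rowFlip_apply, outHom_inr,
    adj_eq one_pos (by omega)]
  exact congrArg (fun c => Sum.inr (c, !b)) (swap_apply_right _ _)

theorem apply_one_inl (p : P) : ρ (s + 1) (Sum.inl p) = Sum.inl (z p) := by
  rw [h.one, Perm.mul_apply, Perm.sumCongr_apply, Sum.map_inl, outHom_inl]

/-- The first two columns are linked as soon as two of their points are. -/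
theorem linked_cols {i : ℕ} (hi : i ≤ s + 1)
    (hl : Linked (itv ρ i (s + 3)) (Sum.inr (0, false)) (Sum.inr (1, true)))
    (x : Fin (m + 3) × Bool) (hx : (x.1 : ℕ) < 2) :
    Linked (itv ρ i (s + 3)) (Sum.inr (0, false)) (Sum.inr x) := by
  have m1 : ρ (s + 1) ∈ itv ρ i (s + 3) := mem_itv hi (by omega)
  have m2 : ρ (s + 2) ∈ itv ρ i (s + 3) := mem_itv (by omega) (by omega)
  have e0 : ∀ b, ρ (s + 2) (Sum.inr (0, b)) = Sum.inr (0, b) := fun b =>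
    h.apply_near le_rfl (by omega) (by simp)
  have e1 : ∀ b, ρ (s + 2) (Sum.inr (1, b)) = Sum.inr (⟨2, by omega⟩, b) := fun b =>
    h.apply_pred le_rfl (by omega) b
  have e2 : ∀ b, ρ (s + 2) (Sum.inr (⟨2, by omega⟩, b)) = Sum.inr (1, b) := fun b => by
    rw [← e1 b, ← Perm.mul_apply, h.two 2 le_rfl (by omega), ← map_mul, adj_mul_self, map_one,
      Perm.one_apply]
  have e3 : ∀ b, ρ (s + 1) (Sum.inr (⟨2, by omega⟩, b)) = Sum.inr (⟨2, by omega⟩, !b) := fun b =>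
    h.apply_one_far (x := (⟨2, by omega⟩, b)) le_rfl
  have l1 := hl.map m2
  rw [e0, e1] at l1
  have l2 := l1.map m1
  rw [h.apply_zero, e3] at l2
  have l3 := l2.map m2
  rw [e1, e2] at l3
  have l4 := l3.map m1
  rw [e3, h.apply_one] at l4
  simp only [Bool.not_false, Bool.not_true] at l2 l3 l4
  obtain ⟨⟨c, hc⟩, b⟩ := x
  obtain rfl | rfl : c = 0 ∨ c = 1 := by simp at hx; omega
  · cases b
    · exact Or.inl rfl
    · exact (hl.trans l2).trans l4
  · cases b
    · exact l1.trans l3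
    · exact hl

theorem not_commute {i : ℕ} (hi : 2 ≤ i) (hm : i + 1 < m + 3) :
    ¬ Commute (ρ (s + (i + 1))) (ρ (s + i)) := by
  rw [h.two i hi (by omega), h.two (i + 1) (by omega) hm]
  intro hc
  refine adj_not_commute (M := m + 3) (i := i) (by omega) hm ?_
  refine Equiv.ext fun x => ?_
  have := congrArg (fun f => f (Sum.inr (x, false))) hc.eq
  simpa using this

theorem inter_mid {i : ℕ} (hi : i < s) (Q : Set P) (hz : ∀ p ∈ Q, z p = p)
    (hQ : ∀ k, i + 1 ≤ k → k ≤ s → ∀ p ∈ Q, ∃ p' ∈ Q, ρ k (Sum.inl p) = Sum.inl p')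
    (h0 : ρ s (Sum.inr (0, true)) = Sum.inr (0, true))
    (hP : ∀ p ∉ Q, Linked (itv ρ (i + 1) (s + 2)) (Sum.inr (0, false)) (Sum.inl p))
    (hl : Linked (itv ρ (i + 1) (s + 2)) (Sum.inr (0, false)) (Sum.inr (1, true))) :
    itv ρ i (s + 2) ⊓ itv ρ (i + 1) (s + 2 + 1) ≤ itv ρ (i + 1) (s + 2) := by
  have hz' : ∀ p ∈ Q, ρ (s + 1) (Sum.inl p) = Sum.inl p := fun p hp => by
    rw [h.apply_one_inl, hz p hp]
  have hS : ∀ x : Fin (m + 3) × Bool, x ≠ (0, false) → x ≠ (1, true) → ∀ k ≤ s,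
      ρ k (Sum.inr x) = Sum.inr x := fun x hx hx' k hk => by
    rcases hk.lt_or_eq with hk | rfl
    · exact h.low k hk x
    · rcases cases_col x with hx2 | rfl | rfl | rfl | rfl
      · exact h.head x (by omega)
      · exact absurd rfl hx
      · exact h0
      · exact h.head _ (by simp)
      · exact absurd rfl hx'
  refine inter_of_actsBy (a := s + 1) (b := s + 2) (a' := i + 1) (b' := s + 1)
    (S := {y | ∃ x, x ≠ (0, false) ∧ x ≠ (1, true) ∧ y = Sum.inr x})
    (S' := {y | ∃ p ∈ Q, y = Sum.inl p})
    (fun k _ hk => h.sign_eq (by omega)) ⟨?_, ?_⟩ ⟨?_, ?_⟩ (by omega) (by omega) (by omega)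
    (by omega) ?_ ?_ (x₀ := Sum.inr (0, false)) ?_
  · rintro k h1 h2 _ ⟨x, hx, hx', rfl⟩
    obtain rfl : k = s + 1 := by omega
    rcases cases_col x with hx2 | rfl | rfl | rfl | rfl
    · refine ⟨(x.1, !x.2), ?_, ?_, h.apply_one_far hx2⟩ <;>
      · rintro e
        rw [Prod.mk.injEq] at e
        rw [e.1] at hx2
        simp at hx2
    · exact absurd rfl hx
    · exact ⟨_, by simp, by simp, h.apply_zero _⟩
    · exact ⟨_, by simp, by simp, h.apply_one _⟩
    · exact absurd rfl hx'
  · rintro k h1 h2 h3 _ ⟨x, hx, hx', rfl⟩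
    exact hS x hx hx' k (by omega)
  · rintro k h1 h2 _ ⟨p, hp, rfl⟩
    obtain ⟨p', hp', e⟩ := hQ k h1 (by omega) p hp
    exact ⟨p', hp', e⟩
  · rintro k h1 h2 h3 _ ⟨p, hp, rfl⟩
    obtain rfl | rfl : k = s + 1 ∨ k = s + 2 := by omega
    · exact hz' p hp
    · exact h.apply_inl le_rfl (by omega) p
  · rintro k h1 h2 _ ⟨p, hp, rfl⟩
    obtain rfl : k = s + 1 := by omega
    exact hz' p hp
  · rintro k h1 h2 _ ⟨x, hx, hx', rfl⟩
    exact hS x hx hx' k (by omega)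
  · rintro (p | x) h1 h2
    · exact hP p fun hp => h2 ⟨p, hp, rfl⟩
    · by_cases hx : x = (0, false)
      · exact Or.inl (by rw [hx])
      · obtain rfl : x = (1, true) := by_contra fun e => h1 ⟨x, hx, e, rfl⟩
        exact hl

/-- The intersection conditions whose groups involve at least two columns. -/
theorem inter_cols {i d : ℕ} (hi : i < s) (hd : 2 ≤ d) (hdm : d < m + 3) (Q : Set P)
    (hz : ∀ p ∈ Q, z p = p)
    (hQ : ∀ k, i + 1 ≤ k → k ≤ s → ∀ p ∈ Q, ∃ p' ∈ Q, ρ k (Sum.inl p) = Sum.inl p')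
    (h0 : ρ s (Sum.inr (0, true)) = Sum.inr (0, true))
    (hP : ∀ p ∉ Q, Linked (itv ρ (i + 1) (s + 2)) (Sum.inr (0, false)) (Sum.inl p))
    (hl : Linked (itv ρ (i + 1) (s + 2)) (Sum.inr (0, false)) (Sum.inr (1, true))) :
    itv ρ i (s + d) ⊓ itv ρ (i + 1) (s + d + 1) ≤ itv ρ (i + 1) (s + d) := by
  rcases hd.eq_or_lt with rfl | hd
  · exact h.inter_mid hi Q hz hQ h0 hP hl
  · have hle : itv ρ (i + 1) (s + 2) ≤ itv ρ (i + 1) (s + 3) := itv_mono le_rfl (by omega)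
    exact h.inter_far hi hd hdm Q hz hQ (fun p hp => (hP p hp).mono hle)
      (h.linked_cols (by omega) (hl.mono hle))

theorem isStringC_stringCGen (hC : IsStringC ρ (s + (m + 3)))
    (hA : itv ρ 0 (s + (m + 3)) = alternatingGroup (P ⊕ Fin (m + 3) × Bool)) :
    StringCGen (alternatingGroup (P ⊕ Fin (m + 3) × Bool)) (s + (m + 3)) ∧
      (3 ≤ m → StringCGen (alternatingGroup (P ⊕ Fin (m + 3) × Bool)) (s + (m + 2))) := by
  refine ⟨⟨ρ, hC, hA⟩, fun hm => ?_⟩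
  obtain ⟨e, rfl⟩ : ∃ e, m = e + 3 := ⟨m - 3, by omega⟩
  have h1 := h.not_commute (i := e + 4) (by omega) (by omega)
  have h2 := h.not_commute (i := e + 3) (by omega) (by omega)
  rw [← hA]
  refine (show IsStringC ρ (s + (e + 2) + 4) from hC).tailRed (k := 1) h1 h2 ?_
  rw [show s + (e + 2) + 1 = s + (e + 3) by omega, h.two (e + 3) (by omega) (by omega),
    h.two (e + 2) (by omega) (by omega), ← map_mul, ← map_pow]
  have := adj_braid (M := e + 3 + 3) (i := e + 2) (by omega) (by omega)
  have e2 : (adj (e + 3 + 3) (e + 3) * adj (e + 3 + 3) (e + 2)) =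
      (adj (e + 3 + 3) (e + 2) * adj (e + 3 + 3) (e + 2 + 1))⁻¹ := by
    rw [mul_inv_rev, inv_eq_of_mul_eq_one_left (adj_mul_self ..),
      inv_eq_of_mul_eq_one_left (adj_mul_self ..)]
  rw [e2, inv_pow, this, inv_one, map_one]

theorem stringCGen (hC : IsStringC ρ (s + (m + 3)))
    (hP : ∀ p, Linked (itv ρ 0 (s + (m + 3))) (Sum.inr (0, false)) (Sum.inl p))
    (hl : ∀ x : Fin (m + 3) × Bool, (x.1 : ℕ) < 2 →
      Linked (itv ρ 0 (s + 3)) (Sum.inr (0, false)) (Sum.inr x)) :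
    StringCGen (alternatingGroup (P ⊕ Fin (m + 3) × Bool)) (s + (m + 3)) ∧
      (3 ≤ m → StringCGen (alternatingGroup (P ⊕ Fin (m + 3) × Bool)) (s + (m + 2))) := by
  refine h.isStringC_stringCGen hC (eq_alternatingGroup (x₀ := Sum.inr (0, false)) ?_
    (itv_le fun k _ hk => h.sign_eq hk))
  rintro (p | x)
  · exact hP p
  · exact h.linked_near (by omega) (by omega) hl x x.1.2

end Tail

end Tail

section Handle

variable {k m : ℕ} [NeZero k] {z : Perm (Fin k)}

/-- Generators on two rows of columns and a path attached to the first point of one row. -/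
def handleGen (k m : ℕ) [NeZero k] (z : Perm (Fin k)) : ℕ → Perm (Fin k ⊕ Fin (m + 3) × Bool)
  | 0 => Perm.sumCongr (zigzag k 0) 1
  | 1 => attach k 1 (0, false)
  | 2 => outHom (Fin k) (m + 3) (adj (m + 3) 1) * Perm.sumCongr z (rowFlip (m + 3))
  | i + 3 => outHom (Fin k) (m + 3) (adj (m + 3) (i + 2))

theorem handleGen_zero_inl (i : Fin k) :
    handleGen k m z 0 (Sum.inl i) = Sum.inl (zigzag k 0 i) := rfl

theorem handleGen_one_zero : handleGen k m z 1 (Sum.inl 0) = Sum.inr (0, false) := attach_zero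

theorem handleGen_one_base : handleGen k m z 1 (Sum.inr (0, false)) = Sum.inl 0 :=
  attach_base rfl

theorem handleGen_one_inl {i : Fin k} (hi : i ≠ 0) :
    handleGen k m z 1 (Sum.inl i) = Sum.inl (zigzag k 1 i) := attach_inl hi

theorem handleGen_one_inr {x : Fin (m + 3) × Bool} (hx : x ≠ (0, false)) :
    handleGen k m z 1 (Sum.inr x) = Sum.inr x := attach_inr rfl hx

theorem zigzag_one_ne_zero {i : Fin k} (hi : i ≠ 0) : zigzag k 1 i ≠ 0 := fun e =>
  hi (by rw [← zigzag_zigzag (p := 1) i, e, zigzag_one_zero])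

theorem tail_handleGen (h2 : 2 ≤ k) (hk : Even (k / 2)) (hk' : Odd ((k - 1) / 2)) (hz : z * z = 1)
    (sz : sign z = (-1) ^ (m + 3)) (hc : Commute (zigzag k 0) z) :
    Tail m 1 z (handleGen k m z) where
  sq_z := hz
  sign_z := sz
  one := rfl
  two i h2 _ := by
    obtain ⟨i, rfl⟩ := Nat.exists_eq_add_of_le' h2
    rw [add_comm 1]
    rfl
  low i hi x := by
    obtain rfl : i = 0 := by omega
    rfl
  head x hx := handleGen_one_inr fun e => hx (by rw [e]; rfl)
  sq i hi := by
    obtain rfl | rfl : i = 0 ∨ i = 1 := by omega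
    · ext1 x
      rcases x with x | x
      · simp [handleGen_zero_inl, zigzag_zigzag]
      · rfl
    · ext1 x
      rcases x with x | x
      · by_cases hx : x = 0
        · subst hx
          simp [handleGen_one_zero, handleGen_one_base]
        · simp [handleGen_one_inl hx, handleGen_one_inl (zigzag_one_ne_zero hx), zigzag_zigzag]
      · by_cases hx : x = (0, false)
        · subst hx
          simp [handleGen_one_zero, handleGen_one_base]
        · simp [handleGen_one_inr hx]
  ne_one i hi := by
    obtain rfl | rfl : i = 0 ∨ i = 1 := by omega
    · intro e
      have := congrArg (fun f => f (Sum.inl 0)) e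
      simp only [handleGen_zero_inl, Perm.one_apply, Sum.inl.injEq] at this
      rw [zigzag_apply_up (by simp) (by simp; omega)] at this
      simpa using congrArg Fin.val this
    · intro e
      have := congrArg (fun f => f (Sum.inl 0)) e
      simp [handleGen_one_zero] at this
  even i hi := by
    obtain rfl | rfl : i = 0 ∨ i = 1 := by omega
    · rw [handleGen, Perm.sign_sumCongr, sign_zigzag_zero, Perm.sign_one, hk.neg_one_pow, one_mul]
    · rw [handleGen, attach, Perm.sign_mul, sign_swap (by simp), Perm.sign_sumCongr,
        sign_zigzag_one, Perm.sign_one, hk'.neg_one_pow]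
      rfl
  comm i j hij hj := by
    obtain ⟨rfl, rfl⟩ : i = 0 ∧ j = 2 := by omega
    have e : ∀ x, zigzag k 0 (z x) = z (zigzag k 0 x) := fun x =>
      congrArg (fun f => f x) hc.eq
    refine Equiv.ext fun x => ?_
    rcases x with x | x
    · simp [handleGen, e]
    · simp [handleGen]
  sep := by
    have h01 : adj (m + 3) 1 0 = 1 := by
      rw [adj_eq (by omega) (by omega)]; exact swap_apply_left _ _
    have h10 : adj (m + 3) 1 1 = 0 := by
      rw [adj_eq (by omega) (by omega)]; exact swap_apply_right _ _
    refine ⟨{Sum.inr (0, true), Sum.inr (1, false)}, true, ?_, ?_, by simp, by simp, by simp⟩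
    · rintro _ (rfl | rfl)
      · rw [handleGen_one_inr (by simp)]; simp
      · rw [handleGen_one_inr (by simp)]; simp
    · rintro _ (rfl | rfl)
      · simp [handleGen, h01]
      · simp [handleGen, h10]

theorem handleGen_linked (h : Tail m 1 z (handleGen k m z))
    (h01 : Linked (itv (handleGen k m z) 1 4) (Sum.inr (0, false)) (Sum.inr (1, true)))
    (hC : IsStringC (handleGen k m z) (1 + (m + 3))) :
    StringCGen (alternatingGroup (Fin k ⊕ Fin (m + 3) × Bool)) (1 + (m + 3)) ∧
      (3 ≤ m → StringCGen (alternatingGroup (Fin k ⊕ Fin (m + 3) × Bool)) (1 + (m + 2))) := by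
  have hl := h.linked_cols (i := 0) (by omega) (h01.mono (itv_mono (by omega) le_rfl))
  have hl' := h.linked_near (i := 0) (d := m + 3) (by omega) (by omega) hl
  refine h.stringCGen hC (fun p => ?_) hl
  have m1 : handleGen k m z 1 ∈ itv (handleGen k m z) 0 (1 + (m + 3)) := mem_itv (by omega) (by omega)
  have m0 : handleGen k m z 0 ∈ itv (handleGen k m z) 0 (1 + (m + 3)) := mem_itv (by omega) (by omega)
  have h0 := (hl' (1, true) (Fin.is_lt _)).map m1
  rw [handleGen_one_base, handleGen_one_inr (by simp)] at h0
  refine (hl' (1, true) (Fin.is_lt _)).trans (h0.symm.trans (linked_handle (u₀ := 1) (c₀ := 1)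
    rfl m1 m0 (fun x => ?_) (Sum.inl p)))
  exact (h0.trans (hl' (1, true) (Fin.is_lt _)).symm).trans (hl' x (Fin.is_lt _))

end Handle

section HandleEven

variable {k m : ℕ} [NeZero k]

theorem exists_handle_even (hk : k % 4 = 0) (hm : Odd m) :
    StringCGen (alternatingGroup (Fin k ⊕ Fin (m + 3) × Bool)) (m + 4) ∧
      (3 ≤ m → StringCGen (alternatingGroup (Fin k ⊕ Fin (m + 3) × Bool)) (m + 3)) := by
  have hk0 := NeZero.pos k
  have h : Tail m 1 1 (handleGen k m 1) := tail_handleGen (by omega) (by rw [Nat.even_iff]; omega)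
    (by rw [Nat.odd_iff]; omega) (one_mul 1)
    (by rw [Perm.sign_one, (hm.add_odd (by decide : Odd 3)).neg_one_pow]) (Commute.one_right _)
  set ρ := handleGen k m 1 with hρ
  have f0 : ∀ x : Fin (m + 3) × Bool, 2 ≤ (x.1 : ℕ) → ∀ y, (y.1 : ℕ) < 2 → x ≠ y :=
    fun x hx y hy e => by rw [e] at hx; omega
  have f1 : ∀ x : Fin (m + 3) × Bool, 2 ≤ (x.1 : ℕ) → ρ 1 (Sum.inr x) = Sum.inr x := fun x hx =>
    handleGen_one_inr (f0 x hx _ (by simp))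
  have f2 : ∀ x : Fin (m + 3) × Bool, 2 ≤ (x.1 : ℕ) → ρ 2 (Sum.inr x) = Sum.inr (x.1, !x.2) :=
    fun x hx => h.apply_one_far hx
  have e2 : ∀ i, ρ 2 (Sum.inl i) = Sum.inl i := fun i => rfl
  have e1 : ∀ i ≠ 0, ρ 1 (Sum.inl i) = Sum.inl (zigzag k 1 i) := fun i hi => handleGen_one_inl hi
  have a2 : ∀ b, ρ 2 (Sum.inr (0, b)) = Sum.inr (1, !b) := h.apply_zero
  have b2 : ∀ b, ρ 2 (Sum.inr (1, b)) = Sum.inr (0, !b) := h.apply_one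
  have a1 : ρ 1 (Sum.inr (0, false)) = Sum.inl 0 := handleGen_one_base
  have z1 : ρ 1 (Sum.inl 0) = Sum.inr (0, false) := handleGen_one_zero
  have c1 : ∀ x ≠ (0, false), ρ 1 (Sum.inr x) = Sum.inr x := fun x hx => handleGen_one_inr hx
  have hz1 : ∀ i ≠ 0, zigzag k 1 i ≠ 0 := fun i hi => zigzag_one_ne_zero hi
  have hcyc : ρ 1 * ρ 2 * (ρ 1 * ρ 2) =
      cyc (Sum.inl 0) (Sum.inr (1, true)) (Sum.inr (0, false)) := by
    refine Equiv.ext fun x => ?_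
    simp only [Perm.mul_apply]
    rcases x with i | x
    · by_cases hi : i = 0
      · subst hi
        rw [cyc_apply_left (by simp) (by simp), e2, z1, a2, c1 _ (by simp)]; rfl
      · rw [cyc_apply_of_ne (by simpa using hi) (by simp) (by simp), e2, e1 i hi, e2,
          e1 _ (hz1 i hi), zigzag_zigzag]
    · rcases cases_col x with hx | rfl | rfl | rfl | rfl
      · rw [cyc_apply_of_ne (by simp) (by simpa using f0 x hx (1, true) (by simp))
          (by simpa using f0 x hx (0, false) (by simp)), f2 x hx,
          f1 (x.1, !x.2) hx, f2 (x.1, !x.2) hx, Bool.not_not, f1 (x.1, x.2) hx]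
      · rw [cyc_apply_right, a2, c1 _ (by simp), b2]
        exact a1
      · rw [cyc_apply_of_ne (by simp) (by simp) (by simp), a2, c1 _ (by simp), b2]
        exact c1 _ (by simp)
      · rw [cyc_apply_of_ne (by simp) (by simp) (by simp), b2, c1 _ (by simp), a2]
        exact c1 _ (by simp)
      · rw [cyc_apply_mid (by simp) (by simp), b2]
        exact (congrArg (fun y => ρ 1 (ρ 2 y)) a1).trans ((congrArg (ρ 1) (e2 0)).trans z1)
  have m1 : ρ 1 ∈ itv ρ 1 3 := mem_itv le_rfl (by omega)
  have m2 : ρ 2 ∈ itv ρ 1 3 := mem_itv (by omega) (by omega)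
  have mc : cyc (Sum.inl 0) (Sum.inr (1, true)) (Sum.inr (0, false)) ∈ itv ρ 1 3 :=
    hcyc ▸ Subgroup.mul_mem _ (Subgroup.mul_mem _ m1 m2) (Subgroup.mul_mem _ m1 m2)
  have l01 : Linked (itv ρ 1 3) (Sum.inr (0, false)) (Sum.inr (1, true)) :=
    (Linked.of_cyc' (by simp) (by simp) (by simp) mc).symm
  have l0e : Linked (itv ρ 1 3) (Sum.inr (0, false)) (Sum.inl 0) :=
    l01.trans (Linked.of_cyc (by simp) (by simp) (by simp) mc).symm
  have h34 : itv ρ 1 3 ≤ itv ρ 1 4 := itv_mono le_rfl (by omega)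
  rw [show m + 4 = 1 + (m + 3) by omega, show StringCGen (alternatingGroup (Fin k ⊕ Fin (m + 3) × Bool))
    (m + 3) = StringCGen _ (1 + (m + 2)) by rw [show 1 + (m + 2) = m + 3 by omega]]
  refine handleGen_linked h (l01.mono h34) (h.isStringC fun i hi j hij hj => ?_)
  obtain rfl : i = 0 := by omega
  obtain rfl | rfl | hj3 : j = 1 ∨ j = 2 ∨ 3 ≤ j := by omega
  · refine inter_pair (h.sq 0 (by omega)) (h.sq 1 (by omega)) fun e => ?_
    have := congrArg (fun f => f (Sum.inl 0)) e
    simp [hρ, handleGen_zero_inl, handleGen_one_zero] at this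
  · refine inter_of_fix (a := 1) (b := 1) (a' := 1) (b' := 2)
      (S := {y | ∃ x, x ≠ (0, false) ∧ y = Sum.inr x})
      (S' := {y | ∃ i : Fin k, i ≠ 0 ∧ y = Sum.inl i}) ⟨fun n h1 h2 => by omega, ?_⟩ ⟨?_, ?_⟩ le_rfl
      (by omega) le_rfl le_rfl (fun n h1 h2 => by omega) ?_ fun g hg hS hS' => ?_
    · rintro n h1 h2 - _ ⟨x, hx, rfl⟩
      obtain rfl | rfl : n = 0 ∨ n = 1 := by omega
      · rfl
      · exact c1 x hx
    · rintro n h1 h2 _ ⟨i, hi, rfl⟩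
      obtain rfl : n = 1 := by omega
      exact ⟨_, hz1 i hi, e1 i hi⟩
    · rintro n h1 h2 h3 _ ⟨i, hi, rfl⟩
      obtain rfl : n = 2 := by omega
      rfl
    · rintro n h1 h2 _ ⟨x, hx, rfl⟩
      obtain rfl : n = 1 := by omega
      exact c1 x hx
    · rw [eq_one_of_sign (sign_itv (fun n _ hn => h.even n (by omega)) hg)
        (x := Sum.inl 0) (y := Sum.inr (0, false))]
      · exact one_mem _
      · rintro (i | x) hi hx
        · exact hS' _ ⟨i, fun e => hi (by rw [e]), rfl⟩
        · exact hS _ ⟨x, fun e => hx (by rw [e]), rfl⟩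
  · obtain ⟨d, rfl⟩ : ∃ d, j = 1 + d := ⟨j - 1, by omega⟩
    refine h.inter_cols (by omega) (by omega) (by omega) {i | i ≠ 0} (fun _ _ => rfl) ?_
      (c1 _ (by simp)) ?_ l01
    · rintro n h1 h2 i hi
      obtain rfl : n = 1 := by omega
      exact ⟨_, hz1 i hi, e1 i hi⟩
    · intro i hi
      obtain rfl : i = 0 := by_contra hi
      exact l0e

end HandleEven

/-- The permutations preserving a ternary relation. -/
def relStab {β : Type*} (T : β → β → β → Prop) : Subgroup (Perm β) where
  carrier := {d | ∀ a b c, T (d a) (d b) (d c) ↔ T a b c}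
  mul_mem' {d e} hd he a b c := (hd _ _ _).trans (he a b c)
  one_mem' _ _ _ := Iff.rfl
  inv_mem' {d} hd a b c := by
    have := hd (d.symm a) (d.symm b) (d.symm c)
    simp only [d.apply_symm_apply] at this
    exact this.symm

/-- Generators of the projective action of degree six of `A₅`. -/
def hexGen : ℕ → Perm (Fin 6)
  | 0 => swap 0 1 * swap 2 3
  | 1 => swap 1 2 * swap 3 4
  | _ => swap 2 3 * swap 4 5

/-- One of the two orbits of triples of this action. -/
def hexRel (a b c : Fin 6) : Prop :=
  2 ^ (a : ℕ) + 2 ^ (b : ℕ) + 2 ^ (c : ℕ) ∈ [7, 11, 21, 41, 49, 38, 26, 50, 28, 44]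

instance (a b c : Fin 6) : Decidable (hexRel a b c) := by unfold hexRel; infer_instance

set_option maxRecDepth 100000 in
theorem hex_fix : ∀ d : Perm (Fin 6), d 0 = 0 → (∀ a b c, hexRel (d a) (d b) (d c) ↔ hexRel a b c) →
    ∃ (n : Fin 5) (e : Fin 2), d = (hexGen 1 * hexGen 2) ^ (n : ℕ) * hexGen 1 ^ (e : ℕ) := by
  decide +kernel

set_option maxRecDepth 100000 in
theorem hexGen_mem : itv hexGen 0 3 ≤ relStab hexRel := itv_le fun k _ hk =>
  (by decide +kernel : ∀ k : Fin 3, ∀ a b c,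
    hexRel (hexGen k a) (hexGen k b) (hexGen k c) ↔ hexRel a b c) ⟨k, hk⟩

theorem hexGen_inter {d : Perm (Fin 6)} (hd : d ∈ itv hexGen 0 3) (h0 : d 0 = 0) :
    d ∈ itv hexGen 1 3 := by
  obtain ⟨n, e, rfl⟩ := hex_fix d h0 (hexGen_mem hd)
  have m1 : hexGen 1 ∈ itv hexGen 1 3 := mem_itv le_rfl (by omega)
  have m2 : hexGen 2 ∈ itv hexGen 1 3 := mem_itv (by omega) (by omega)
  exact Subgroup.mul_mem _ (Subgroup.pow_mem _ (Subgroup.mul_mem _ m1 m2) _)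
    (Subgroup.pow_mem _ m1 _)

theorem hexGen_fix {d : Perm (Fin 6)} (hd : d ∈ itv hexGen 1 3) (h5 : d 5 = 5) :
    d ∈ itv hexGen 1 2 := by
  have h0 : d 0 = 0 := fix_itv (fun k h1 h2 => by
    obtain rfl | rfl : k = 1 ∨ k = 2 := by omega
    all_goals decide) hd
  obtain ⟨n, e, rfl⟩ := hex_fix d h0 (hexGen_mem (itv_mono (by omega) le_rfl hd))
  have h : ∀ (n : Fin 5) (e : Fin 2),
      ((hexGen 1 * hexGen 2) ^ (n : ℕ) * hexGen 1 ^ (e : ℕ)) 5 = 5 → n = 0 := by decide +kernel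
  rw [h n e h5, Fin.val_zero, pow_zero, one_mul]
  exact Subgroup.pow_mem _ (mem_itv le_rfl (by omega)) _

theorem pow_apply_embed {α β : Type*} {ι : β → α} {g : Perm α} {d : Perm β}
    (h : ∀ x, g (ι x) = ι (d x)) (n : ℕ) (x : β) : (g ^ n) (ι x) = ι ((d ^ n) x) := by
  induction n generalizing x with
  | zero => rfl
  | succ n ih => rw [pow_succ, pow_succ, Perm.mul_apply, Perm.mul_apply, h, ih]

theorem pow_apply_of_agree {α : Type*} {S : Set α} {g d : Perm α}
    (h : ∀ x ∈ S, g x = d x) (hd : ∀ x ∈ S, d x ∈ S) (n : ℕ) {x : α} (hx : x ∈ S) :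
    (g ^ n) x = (d ^ n) x := by
  induction n generalizing x with
  | zero => rfl
  | succ n ih => rw [pow_succ, pow_succ, Perm.mul_apply, Perm.mul_apply, h x hx, ih (hd x hx)]

section HandleOdd

variable {m : ℕ}

/-- Six points of the path and the first two columns. -/
def hexEmb (m : ℕ) : Fin 6 → Fin 4 ⊕ Fin (m + 3) × Bool :=
  ![Sum.inl 3, Sum.inl 2, Sum.inl 1, Sum.inl 0, Sum.inr (0, false), Sum.inr (1, true)]

theorem hexEmb_injective : Function.Injective (hexEmb m) := by
  have : ∀ i j : Fin 6, i < j → hexEmb m i ≠ hexEmb m j := by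
    intro i j hij
    fin_cases i <;> fin_cases j <;> simp [hexEmb] at hij ⊢
  intro i j h
  rcases lt_trichotomy i j with hij | hij | hij
  · exact absurd h (this i j hij)
  · exact hij
  · exact absurd h.symm (this j i hij)

theorem exists_handle_odd (hm : Even m) :
    StringCGen (alternatingGroup (Fin 4 ⊕ Fin (m + 3) × Bool)) (m + 4) := by
  have h : Tail m 1 (swap (0 : Fin 4) 1) (handleGen 4 m (swap 0 1)) :=
    tail_handleGen (by omega) (by decide) (by decide) (by simp)
      (by rw [(hm.add_odd (by decide : Odd 3)).neg_one_pow]; decide)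
      (by decide +kernel : zigzag 4 0 * swap 0 1 = swap 0 1 * zigzag 4 0)
  set ρ := handleGen 4 m (swap 0 1) with hρ
  have f0 : ∀ x : Fin (m + 3) × Bool, 2 ≤ (x.1 : ℕ) → ∀ y, (y.1 : ℕ) < 2 → x ≠ y :=
    fun x hx y hy e => by rw [e] at hx; omega
  have f2 : ∀ x : Fin (m + 3) × Bool, 2 ≤ (x.1 : ℕ) → ρ 2 (Sum.inr x) = Sum.inr (x.1, !x.2) :=
    fun x hx => h.apply_one_far hx
  have e2 : ∀ i, ρ 2 (Sum.inl i) = Sum.inl (swap 0 1 i) := fun i => rfl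
  have e1 : ∀ i ≠ 0, ρ 1 (Sum.inl i) = Sum.inl (zigzag 4 1 i) := fun i hi => handleGen_one_inl hi
  have a2 : ∀ b, ρ 2 (Sum.inr (0, b)) = Sum.inr (1, !b) := h.apply_zero
  have b2 : ∀ b, ρ 2 (Sum.inr (1, b)) = Sum.inr (0, !b) := h.apply_one
  have a1 : ρ 1 (Sum.inr (0, false)) = Sum.inl 0 := handleGen_one_base
  have z1 : ρ 1 (Sum.inl 0) = Sum.inr (0, false) := handleGen_one_zero
  have c1 : ∀ x ≠ (0, false), ρ 1 (Sum.inr x) = Sum.inr x := fun x hx => handleGen_one_inr hx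
  have hι : ∀ k, 0 ≤ k → k < 3 → ∀ x, ρ k (hexEmb m x) = hexEmb m (hexGen k x) := by
    have z0 : ∀ i, zigzag 4 0 i = (swap 0 1 * swap 2 3 : Perm (Fin 4)) i := by decide +kernel
    have z1' : ∀ i, i ≠ 0 → zigzag 4 1 i = (swap 1 2 : Perm (Fin 4)) i := by
      decide +kernel
    intro k _ hk x
    obtain rfl | rfl | rfl : k = 0 ∨ k = 1 ∨ k = 2 := by omega
    · fin_cases x
      · exact congrArg Sum.inl (z0 3)
      · exact congrArg Sum.inl (z0 2)
      · exact congrArg Sum.inl (z0 1)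
      · exact congrArg Sum.inl (z0 0)
      · rfl
      · rfl
    · fin_cases x
      · exact (e1 3 (by decide)).trans (congrArg Sum.inl (z1' 3 (by decide)))
      · exact (e1 2 (by decide)).trans (congrArg Sum.inl (z1' 2 (by decide)))
      · exact (e1 1 (by decide)).trans (congrArg Sum.inl (z1' 1 (by decide)))
      · exact z1
      · exact a1
      · exact c1 _ (by simp)
    · fin_cases x
      · rfl
      · rfl
      · rfl
      · rfl
      · exact a2 false
      · exact b2 true
  let S : Set (Fin 4 ⊕ Fin (m + 3) × Bool) :=
    {y | ∃ x, x ≠ (0, false) ∧ x ≠ (1, true) ∧ y = Sum.inr x}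
  have hcov : ∀ y, y ∈ S ∨ ∃ i, y = hexEmb m i := by
    rintro (i | x)
    · right
      fin_cases i
      exacts [⟨3, rfl⟩, ⟨2, rfl⟩, ⟨1, rfl⟩, ⟨0, rfl⟩]
    · by_cases h0 : x = (0, false)
      · exact Or.inr ⟨4, by rw [h0]; rfl⟩
      · by_cases h1 : x = (1, true)
        · exact Or.inr ⟨5, by rw [h1]; rfl⟩
        · exact Or.inl ⟨x, h0, h1, rfl⟩
  have hS1 : ∀ k < 2, ∀ y ∈ S, ρ k y = y := by
    rintro k hk _ ⟨x, hx, -, rfl⟩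
    obtain rfl | rfl : k = 0 ∨ k = 1 := by omega
    · rfl
    · exact c1 x hx
  have hS2 : ∀ y ∈ S, ρ 2 y ∈ S := by
    rintro _ ⟨x, hx, hx', rfl⟩
    rcases cases_col x with hx2 | rfl | rfl | rfl | rfl
    · exact ⟨_, f0 (x.1, !x.2) hx2 _ (by simp), f0 (x.1, !x.2) hx2 _ (by simp), f2 x hx2⟩
    · exact absurd rfl hx
    · exact ⟨_, by simp, by simp, a2 _⟩
    · exact ⟨_, by simp, by simp, b2 _⟩
    · exact absurd rfl hx'
  have sq2 : ρ 2 * ρ 2 = 1 := h.isStringC_shift.sq 1 (by omega)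
  have m1 : ρ 1 ∈ itv ρ 1 3 := mem_itv le_rfl (by omega)
  have m2 : ρ 2 ∈ itv ρ 1 3 := mem_itv (by omega) (by omega)
  obtain ⟨t, ht, htι, htS⟩ : ∃ t ∈ itv ρ 1 3, (∀ x, t (hexEmb m x) = hexEmb m x) ∧
      ∀ y ∈ S, t y = ρ 2 y := by
    refine ⟨(ρ 1 * ρ 2) ^ 5, Subgroup.pow_mem _ (Subgroup.mul_mem _ m1 m2) _, fun x => ?_,
      fun y hy => ?_⟩
    · rw [pow_apply_embed (d := hexGen 1 * hexGen 2) (fun x => by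
        rw [Perm.mul_apply, hι 2 (by omega) (by omega), hι 1 (by omega) (by omega)]; rfl),
        show (hexGen 1 * hexGen 2) ^ 5 = 1 by decide +kernel]
      rfl
    · rw [pow_apply_of_agree (d := ρ 2) (S := S) (fun y hy => by
        rw [Perm.mul_apply, hS1 1 (by omega) _ (hS2 y hy)]) hS2 5 hy,
        show (5 : ℕ) = 2 * 2 + 1 from rfl, pow_succ, pow_mul]
      simp [pow_two, sq2]
  have c3 : ∀ b, ρ 3 (Sum.inr (0, b)) = Sum.inr (0, b) := fun b =>
    h.apply_near le_rfl (by omega) (by simp)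
  have d3 : ∀ b, ρ 3 (Sum.inr (1, b)) = Sum.inr (⟨2, by omega⟩, b) := fun b =>
    h.apply_pred le_rfl (by omega) b
  have sq3 : ρ 3 * ρ 3 = 1 := h.isStringC_shift.sq 2 (by omega)
  have d3' : ∀ b, ρ 3 (Sum.inr (⟨2, by omega⟩, b)) = Sum.inr (1, b) := fun b => by
    rw [← d3 b, ← Perm.mul_apply, sq3, Perm.one_apply]
  have i3 : ∀ i, ρ 3 (Sum.inl i) = Sum.inl i := fun i => rfl
  have g3 : ∀ x : Fin (m + 3) × Bool, 2 ≤ (x.1 : ℕ) → ∀ (hx : (x.1 : ℕ) ≠ 2),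
      ρ 3 (Sum.inr x) = Sum.inr x := fun x hx hx' =>
    h.two 2 le_rfl (by omega) ▸ by
      rw [outHom_inr, adj_apply_of_ne (x := x.1) (by omega) (by omega)]
  have hwS : ∀ y ∈ S, (ρ 2 * t) y = y := fun y hy => by
    rw [Perm.mul_apply, htS y hy, ← Perm.mul_apply, sq2, Perm.one_apply]
  have hwι : ∀ x, (ρ 2 * t) (hexEmb m x) = hexEmb m (hexGen 2 x) := fun x => by
    rw [Perm.mul_apply, htι, hι 2 (by omega) (by omega)]
  have w0 : (ρ 2 * t) (Sum.inr (0, false)) = Sum.inr (1, true) := hwι 4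
  have w1 : (ρ 2 * t) (Sum.inr (1, true)) = Sum.inr (0, false) := hwι 5
  have memS : ∀ x, x ≠ (0, false) → x ≠ (1, true) → Sum.inr x ∈ S := fun x h0 h1 => ⟨x, h0, h1, rfl⟩
  let c : Fin (m + 3) := ⟨2, by omega⟩
  have hc0 : ∀ b b', (c, b) ≠ (0, b') := fun b b' => f0 (c, b) le_rfl (0, b') (by simp)
  have hc1 : ∀ b b', (c, b) ≠ (1, b') := fun b b' => f0 (c, b) le_rfl (1, b') (by simp)
  have n0 : ∀ b b', (Sum.inr (0, b') : Fin 4 ⊕ Fin (m + 3) × Bool) ≠ Sum.inr (c, b) :=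
    fun b b' e => hc0 b b' (Sum.inr.inj e).symm
  have n1 : ∀ b b', (Sum.inr (1, b') : Fin 4 ⊕ Fin (m + 3) × Bool) ≠ Sum.inr (c, b) :=
    fun b b' e => hc1 b b' (Sum.inr.inj e).symm
  have hcyc : ρ 2 * t * ρ 3 * (ρ 2 * t * ρ 3) =
      cyc (Sum.inr (1, true)) (Sum.inr (0, false)) (Sum.inr (c, true)) := by
    refine Equiv.ext fun x => ?_
    simp only [Perm.mul_apply _ (ρ 3), Perm.mul_apply (ρ 2 * t * ρ 3)]
    rcases x with i | x
    · rw [cyc_apply_of_ne (by simp) (by simp) (by simp), i3]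
      fin_cases i
      · exact (congrArg (fun y => (ρ 2 * t) (ρ 3 y)) (hwι 3)).trans (hwι 2)
      · exact (congrArg (fun y => (ρ 2 * t) (ρ 3 y)) (hwι 2)).trans (hwι 3)
      · exact (congrArg (fun y => (ρ 2 * t) (ρ 3 y)) (hwι 1)).trans (hwι 1)
      · exact (congrArg (fun y => (ρ 2 * t) (ρ 3 y)) (hwι 0)).trans (hwι 0)
    · by_cases hx : x.1 = c
      · obtain ⟨x1, b⟩ := x
        obtain rfl : x1 = c := hx
        rw [d3']
        cases b
        · rw [hwS _ (memS _ (by simp) (by simp)), d3, hwS _ (memS _ (hc0 _ _) (hc1 _ _)),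
            cyc_apply_of_ne (n1 _ _).symm (n0 _ _).symm (by simp)]
        · rw [w1, c3, w0, cyc_apply_right]
      · rcases cases_col x with hx2 | rfl | rfl | rfl | rfl
        · have h2 : (x.1 : ℕ) ≠ 2 := fun e => hx (Fin.ext e)
          have hx0 := fun b => f0 x hx2 (0, b) (by simp)
          have hx1 := fun b => f0 x hx2 (1, b) (by simp)
          rw [g3 x hx2 h2, hwS _ (memS _ (hx0 _) (hx1 _)), g3 x hx2 h2,
            hwS _ (memS _ (hx0 _) (hx1 _)), cyc_apply_of_ne (by simpa using hx1 _)
              (by simpa using hx0 _) (by simpa using fun e : x = _ => hx (by rw [e]))]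
        · rw [c3, w0, d3, hwS _ (memS _ (hc0 _ _) (hc1 _ _)), cyc_apply_mid
            (n1 _ _) (n0 _ _)]
        · rw [c3, hwS _ (memS _ (by simp) (by simp)), c3, hwS _ (memS _ (by simp) (by simp)),
            cyc_apply_of_ne (by simp) (by simp) (n0 _ _)]
        · rw [d3, hwS _ (memS _ (hc0 _ _) (hc1 _ _)), d3', hwS _ (memS _ (by simp) (by simp)),
            cyc_apply_of_ne (by simp) (by simp) (n1 _ _)]
        · rw [d3, hwS _ (memS _ (hc0 _ _) (hc1 _ _)), d3', w1, cyc_apply_left (by simp)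
            (n1 _ _)]
  have h34 : itv ρ 1 3 ≤ itv ρ 1 4 := itv_mono le_rfl (by omega)
  have mw : ρ 2 * t * ρ 3 ∈ itv ρ 1 4 := Subgroup.mul_mem _
    (Subgroup.mul_mem _ (h34 m2) (h34 ht)) (mem_itv (by omega) (by omega))
  have l01 : Linked (itv ρ 1 4) (Sum.inr (0, false)) (Sum.inr (1, true)) :=
    (Linked.of_cyc (by simp) (n1 _ _) (n0 _ _)
      (hcyc ▸ Subgroup.mul_mem _ mw mw)).symm
  have le0 : Linked (itv ρ 1 4) (Sum.inl 0) (Sum.inr (1, true)) := by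
    have := l01.map (h34 m1)
    rwa [a1, c1 _ (by simp)] at this
  have le1 : Linked (itv ρ 1 4) (Sum.inl 1) (Sum.inr (0, false)) := by
    have := le0.map (h34 m2)
    rwa [e2, b2] at this
  have le2 : Linked (itv ρ 1 4) (Sum.inl 2) (Sum.inl 0) := by
    have := le1.map (h34 m1)
    rw [e1 _ (by decide), a1] at this
    exact (by decide +kernel : zigzag 4 1 1 = 2) ▸ this
  rw [show m + 4 = 1 + (m + 3) by omega]
  refine (handleGen_linked h l01 (h.isStringC fun i hi j hij hj => ?_)).1
  obtain rfl : i = 0 := by omega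
  obtain rfl | rfl | rfl | hj3 : j = 1 ∨ j = 2 ∨ j = 3 ∨ 4 ≤ j := by omega
  · refine inter_pair (h.sq 0 (by omega)) (h.sq 1 (by omega)) fun e => ?_
    have := congrArg (fun f => f (Sum.inl 0)) e
    simp [hρ, handleGen_zero_inl, handleGen_one_zero] at this
  · intro g hg
    obtain ⟨hg1, hg2⟩ := Subgroup.mem_inf.1 hg
    obtain ⟨d, hd, hgd⟩ := exists_acts (hexEmb m)
      (fun k h1 h2 => hι k (by omega) h2) hg2
    have h5 : d 5 = 5 := by
      have : g (hexEmb m 5) = hexEmb m 5 := fix_itv (fun k _ hk => by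
        obtain rfl | rfl : k = 0 ∨ k = 1 := by omega
        · rfl
        · exact c1 _ (by simp)) hg1
      rw [hgd] at this
      exact hexEmb_injective this
    obtain ⟨l, hl, hld⟩ := exists_lift (hexEmb m) (fun k h1 h2 => hι k (by omega) (by omega))
      (hexGen_fix hd h5)
    suffices g = l from this ▸ hl
    refine Equiv.ext fun y => ?_
    rcases hcov y with hy | ⟨i, rfl⟩
    · rw [fix_itv (fun k _ hk => hS1 k hk y hy) hg1, fix_itv (fun k _ hk => hS1 k hk y hy) hl]
    · rw [hgd, hld]
  · intro g hg
    obtain ⟨hg1, hg2⟩ := Subgroup.mem_inf.1 hg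
    obtain ⟨d, hd, hgd⟩ := exists_acts (hexEmb m) hι hg1
    have h0 : d 0 = 0 := by
      have : g (hexEmb m 0) = hexEmb m 0 := fix_itv (fun k h1 h2 => by
        obtain rfl | rfl | rfl : k = 1 ∨ k = 2 ∨ k = 3 := by omega
        · exact hι 1 (by omega) (by omega) 0
        · rfl
        · rfl) hg2
      rw [hgd] at this
      exact hexEmb_injective this
    obtain ⟨l, hl, hld⟩ := exists_lift (hexEmb m) (fun k h1 h2 => hι k (by omega) (by omega))
      (hexGen_inter hd h0)
    rw [← Subgroup.mul_mem_cancel_left _ (Subgroup.inv_mem _ hl)]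
    have hlow : itv ρ 1 3 ≤ itv ρ 0 3 := itv_mono (by omega) le_rfl
    have hA : ActsBy ρ 0 3 2 3 S := by
      refine ⟨fun k h1 h2 => ?_, fun k h1 h2 h3 => hS1 k (by omega)⟩
      obtain rfl : k = 2 := by omega
      exact hS2
    obtain ⟨q, hq, hgq⟩ := hA.exists_agree
      (Subgroup.mul_mem _ (Subgroup.inv_mem _ (hlow hl)) hg1)
    have hfix : ∀ x, (l⁻¹ * g) (hexEmb m x) = hexEmb m x := fun x => by
      rw [Perm.mul_apply, hgd, Perm.inv_eq_iff_eq, hld]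
    rcases (mem_itv_one sq2).1 hq with rfl | rfl
    · suffices l⁻¹ * g = 1 from this ▸ one_mem _
      refine Equiv.ext fun y => ?_
      rcases hcov y with hy | ⟨i, rfl⟩
      · exact hgq y hy
      · exact hfix i
    · suffices l⁻¹ * g = t from this ▸ ht
      refine Equiv.ext fun y => ?_
      rcases hcov y with hy | ⟨i, rfl⟩
      · rw [hgq y hy, htS y hy]
      · rw [hfix, htι]
  · obtain ⟨d, rfl⟩ : ∃ d, j = 1 + d := ⟨j - 1, by omega⟩
    refine h.inter_far (by omega) (by omega) (by omega) {3} ?_ ?_ ?_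
      (h.linked_cols (by omega) l01)
    · rintro _ rfl
      decide
    · rintro n h1 h2 _ rfl
      obtain rfl : n = 1 := by omega
      exact ⟨_, rfl, hι 1 (by omega) (by omega) 0⟩
    · intro i hi
      have : i = 0 ∨ i = 1 ∨ i = 2 := by
        revert i; decide
      rcases this with rfl | rfl | rfl
      · exact l01.trans le0.symm
      · exact le1.symm
      · exact l01.trans (le0.symm.trans le2.symm)

end HandleOdd

section Map

variable {G H : Type*} [Group G] [Group H] {r : ℕ → G} {ρ : ℕ → H} {i j : ℕ}

theorem map_mem_itv (f : G →* H) (h : ∀ k, i ≤ k → k < j → f (r k) = ρ k) {g : G}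
    (hg : g ∈ itv r i j) : f g ∈ itv ρ i j :=
  (itv_le (H := (itv ρ i j).comap f) fun k h1 h2 => by
    rw [Subgroup.mem_comap, h k h1 h2]
    exact mem_itv h1 h2) hg

theorem exists_of_mem_itv (f : G →* H) (h : ∀ k, i ≤ k → k < j → f (r k) = ρ k) {g : H}
    (hg : g ∈ itv ρ i j) : ∃ e ∈ itv r i j, f e = g :=
  (itv_le (H := (itv r i j).map f) fun k h1 h2 => ⟨r k, mem_itv h1 h2, h k h1 h2⟩) hg

end Map

section Ladder

/-- A property invariant under both zigzags holds everywhere as soon as it holds somewhere. -/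
theorem zigzag_induction {k : ℕ} {p : Fin k → Prop} (h0 : ∀ i, p i → p (zigzag k 0 i))
    (h1 : ∀ i, p i → p (zigzag k 1 i)) {i : Fin k} (hi : p i) (j : Fin k) : p j := by
  have up : ∀ c (h : c + 1 < k), p ⟨c, by omega⟩ → p ⟨c + 1, h⟩ := fun c h hp => by
    rcases Nat.mod_two_eq_zero_or_one c with e | e
    · have := h0 _ hp
      rwa [zigzag_apply_up (by simpa using e) (by simpa using h)] at this
    · have := h1 _ hp
      rwa [zigzag_apply_up (by simp; omega) (by simpa using h)] at this
  have down : ∀ c (h : c + 1 < k), p ⟨c + 1, h⟩ → p ⟨c, by omega⟩ := fun c h hp => by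
    rcases Nat.mod_two_eq_zero_or_one c with e | e
    · have := h0 _ hp
      rwa [zigzag_apply_down (by simp; omega)] at this
    · have := h1 _ hp
      rwa [zigzag_apply_down (by simp; omega)] at this
  have hk : 0 < k := i.pos
  have hz : p ⟨0, hk⟩ := by
    obtain ⟨c, hc⟩ := i
    induction c with
    | zero => exact hi
    | succ c ih => exact ih _ (down c hc hi)
  obtain ⟨c, hc⟩ := j
  induction c with
  | zero => exact hz
  | succ c ih => exact up c hc (ih _)

/-- Two rows of `l + 4` points, the first point of the second one being the first point of the
columns. -/
def ladderEmb (l m : ℕ) : Fin (l + 4) × Bool ↪ (Fin (l + 4) ⊕ Fin (l + 3)) ⊕ Fin (m + 3) × Bool where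
  toFun x := match x.2 with
    | false => Sum.inl (Sum.inl x.1)
    | true => Fin.cases (Sum.inr (0, false)) (fun j => Sum.inl (Sum.inr j)) x.1
  inj' := by
    rintro ⟨i, b⟩ ⟨j, c⟩ h
    cases b <;> cases c <;> induction i using Fin.cases <;> induction j using Fin.cases <;>
      simp_all

variable {l m : ℕ}

theorem ladderEmb_false (i : Fin (l + 4)) : ladderEmb l m (i, false) = Sum.inl (Sum.inl i) := rfl

theorem ladderEmb_zero : ladderEmb l m (0, true) = Sum.inr (0, false) := rfl

theorem ladderEmb_succ (i : Fin (l + 3)) : ladderEmb l m (i.succ, true) = Sum.inl (Sum.inr i) := rfl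

theorem ladderEmb_notMem {x : Fin (m + 3) × Bool} (hx : x ≠ (0, false)) :
    Sum.inr x ∉ Set.range (ladderEmb l m) := by
  rintro ⟨⟨i, b⟩, h⟩
  cases b
  · simp [ladderEmb_false] at h
  · induction i using Fin.cases with
    | zero => exact hx (Sum.inr_injective h).symm
    | succ i => simp [ladderEmb_succ] at h

/-- The action on the columns of the two rows. -/
def ladderCol (l : ℕ) : ℕ → Perm (Fin (l + 4))
  | 1 => zigzag (l + 4) 1
  | 2 => zigzag (l + 4) 0
  | _ => 1

/-- An exchange of the rows in two columns, followed by the actions on the columns. -/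
def ladder (l : ℕ) : ℕ → Perm (Fin (l + 4) × Bool)
  | 0 => swap (2, false) (2, true) * swap (3, false) (3, true)
  | k + 1 => colHom (l + 4) (ladderCol l (k + 1))

theorem ladder_fst (k : ℕ) (x : Fin (l + 4) × Bool) : (ladder l k x).1 = ladderCol l k x.1 := by
  rcases k with _ | k
  · change _ = x.1
    rw [ladder, Perm.mul_apply]
    have : ∀ (i : Fin (l + 4)) (y : Fin (l + 4) × Bool),
        (swap (i, false) (i, true) y).1 = y.1 := fun i y => by
      rw [swap_apply_def]
      split_ifs with h1 h2
      · rw [h1]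
      · rw [h2]
      · rfl
    rw [this, this]
  · rfl

theorem ladder_zero_of_ne {x : Fin (l + 4) × Bool} (h2 : x.1 ≠ 2) (h3 : x.1 ≠ 3) :
    ladder l 0 x = x := by
  rw [ladder, Perm.mul_apply, swap_apply_of_ne_of_ne (x := x) (fun e => h3 (by rw [e]))
    fun e => h3 (by rw [e]), swap_apply_of_ne_of_ne (fun e => h2 (by rw [e]))
    fun e => h2 (by rw [e])]

theorem val_fin_two : ((2 : Fin (l + 4)) : ℕ) = 2 :=
  Nat.mod_eq_of_lt (show 2 < l + 4 by omega)

theorem val_fin_three : ((3 : Fin (l + 4)) : ℕ) = 3 :=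
  Nat.mod_eq_of_lt (show 3 < l + 4 by omega)

theorem fin_two_ne_three : (2 : Fin (l + 4)) ≠ 3 := by
  rw [Ne, Fin.ext_iff, val_fin_two, val_fin_three]
  omega

theorem ladder_zero_two (b : Bool) : ladder l 0 (2, b) = (2, !b) := by
  rw [ladder, Perm.mul_apply, swap_apply_of_ne_of_ne (x := (2, b))
    (fun e => fin_two_ne_three (Prod.mk.inj e).1) fun e => fin_two_ne_three (Prod.mk.inj e).1]
  cases b
  · exact swap_apply_left _ _
  · exact swap_apply_right _ _

theorem ladder_zero_three (b : Bool) : ladder l 0 (3, b) = (3, !b) := by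
  have h : ∀ b, swap ((2 : Fin (l + 4)), false) (2, true) (3, b) = (3, b) := fun b =>
    swap_apply_of_ne_of_ne (fun e => fin_two_ne_three (Prod.mk.inj e).1.symm)
      fun e => fin_two_ne_three (Prod.mk.inj e).1.symm
  cases b
  · rw [ladder, Perm.mul_apply, swap_apply_left, h]; rfl
  · rw [ladder, Perm.mul_apply, swap_apply_right, h]; rfl

theorem ladderCol_sq (k : ℕ) : ladderCol l k * ladderCol l k = 1 := by
  ext1 x
  unfold ladderCol
  split <;> simp [zigzag_zigzag]

theorem ladder_sq (k : ℕ) : ladder l k * ladder l k = 1 := by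
  rcases k with _ | k
  · refine Equiv.ext fun x => ?_
    rw [Perm.mul_apply]
    by_cases h2 : x.1 = 2
    · rw [show x = (2, x.2) by rw [← h2], ladder_zero_two, ladder_zero_two, Bool.not_not]; rfl
    · by_cases h3 : x.1 = 3
      · rw [show x = (3, x.2) by rw [← h3], ladder_zero_three, ladder_zero_three, Bool.not_not]; rfl
      · rw [ladder_zero_of_ne h2 h3, ladder_zero_of_ne h2 h3]; rfl
  · rw [ladder, ← map_mul, ladderCol_sq, map_one]

theorem sign_ladder (k : ℕ) : sign (ladder l k) = 1 := by
  rcases k with _ | k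
  · rw [ladder, Perm.sign_mul, sign_swap (by simp), sign_swap (by simp)]; rfl
  · exact sign_colHom _

theorem zigzag_two : zigzag (l + 4) 0 2 = 3 := by
  rw [zigzag_apply_up (by rw [val_fin_two]) (by rw [val_fin_two]; omega), Fin.ext_iff, val_fin_three,
    Fin.val_mk, val_fin_two]

theorem ladder_commute : Commute (ladder l 0) (ladder l 2) := by
  have h3 : zigzag (l + 4) 0 3 = 2 := by
    rw [← zigzag_two, zigzag_zigzag]
  have e : ∀ x, ladder l 2 x = (zigzag (l + 4) 0 x.1, x.2) := fun _ => rfl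
  refine Equiv.ext fun x => ?_
  rw [Perm.mul_apply, Perm.mul_apply, e, e]
  by_cases h2 : x.1 = 2
  · rw [show x = (2, x.2) by rw [← h2], ladder_zero_two, zigzag_two, ladder_zero_three]
  · by_cases hx3 : x.1 = 3
    · rw [show x = (3, x.2) by rw [← hx3], ladder_zero_three, h3, ladder_zero_two]
    · rw [ladder_zero_of_ne h2 hx3, ladder_zero_of_ne]
      · exact fun e => hx3 (by rw [← zigzag_two, ← show zigzag (l + 4) 0 x.1 = 2 from e, zigzag_zigzag])
      · exact fun e => h2 (by rw [← h3, ← show zigzag (l + 4) 0 x.1 = 3 from e, zigzag_zigzag])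

/-- Generators on a ladder attached to two rows of columns. -/
noncomputable def ladderGen (l m : ℕ) : ℕ → Perm ((Fin (l + 4) ⊕ Fin (l + 3)) ⊕ Fin (m + 3) × Bool)
  | 0 => viaEmbeddingHom (ladderEmb l m) (ladder l 0)
  | 1 => viaEmbeddingHom (ladderEmb l m) (ladder l 1)
  | 2 => viaEmbeddingHom (ladderEmb l m) (ladder l 2)
  | 3 => outHom _ (m + 3) (adj (m + 3) 1) * Perm.sumCongr 1 (rowFlip (m + 3))
  | i + 4 => outHom _ (m + 3) (adj (m + 3) (i + 2))

theorem ladderGen_eq {k : ℕ} (hk : k < 3) :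
    viaEmbeddingHom (ladderEmb l m) (ladder l k) = ladderGen l m k := by
  obtain rfl | rfl | rfl : k = 0 ∨ k = 1 ∨ k = 2 := by omega
  all_goals rfl

theorem ladderGen_apply {k : ℕ} (hk : k < 3) (x : Fin (l + 4) × Bool) :
    ladderGen l m k (ladderEmb l m x) = ladderEmb l m (ladder l k x) := by
  rw [← ladderGen_eq hk, viaEmbeddingHom_apply, viaEmbedding_apply]

theorem ladderGen_inr {k : ℕ} (hk : k < 3) {x : Fin (m + 3) × Bool} (hx : x ≠ (0, false)) :
    ladderGen l m k (Sum.inr x) = Sum.inr x := by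
  rw [← ladderGen_eq hk, viaEmbeddingHom_apply,
    viaEmbedding_apply_of_notMem _ _ _ (ladderEmb_notMem hx)]

theorem sign_viaEmbeddingHom {α β : Type*} [Fintype α] [DecidableEq α] [Fintype β] [DecidableEq β]
    (ι : α ↪ β) (e : Perm α) : sign (viaEmbeddingHom ι e) = sign e := by
  classical
  rw [viaEmbeddingHom_apply]
  rw [viaEmbedding]
  convert sign_extendDomain e (Equiv.ofInjective ι ι.injective) <;> rfl

theorem commute_of_inl_inr {α β : Type*} {f g : Perm (α ⊕ β)} (hf : ∀ x, f (Sum.inr x) = Sum.inr x)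
    (hg : ∀ x, g (Sum.inl x) = Sum.inl x) : Commute f g :=
  Disjoint.commute fun x => by
    rcases x with x | x
    · exact Or.inr (hg x)
    · exact Or.inl (hf x)

theorem ladder_apply_zero {k : ℕ} (hk : k ≠ 2) : ladder l k (0, true) = (0, true) := by
  rcases k with _ | _ | _ | k
  · exact ladder_zero_of_ne (by rw [Ne, Fin.ext_iff, val_fin_two]; simp)
      (by rw [Ne, Fin.ext_iff, val_fin_three]; simp)
  · exact congrArg (·, true) zigzag_one_zero
  · exact absurd rfl hk
  · rfl

theorem ladderGen_inr_of_ne {k : ℕ} (hk : k < 2) (x : Fin (m + 3) × Bool) :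
    ladderGen l m k (Sum.inr x) = Sum.inr x := by
  by_cases hx : x = (0, false)
  · subst hx
    rw [← ladderEmb_zero (l := l), ladderGen_apply (by omega), ladder_apply_zero (by omega)]
  · exact ladderGen_inr (by omega) hx

theorem tail_ladderGen (hm : Odd m) : Tail m 2 1 (ladderGen l m) where
  sq_z := one_mul 1
  sign_z := by rw [Perm.sign_one, (hm.add_odd (by decide : Odd 3)).neg_one_pow]
  one := rfl
  two i h2 _ := by
    obtain ⟨i, rfl⟩ := Nat.exists_eq_add_of_le' h2
    rw [add_comm 2]
    rfl
  low i hi x := ladderGen_inr_of_ne hi x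
  head x hx := ladderGen_inr (by omega) fun e => hx (by rw [e]; rfl)
  sq i hi := by rw [← ladderGen_eq (by omega), ← map_mul, ladder_sq, map_one]
  ne_one i hi := by
    rw [← ladderGen_eq (by omega), Ne, ← map_one (viaEmbeddingHom (ladderEmb l m)),
      (viaEmbeddingHom_injective _).eq_iff]
    intro e
    have h : ∀ x, ladder l i x = x := fun x => by rw [e]; rfl
    obtain rfl | rfl | rfl : i = 0 ∨ i = 1 ∨ i = 2 := by omega
    · simpa [ladder_zero_two] using h (2, false)
    · have := congrArg (fun x => (x.1 : ℕ)) (h (1, false))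
      rw [ladder_fst] at this
      simp [ladderCol, zigzag_apply_up] at this
    · have := congrArg Prod.fst (h (2, false))
      rw [ladder_fst] at this
      exact fin_two_ne_three (this.symm.trans zigzag_two)
  even i hi := by rw [← ladderGen_eq (by omega), sign_viaEmbeddingHom, sign_ladder]
  comm i j hij hj := by
    obtain ⟨rfl, rfl⟩ | ⟨hi, rfl⟩ : (i = 0 ∧ j = 2) ∨ (i < 2 ∧ j = 3) := by omega
    · rw [← ladderGen_eq (by omega), ← ladderGen_eq (by omega)]
      exact ladder_commute.map _
    · exact commute_of_inl_inr (ladderGen_inr_of_ne hi) fun x => rfl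
  sep := by
    have h01 : adj (m + 3) 1 0 = 1 := by
      rw [adj_eq (by omega) (by omega)]; exact swap_apply_left _ _
    have h10 : adj (m + 3) 1 1 = 0 := by
      rw [adj_eq (by omega) (by omega)]; exact swap_apply_right _ _
    refine ⟨{Sum.inr (0, true), Sum.inr (1, false)}, true, ?_, ?_, by simp, by simp, by simp⟩
    · rintro _ (rfl | rfl)
      · rw [ladderGen_inr (by omega) (by simp)]; simp
      · rw [ladderGen_inr (by omega) (by simp)]; simp
    · rintro _ (rfl | rfl)
      · simp [ladderGen, h01]
      · simp [ladderGen, h10]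

theorem ladder_col {i j : ℕ} {e : Perm (Fin (l + 4) × Bool)} (he : e ∈ itv (ladder l) i j) :
    ∃ τ ∈ itv (ladderCol l) i j, ∀ x, (e x).1 = τ x.1 := by
  refine Subgroup.closure_induction
    (p := fun e _ => ∃ τ ∈ itv (ladderCol l) i j, ∀ x, (e x).1 = τ x.1) ?_
    ⟨1, one_mem _, fun _ => rfl⟩ ?_ ?_ he
  · rintro _ ⟨k, hk, rfl⟩
    exact ⟨_, mem_itv hk.1 hk.2, ladder_fst k⟩
  · rintro a b - - ⟨d, hd, ha⟩ ⟨e, he, hb⟩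
    exact ⟨d * e, Subgroup.mul_mem _ hd he, fun x => by
      rw [Perm.mul_apply, ha, hb, Perm.mul_apply]⟩
  · rintro a - ⟨d, hd, ha⟩
    refine ⟨d⁻¹, Subgroup.inv_mem _ hd, fun x => ?_⟩
    rw [Perm.eq_inv_iff_eq, ← ha]
    exact congrArg Prod.fst (a.apply_symm_apply x)

/-- Elements preserving the first row, determined by their action on the columns. -/
theorem ladderGen_mem {i j i' : ℕ} (hi : 1 ≤ i') (hj : j ≤ 3) {e : Perm (Fin (l + 4) × Bool)}
    {σ : Perm (Fin (l + 4))} (hσ : σ ∈ itv (ladderCol l) i' j) (he : e ∈ itv (ladder l) i j)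
    (h : ∀ c, e (c, false) = (σ c, false)) :
    viaEmbeddingHom (ladderEmb l m) e ∈ itv (ladderGen l m) i' j := by
  obtain ⟨τ, -, hτ⟩ := ladder_col he
  have e1 : ∀ c, τ c = σ c := fun c => by rw [← hτ (c, false), h]
  have e2 : e = colHom (l + 4) σ := by
    refine Equiv.ext fun ⟨c, b⟩ => ?_
    cases b
    · exact h c
    · have h1 := hτ (c, true)
      have h2 : (e (c, true)).2 = true := by
        by_contra h2
        have h3 : e (c, true) = e (c, false) := by
          rw [h, Prod.ext_iff, h1, e1]
          exact ⟨rfl, by simpa using h2⟩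
        simpa using e.injective h3
      exact Prod.ext (h1.trans (e1 c)) h2
  rw [e2]
  refine map_mem_itv (r := ladder l) _ (fun k _ hk => ladderGen_eq (by omega)) ?_
  refine map_mem_itv (r := ladderCol l) _ (fun k hk hk' => ?_) hσ
  obtain ⟨k, rfl⟩ := Nat.exists_eq_add_of_le' (hi.trans hk)
  rfl

theorem ladderGen_inl_inl {k : ℕ} (hk : 1 ≤ k) (hk' : k < 4) (c : Fin (l + 4)) :
    ladderGen l m k (Sum.inl (Sum.inl c)) = Sum.inl (Sum.inl (ladderCol l k c)) := by
  obtain hk | rfl : k < 3 ∨ k = 3 := by omega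
  · rw [← ladderEmb_false, ladderGen_apply hk]
    obtain ⟨k, rfl⟩ := Nat.exists_eq_add_of_le' ‹1 ≤ k›
    rfl
  · rfl

theorem ladderGen_inter {i j : ℕ} (hi : i < 2) (hj : i + 2 ≤ j) (hj' : j ≤ 3) :
    itv (ladderGen l m) i j ⊓ itv (ladderGen l m) (i + 1) (j + 1) ≤ itv (ladderGen l m) (i + 1) j := by
  intro g hg
  obtain ⟨hg1, hg2⟩ := Subgroup.mem_inf.1 hg
  obtain ⟨e, he, rfl⟩ := exists_of_mem_itv _ (fun k _ hk => ladderGen_eq (by omega)) hg1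
  obtain ⟨σ, hσ, hgσ⟩ := exists_acts (r := ladderCol l) (fun c => Sum.inl (Sum.inl c))
    (fun k hk hk' => ladderGen_inl_inl (by omega) (by omega)) hg2
  have h : ∀ c, e (c, false) = (σ c, false) := fun c => by
    have := hgσ c
    rw [← ladderEmb_false, ← ladderEmb_false, viaEmbeddingHom_apply, viaEmbedding_apply] at this
    exact (ladderEmb l m).injective this
  obtain rfl | ⟨rfl, rfl⟩ : i = 0 ∨ i = 1 ∧ j = 3 := by omega
  · obtain ⟨τ, hτ, hτ'⟩ := ladder_col he
    obtain rfl : σ = τ := Equiv.ext fun c => by rw [← hτ' (c, false), h]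
    refine ladderGen_mem le_rfl hj' (itv_le (fun k h1 h2 => ?_) hτ) he h
    rcases Nat.eq_zero_or_pos k with rfl | hk
    · exact one_mem _
    · exact mem_itv hk h2
  · refine ladderGen_mem (by omega) le_rfl (itv_le (fun k h1 h2 => ?_) hσ) he h
    obtain hk | rfl : k < 3 ∨ k = 3 := by omega
    · exact mem_itv h1 hk
    · exact one_mem _

theorem exists_ladder (l : ℕ) (hm : Odd m) :
    StringCGen (alternatingGroup ((Fin (l + 4) ⊕ Fin (l + 3)) ⊕ Fin (m + 3) × Bool)) (m + 5) ∧
      (3 ≤ m → StringCGen (alternatingGroup ((Fin (l + 4) ⊕ Fin (l + 3)) ⊕ Fin (m + 3) × Bool))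
        (m + 4)) := by
  have h : Tail m 2 1 (ladderGen l m) := tail_ladderGen hm
  have y0 : ladderGen l m 2 (Sum.inr (0, false)) = Sum.inl (Sum.inr 0) := by
    rw [← ladderEmb_zero (l := l), ladderGen_apply (by omega)]
    change ladderEmb l m (zigzag (l + 4) 0 0, true) = _
    rw [zigzag_apply_up (by simp) (by simp)]
    rfl
  have y1 : ladderGen l m 2 (Sum.inl (Sum.inr 0)) = Sum.inr (0, false) := by
    rw [← y0, ← Perm.mul_apply, h.sq 2 le_rfl]; rfl
  have x3 : ∀ p, ladderGen l m 3 (Sum.inl p) = Sum.inl p := fun p => rfl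
  have c2 : ∀ x ≠ (0, false), ladderGen l m 2 (Sum.inr x) = Sum.inr x := fun x hx =>
    ladderGen_inr (by omega) hx
  have a3 : ∀ b, ladderGen l m 3 (Sum.inr (0, b)) = Sum.inr (1, !b) := h.apply_zero
  have b3 : ∀ b, ladderGen l m 3 (Sum.inr (1, b)) = Sum.inr (0, !b) := h.apply_one
  have f0 : ∀ x : Fin (m + 3) × Bool, 2 ≤ (x.1 : ℕ) → ∀ y, (y.1 : ℕ) < 2 → x ≠ y :=
    fun x hx y hy e => by rw [e] at hx; omega
  have f2 : ∀ x : Fin (m + 3) × Bool, 2 ≤ (x.1 : ℕ) → ladderGen l m 2 (Sum.inr x) = Sum.inr x :=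
    fun x hx => c2 x (f0 x hx _ (by simp))
  have f3 : ∀ x : Fin (m + 3) × Bool, 2 ≤ (x.1 : ℕ) →
      ladderGen l m 3 (Sum.inr x) = Sum.inr (x.1, !x.2) := fun x hx => h.apply_one_far hx
  set ρ := ladderGen l m with hρ
  have hQ : ∀ p ≠ Sum.inr 0, ∃ q ≠ Sum.inr 0, ρ 2 (Sum.inl p) = Sum.inl q := fun p hp => by
    rcases hq : ρ 2 (Sum.inl p) with q | q
    · refine ⟨q, ?_, rfl⟩
      rintro rfl
      rw [← y0] at hq
      simpa using (ρ 2).injective hq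
    · refine absurd ?_ hp
      have hq' : Sum.inl p = ρ 2 (Sum.inr q) := by
        rw [← hq, ← Perm.mul_apply, h.sq 2 le_rfl]; rfl
      by_cases hq0 : q = (0, false)
      · rw [hq0, y0] at hq'
        exact Sum.inl_injective hq'
      · rw [c2 q hq0] at hq'
        simp at hq'
  have hcyc : ρ 2 * ρ 3 * (ρ 2 * ρ 3) =
      cyc (Sum.inr (0, false)) (Sum.inl (Sum.inr 0)) (Sum.inr (1, true)) := by
    refine Equiv.ext fun x => ?_
    simp only [Perm.mul_apply]
    rcases x with p | x
    · by_cases hp : p = Sum.inr 0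
      · subst hp
        rw [cyc_apply_mid (by simp) (by simp), x3, y1, a3]
        exact c2 _ (by simp)
      · obtain ⟨q, -, hq⟩ := hQ p hp
        rw [cyc_apply_of_ne (by simp) (by simpa using hp) (by simp), x3, hq, x3, ← hq,
          ← Perm.mul_apply, h.sq 2 le_rfl]
        rfl
    · rcases cases_col x with hx | rfl | rfl | rfl | rfl
      · rw [cyc_apply_of_ne (by simpa using f0 x hx (0, false) (by simp)) (by simp)
          (by simpa using f0 x hx (1, true) (by simp)), f3 x hx, f2 (x.1, !x.2) hx,
          f3 (x.1, !x.2) hx, Bool.not_not, f2 (x.1, x.2) hx]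
      · rw [cyc_apply_left (by simp) (by simp), a3, c2 _ (by simp), b3]
        exact y0
      · rw [cyc_apply_of_ne (by simp) (by simp) (by simp), a3, c2 _ (by simp), b3]
        exact c2 _ (by simp)
      · rw [cyc_apply_of_ne (by simp) (by simp) (by simp), b3, c2 _ (by simp), a3]
        exact c2 _ (by simp)
      · rw [cyc_apply_right, b3]
        exact (congrArg (fun y => ρ 2 (ρ 3 y)) y0).trans ((congrArg (ρ 2) (x3 _)).trans y1)
  have m2 : ρ 2 ∈ itv ρ 2 4 := mem_itv le_rfl (by omega)
  have m3 : ρ 3 ∈ itv ρ 2 4 := mem_itv (by omega) (by omega)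
  have mc : cyc (Sum.inr (0, false)) (Sum.inl (Sum.inr 0)) (Sum.inr (1, true)) ∈ itv ρ 2 4 :=
    hcyc ▸ Subgroup.mul_mem _ (Subgroup.mul_mem _ m2 m3) (Subgroup.mul_mem _ m2 m3)
  have l0 : Linked (itv ρ 2 4) (Sum.inr (0, false)) (Sum.inl (Sum.inr 0)) :=
    Linked.of_cyc (by simp) (by simp) (by simp) mc
  have l1 : Linked (itv ρ 2 4) (Sum.inr (0, false)) (Sum.inr (1, true)) :=
    l0.trans (Linked.of_cyc' (by simp) (by simp) (by simp) mc)
  have hrow : ∀ K, itv ρ 1 4 ≤ K → ∀ {c b}, Linked K (Sum.inr (0, false)) (ladderEmb l m (c, b)) →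
      ∀ c, Linked K (Sum.inr (0, false)) (ladderEmb l m (c, b)) := fun K hK c b hc c' => by
    refine zigzag_induction (p := fun c => Linked K (Sum.inr (0, false)) (ladderEmb l m (c, b)))
      (fun i hi => ?_) (fun i hi => ?_) hc c'
    · have := hi.map (hK (mem_itv (k := 2) (by omega) (by omega)))
      rw [y0, hρ, ladderGen_apply (by omega)] at this
      exact (l0.mono ((itv_mono (by omega) le_rfl).trans hK)).trans this
    · have := hi.map (hK (mem_itv (k := 1) (by omega) (by omega)))
      rwa [hρ, ladderGen_inr_of_ne (by omega), ladderGen_apply (by omega)] at this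
  have hy : ∀ c, Linked (itv ρ 1 4) (Sum.inr (0, false)) (ladderEmb l m (c, true)) :=
    hrow _ le_rfl (c := 0) (Or.inl rfl)
  have hx : ∀ c, Linked (itv ρ 0 4) (Sum.inr (0, false)) (ladderEmb l m (c, false)) := by
    refine hrow _ (itv_mono (by omega) le_rfl) (c := 2) ?_
    have := ((hy 2).mono (itv_mono (k := 0) (by omega) le_rfl)).map
      (mem_itv (k := 0) le_rfl (by omega))
    rwa [hρ, ladderGen_inr_of_ne (by omega), ladderGen_apply (by omega), ladder_zero_two] at this
  rw [show m + 5 = 2 + (m + 3) by omega, show m + 4 = 2 + (m + 2) by omega]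
  refine h.stringCGen (h.isStringC fun i hi j hij hj => ?_) ?_
    (h.linked_cols (by omega) (l1.mono (itv_mono (by omega) (by omega))))
  · obtain rfl | hj2 | hj3 : j = i + 1 ∨ (i + 2 ≤ j ∧ j ≤ 3) ∨ 4 ≤ j := by omega
    · refine inter_pair (h.sq i (by omega)) (h.sq (i + 1) (by omega)) fun e => ?_
      obtain rfl | rfl : i = 0 ∨ i = 1 := by omega
      · have := congrArg (fun f => f (ladderEmb l m (2, false))) e
        simp only [hρ] at this
        rw [ladderGen_apply (by omega), ladderGen_apply (by omega), ladder_zero_two,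
          (ladderEmb l m).injective.eq_iff] at this
        exact absurd (congrArg Prod.snd this) (by simp [ladder])
      · have := congrArg (fun f => f (Sum.inr (0, false))) e
        simp only [hρ] at this
        rw [ladderGen_inr_of_ne (by omega), y0] at this
        simp at this
    · exact ladderGen_inter (by omega) hj2.1 hj2.2
    · obtain ⟨d, rfl⟩ : ∃ d, j = 2 + d := ⟨j - 2, by omega⟩
      obtain rfl | rfl : i = 0 ∨ i = 1 := by omega
      · refine h.inter_cols (by omega) (by omega) (by omega) {p | ∃ c, p = Sum.inl c} (fun _ _ => rfl)
          ?_ (c2 _ (by simp)) ?_ (l1.mono (itv_mono (by omega) le_rfl))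
        · rintro k h1 h2 _ ⟨c, rfl⟩
          exact ⟨_, ⟨_, rfl⟩, ladderGen_inl_inl h1 (by omega) c⟩
        · rintro (c | c) hc
          · exact absurd ⟨c, rfl⟩ hc
          · exact hy c.succ
      · refine h.inter_cols (by omega) (by omega) (by omega) {p | p ≠ Sum.inr 0} (fun _ _ => rfl)
          ?_ (c2 _ (by simp)) ?_ l1
        · rintro k h1 h2 p hp
          obtain rfl : k = 2 := by omega
          exact hQ p hp
        · intro p hp
          obtain rfl : p = Sum.inr 0 := by_contra hp
          exact l0
  · rintro (c | c)
    · exact (hx c).mono (itv_mono le_rfl (by omega))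
    · exact (hy c.succ).mono (itv_mono (by omega) (by omega))

end Ladder

section Hook

variable {m : ℕ}

/-- Generators of the projective action of degree six of `A₅`. -/
def hookHex : ℕ → Perm (Fin 6)
  | 0 => swap 2 3 * swap 4 5
  | 1 => swap 1 2 * swap 3 4
  | _ => swap 0 1 * swap 4 5

/-- The permutations of six points, next to other fixed points. -/
def hookHom (m : ℕ) : Perm (Fin 6) →* Perm (Option (Fin 6) ⊕ Fin (m + 3) × Bool) where
  toFun d := Perm.sumCongr (optionCongr d) 1
  map_one' := by
    ext1 x
    rcases x with (_ | x) | x <;> rfl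
  map_mul' d e := by
    ext1 x
    rcases x with (_ | x) | x <;> rfl

theorem hookHom_some (d : Perm (Fin 6)) (i : Fin 6) :
    hookHom m d (Sum.inl (some i)) = Sum.inl (some (d i)) := rfl

/-- Generators acting on a path of six points with a fork, followed by two rows. -/
def hookGen (m : ℕ) : ℕ → Perm (Option (Fin 6) ⊕ Fin (m + 3) × Bool)
  | 0 => hookHom m (hookHex 0)
  | 1 => hookHom m (hookHex 1)
  | 2 => hookHom m (hookHex 2)
  | 3 => swap (Sum.inl none) (Sum.inr (0, true)) * swap (Sum.inl (some 0)) (Sum.inr (0, false))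
  | 4 => outHom _ (m + 3) (adj (m + 3) 1) * Perm.sumCongr 1 (rowFlip (m + 3))
  | i + 5 => outHom _ (m + 3) (adj (m + 3) (i + 2))

theorem hookGen_eq {k : ℕ} (hk : k < 3) : hookHom m (hookHex k) = hookGen m k := by
  obtain rfl | rfl | rfl : k = 0 ∨ k = 1 ∨ k = 2 := by omega
  all_goals rfl

theorem hookGen_some {k : ℕ} (hk : k < 3) (i : Fin 6) :
    hookGen m k (Sum.inl (some i)) = Sum.inl (some (hookHex k i)) := by
  rw [← hookGen_eq hk, hookHom_some]

theorem hookGen_none {k : ℕ} (hk : k < 3) :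
    hookGen m k (Sum.inl none) = Sum.inl none := by
  rw [← hookGen_eq hk]; rfl

theorem hookGen_inr {k : ℕ} (hk : k < 3) (x) : hookGen m k (Sum.inr x) = Sum.inr x := by
  rw [← hookGen_eq hk]; rfl

theorem hookGen_three_some {i : Fin 6} (hi : i ≠ 0) :
    hookGen m 3 (Sum.inl (some i)) = Sum.inl (some i) := by
  rw [hookGen, Perm.mul_apply, swap_apply_of_ne_of_ne (x := Sum.inl (some i)) (by simpa) (by simp),
    swap_apply_of_ne_of_ne (by simp) (by simp)]

theorem hookGen_three_inr {x : Fin (m + 3) × Bool} (hx : x.1 ≠ 0) :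
    hookGen m 3 (Sum.inr x) = Sum.inr x := by
  rw [hookGen, Perm.mul_apply, swap_apply_of_ne_of_ne (x := Sum.inr x) (by simp) fun e => hx (by
    rw [Sum.inr.inj e]), swap_apply_of_ne_of_ne (by simp) fun e => hx (by rw [Sum.inr.inj e])]

theorem hookGen_three_none : hookGen m 3 (Sum.inl none) = Sum.inr (0, true) := by
  simp [hookGen, swap_apply_of_ne_of_ne]

theorem hookGen_three_true : hookGen m 3 (Sum.inr (0, true)) = Sum.inl none := by
  simp [hookGen, swap_apply_of_ne_of_ne]

theorem hookGen_three_zero : hookGen m 3 (Sum.inl (some 0)) = Sum.inr (0, false) := by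
  simp [hookGen, swap_apply_of_ne_of_ne]

theorem hookGen_three_false : hookGen m 3 (Sum.inr (0, false)) = Sum.inl (some 0) := by
  simp [hookGen, swap_apply_of_ne_of_ne]

theorem hookHex_sq {k : ℕ} (hk : k < 3) : hookHex k * hookHex k = 1 :=
  (by decide +kernel : ∀ k : Fin 3, hookHex k * hookHex k = 1) ⟨k, hk⟩

theorem hookGen_three_sq : hookGen m 3 * hookGen m 3 = 1 := by
  ext1 x
  rw [Perm.mul_apply, Perm.one_apply]
  rcases x with (_ | i) | ⟨c, b⟩
  · rw [hookGen_three_none, hookGen_three_true]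
  · by_cases hi : i = 0
    · rw [hi, hookGen_three_zero, hookGen_three_false]
    · rw [hookGen_three_some hi, hookGen_three_some hi]
  · by_cases hc : c = 0
    · subst hc
      cases b
      · rw [hookGen_three_false, hookGen_three_zero]
      · rw [hookGen_three_true, hookGen_three_none]
    · rw [hookGen_three_inr hc, hookGen_three_inr hc]

theorem sign_hookHom (d : Perm (Fin 6)) : sign (hookHom m d) = sign d := by
  refine (Perm.sign_sumCongr _ _).trans ?_
  rw [Perm.sign_one, mul_one, optionCongr_sign]

theorem tail_hookGen (hm : Odd m) : Tail m 3 1 (hookGen m) where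
  sq_z := one_mul 1
  sign_z := by rw [Perm.sign_one, (hm.add_odd (by decide : Odd 3)).neg_one_pow]
  one := rfl
  two i h2 _ := by
    obtain ⟨i, rfl⟩ := Nat.exists_eq_add_of_le' h2
    rw [add_comm 3]
    rfl
  low i hi x := hookGen_inr hi x
  head x hx := hookGen_three_inr fun e => hx (by rw [e]; rfl)
  sq i hi := by
    rcases hi.lt_or_eq with hi | rfl
    · rw [← hookGen_eq hi, ← map_mul, hookHex_sq hi, map_one]
    · exact hookGen_three_sq
  ne_one i hi e := by
    rcases hi.lt_or_eq with hi | rfl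
    · have h : ∀ x, hookHex i x = x := fun x => by
        have := hookGen_some (m := m) hi x
        rw [e] at this
        simpa using this.symm
      exact absurd (h) ((by decide +kernel : ∀ k : Fin 3, ¬ ∀ x, hookHex k x = x) ⟨i, hi⟩)
    · have := hookGen_three_none (m := m)
      rw [e] at this
      simp at this
  even i hi := by
    rcases hi.lt_or_eq with hi | rfl
    · rw [← hookGen_eq hi, sign_hookHom]
      exact (by decide +kernel : ∀ k : Fin 3, sign (hookHex k) = 1) ⟨i, hi⟩
    · rw [hookGen, Perm.sign_mul, sign_swap (by simp), sign_swap (by simp)]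
      decide
  comm i j hij hj := by
    obtain ⟨rfl, rfl⟩ | ⟨hi, rfl⟩ | ⟨hi, rfl⟩ : (i = 0 ∧ j = 2) ∨ (i < 2 ∧ j = 3) ∨ (i < 3 ∧ j = 4) := by
      omega
    · exact (show Commute (hookHex 0) (hookHex 2) from by
        exact (by decide +kernel : hookHex 0 * hookHex 2 = hookHex 2 * hookHex 0)).map (hookHom m)
    · have h0 : hookHex i 0 = 0 :=
        (by decide +kernel : ∀ k : Fin 2, hookHex k 0 = 0) ⟨i, hi⟩
      refine Disjoint.commute fun x => ?_
      rcases x with (_ | k) | x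
      · exact Or.inl (hookGen_none (by omega))
      · by_cases hk : k = 0
        · rw [hk, hookGen_some (by omega), h0]
          exact Or.inl rfl
        · exact Or.inr (hookGen_three_some hk)
      · exact Or.inl (hookGen_inr (by omega) x)
    · exact commute_of_inl_inr (hookGen_inr hi) fun x => rfl
  sep := by
    have h01 : adj (m + 3) 1 0 = 1 := by
      rw [adj_eq (by omega) (by omega)]; exact swap_apply_left _ _
    have h10 : adj (m + 3) 1 1 = 0 := by
      rw [adj_eq (by omega) (by omega)]; exact swap_apply_right _ _
    refine ⟨{Sum.inl none, Sum.inr (0, true), Sum.inr (1, false)}, true, ?_, ?_, by simp, by simp,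
      by simp⟩
    · rintro _ (rfl | rfl | rfl)
      · rw [hookGen_three_none]; simp
      · rw [hookGen_three_true]; simp
      · rw [hookGen_three_inr (by simp)]; simp
    · rintro _ (rfl | rfl | rfl)
      · simp [hookGen]
      · simp [hookGen, h01]
      · simp [hookGen, h10]

theorem hookHex_mem : itv hookHex 0 3 ≤ relStab hexRel := itv_le fun k _ hk =>
  (by decide +kernel : ∀ k : Fin 3, ∀ a b c,
    hexRel (hookHex k a) (hookHex k b) (hookHex k c) ↔ hexRel a b c) ⟨k, hk⟩

set_option maxRecDepth 100000 in
theorem hookHex_stab : ∀ d : Perm (Fin 6), (∀ i, 3 ≤ i → 3 ≤ d i) →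
    (∀ a b c, hexRel (d a) (d b) (d c) ↔ hexRel a b c) →
    ∃ (n : Fin 3) (e : Fin 2), d = (hookHex 1 * hookHex 2) ^ (n : ℕ) * hookHex 1 ^ (e : ℕ) ∧
      (d 0 = 0 → n = 0) ∧ (d 2 = 2 → d = 1 ∨ d = hookHex 2) := by
  decide +kernel

/-- The intersection conditions of the generators of the action of degree six. -/
theorem hookGen_inter {i j : ℕ} (hij : i + 2 ≤ j) (hj : j ≤ 3) :
    itv (hookGen m) i j ⊓ itv (hookGen m) (i + 1) (j + 1) ≤ itv (hookGen m) (i + 1) j := by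
  intro g hg
  obtain ⟨hg1, hg2⟩ := Subgroup.mem_inf.1 hg
  obtain ⟨d, hd, rfl⟩ := exists_of_mem_itv (hookHom m) (fun k _ hk => hookGen_eq (by omega)) hg1
  refine map_mem_itv (hookHom m) (fun k _ hk => hookGen_eq (by omega)) ?_
  have hrel := hookHex_mem (itv_mono (by omega) hj hd)
  have h3 : ∀ i, 3 ≤ i → 3 ≤ d i := by
    rcases Nat.eq_zero_or_pos i with rfl | hi
    · intro p hp
      have : hookHom m d (Sum.inl (some p)) ∈ {y | ∃ p' : Fin 6, 3 ≤ p' ∧ y = Sum.inl (some p')} := by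
        refine mapsTo_itv ?_ hg2 ⟨p, hp, rfl⟩
        rintro k h1 h2 _ ⟨p, hp, rfl⟩
        obtain rfl | ⟨h1, h2⟩ : k = 3 ∨ (1 ≤ k ∧ k < 3) := by omega
        · exact ⟨p, hp, hookGen_three_some (by rintro rfl; exact absurd hp (by decide))⟩
        · refine ⟨_, ?_, hookGen_some h2 p⟩
          exact (by decide +kernel : ∀ k : Fin 3, 1 ≤ k → ∀ p, 3 ≤ p → 3 ≤ hookHex k p) ⟨k, h2⟩
            h1 p hp
      obtain ⟨p', hp', e⟩ := this
      rw [hookHom_some] at e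
      simp only [Sum.inl.injEq, Option.some.injEq] at e
      rwa [e]
    · intro p hp
      have : d p ∈ {p : Fin 6 | 3 ≤ p} := by
        refine mapsTo_itv ?_ hd hp
        intro k h1 h2 p hp
        exact (by decide +kernel : ∀ k : Fin 3, 1 ≤ k → ∀ p, 3 ≤ p → 3 ≤ hookHex k p) ⟨k, by omega⟩
            (show 1 ≤ k by omega) p hp
      exact this
  obtain ⟨n, e, hd', k0, k2⟩ := hookHex_stab d h3 hrel
  obtain rfl | rfl : i = 0 ∨ i = 1 := by omega
  · have m1 : hookHex 1 ∈ itv hookHex 1 j := mem_itv le_rfl (by omega)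
    obtain rfl | rfl : j = 2 ∨ j = 3 := by omega
    · have : d 0 = 0 := fix_itv (fun k _ hk => (by decide +kernel : ∀ k : Fin 2, hookHex k 0 = 0)
        ⟨k, hk⟩) hd
      rw [hd', k0 this, Fin.val_zero, pow_zero, one_mul]
      exact Subgroup.pow_mem _ m1 _
    · rw [hd']
      exact Subgroup.mul_mem _ (Subgroup.pow_mem _ (Subgroup.mul_mem _ m1
        (mem_itv (by omega) (by omega))) _) (Subgroup.pow_mem _ m1 _)
  · obtain rfl : j = 3 := by omega
    have : d 2 = 2 := by
      have : hookHom m d (Sum.inl (some 2)) = Sum.inl (some 2) := fix_itv (fun k h1 h2 => by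
        obtain rfl | rfl : k = 2 ∨ k = 3 := by omega
        · exact (hookGen_some (by omega) 2).trans (congrArg (Sum.inl ∘ some)
            (by decide +kernel : hookHex 2 2 = 2))
        · exact hookGen_three_some (by decide)) hg2
      rw [hookHom_some] at this
      simpa using this
    rcases k2 this with e | e
    · rw [e]; exact one_mem _
    · rw [e]; exact mem_itv le_rfl (by omega)

end Hook

section Hook

variable {m : ℕ}

/-- The exchange of the rows together with that of the ends of the fork. -/
def hookFlip (m : ℕ) : Perm (Option (Fin 6) ⊕ Fin (m + 3) × Bool) :=
  Perm.sumCongr (swap none (some 0)) (rowFlip (m + 3))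

theorem hookFlip_inr (c : Fin (m + 3)) (b : Bool) :
    hookFlip m (Sum.inr (c, b)) = Sum.inr (c, !b) := rfl

theorem hookFlip_none : hookFlip m (Sum.inl none) = Sum.inl (some 0) := rfl

theorem hookFlip_zero : hookFlip m (Sum.inl (some 0)) = Sum.inl none := rfl

theorem hookFlip_some {i : Fin 6} (hi : i ≠ 0) :
    hookFlip m (Sum.inl (some i)) = Sum.inl (some i) := by
  rw [hookFlip, Perm.sumCongr_apply, Sum.map_inl, swap_apply_of_ne_of_ne (by simp) (by simpa)]

theorem commute_hookFlip {k : ℕ} (hk : 3 ≤ k) (x) :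
    hookGen m k (hookFlip m x) = hookFlip m (hookGen m k x) := by
  obtain ⟨k, rfl⟩ := Nat.exists_eq_add_of_le' hk
  rcases k with _ | _ | k
  · rcases x with (_ | i) | ⟨c, b⟩
    · rw [hookFlip_none, hookGen_three_none, hookGen_three_zero, hookFlip_inr, Bool.not_true]
    · by_cases hi : i = 0
      · rw [hi, hookFlip_zero, hookGen_three_none, hookGen_three_zero, hookFlip_inr, Bool.not_false]
      · rw [hookFlip_some hi, hookGen_three_some hi, hookFlip_some hi]
    · by_cases hc : c = 0
      · subst hc
        cases b
        · rw [hookFlip_inr, Bool.not_false, hookGen_three_true, hookGen_three_false, hookFlip_zero]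
        · rw [hookFlip_inr, Bool.not_true, hookGen_three_true, hookGen_three_false, hookFlip_none]
      · rw [hookFlip_inr, hookGen_three_inr hc, hookGen_three_inr hc, hookFlip_inr]
  · rcases x with p | x
    · rfl
    · rfl
  · rcases x with p | x
    · rfl
    · rfl

theorem apply_hookFlip {i j : ℕ} (hi : 3 ≤ i) {g} (hg : g ∈ itv (hookGen m) i j) (x) :
    g (hookFlip m x) = hookFlip m (g x) := by
  have : itv (hookGen m) i j ≤ Subgroup.centralizer {hookFlip m} := itv_le fun k h1 _ =>
    Subgroup.mem_centralizer_singleton_iff.2 (Equiv.ext fun x => commute_hookFlip (by omega) x)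
  exact DFunLike.congr_fun (Subgroup.mem_centralizer_singleton_iff.1 (this hg)) x

theorem apply_hook_some {i j : ℕ} (hi : 3 ≤ i) {g} (hg : g ∈ itv (hookGen m) i j) {p : Fin 6}
    (hp : p ≠ 0) : g (Sum.inl (some p)) = Sum.inl (some p) := by
  refine fix_itv (fun k h1 _ => ?_) hg
  obtain ⟨k, rfl⟩ := Nat.exists_eq_add_of_le' (hi.trans h1)
  rcases k with _ | _ | k
  · exact hookGen_three_some hp
  · rfl
  · rfl

theorem hook_map_le {d : ℕ} (hm : Odd m) (hd : 3 ≤ d) (hdm : d < m + 3) {σ : Perm (Fin (m + 3))}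
    (hσ : ∀ x : Fin (m + 3), d ≤ (x : ℕ) → σ x = x) : outHom _ (m + 3) σ ∈ itv (hookGen m) 3 (3 + d) := by
  have h := ((tail_hookGen hm).twistedSym.map_le hd hdm.le)
    ⟨σ, mem_itv_adj (fun x hx => by omega) hσ, rfl⟩
  rw [itv_shift, add_comm d 3] at h
  exact itv_mono (by omega) le_rfl h

theorem hook_flip_mem {d : ℕ} (hm : Odd m) (hd : 3 ≤ d) :
    Perm.sumCongr 1 (rowFlip (m + 3)) ∈ itv (hookGen m) 3 (3 + d) := by
  have h := (tail_hookGen hm).twistedSym.c_mem hd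
  rw [itv_shift, add_comm d 3] at h
  exact itv_mono (by omega) le_rfl h

/-- The top free column is sent anywhere, within the group of the generators from the hook on. -/
theorem hook_reach {d : ℕ} (hm : Odd m) (hd : 3 ≤ d) (hdm : d < m + 3) {e : Fin (m + 3)}
    (he : (e : ℕ) < d) {p : Option (Fin 6) ⊕ Fin (m + 3) × Bool}
    (hp : p = Sum.inl none ∨ p = Sum.inl (some 0) ∨ ∃ x : Fin (m + 3) × Bool, x.1 ≤ e ∧ p = Sum.inr x) :
    ∃ h ∈ itv (hookGen m) 3 (3 + d), h (Sum.inr (e, true)) = p ∧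
      ∀ x : Fin (m + 3) × Bool, e < x.1 → h (Sum.inr x) = Sum.inr x := by
  set C := itv (hookGen m) 3 (3 + d) with hC
  have hne : ∀ i : Fin (m + 3), e < i → i ≠ 0 := fun i hi h0 => by
    rw [h0] at hi; exact absurd hi (by simp)
  have hsw : ∀ i ≤ e, outHom (Option (Fin 6)) (m + 3) (swap 0 i) ∈ C ∧
      ∀ x : Fin (m + 3) × Bool, e < x.1 → outHom (Option (Fin 6)) (m + 3) (swap 0 i) (Sum.inr x) =
        Sum.inr x := fun i hi => by
    refine ⟨hook_map_le (σ := swap 0 i) hm hd hdm fun x hx => swap_apply_of_ne_of_ne ?_ ?_,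
      fun x hx => ?_⟩
    · rintro rfl; simp at hx; omega
    · rintro rfl; exact absurd (show (x : ℕ) ≤ e from hi) (by omega)
    · rw [outHom_inr, swap_apply_of_ne_of_ne (hne _ hx) (hi.trans_lt hx).ne']
  have m3 : hookGen m 3 ∈ C := mem_itv le_rfl (by omega)
  have mc := hook_flip_mem (m := m) hm hd
  have f3 : ∀ x : Fin (m + 3) × Bool, e < x.1 → hookGen m 3 (Sum.inr x) = Sum.inr x :=
    fun x hx => hookGen_three_inr (hne _ hx)
  set c : Perm (Option (Fin 6) ⊕ Fin (m + 3) × Bool) := Perm.sumCongr 1 (rowFlip (m + 3)) with hc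
  have c1 : ∀ x, c (Sum.inr x) = Sum.inr (x.1, !x.2) := fun x => rfl
  have c0 : ∀ x, c (Sum.inl x) = Sum.inl x := fun x => rfl
  obtain ⟨t, ht, ht1, ht2⟩ : ∃ t ∈ C, t (Sum.inr (0, true)) = Sum.inr (0, false) ∧
      ∀ x : Fin (m + 3) × Bool, e < x.1 → t (Sum.inr x) = Sum.inr x := by
    refine ⟨hookGen m 3 * (c * hookGen m 3 * c), Subgroup.mul_mem _ m3 (Subgroup.mul_mem _
      (Subgroup.mul_mem _ mc m3) mc), ?_, fun x hx => ?_⟩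
    · simp only [Perm.mul_apply]
      rw [c1, Bool.not_true, hookGen_three_false, c0, hookGen_three_zero]
    · simp only [Perm.mul_apply]
      rw [c1, f3 _ (by exact hx), c1, Bool.not_not, f3 _ hx]
  have hb : ∀ b, ∃ t ∈ C, t (Sum.inr (0, true)) = Sum.inr (0, b) ∧
      ∀ x : Fin (m + 3) × Bool, e < x.1 → t (Sum.inr x) = Sum.inr x := by
    rintro (_ | _)
    · exact ⟨t, ht, ht1, ht2⟩
    · exact ⟨1, one_mem _, rfl, fun _ _ => rfl⟩
  have hT : ∃ T ∈ C, ∃ b, T (Sum.inr (0, b)) = p ∧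
      ∀ x : Fin (m + 3) × Bool, e < x.1 → T (Sum.inr x) = Sum.inr x := by
    rcases hp with rfl | rfl | ⟨⟨i, b⟩, hi, rfl⟩
    · exact ⟨_, m3, true, hookGen_three_true, f3⟩
    · exact ⟨_, m3, false, hookGen_three_false, f3⟩
    · exact ⟨_, (hsw i hi).1, b, by rw [outHom_inr, swap_apply_left], (hsw i hi).2⟩
  obtain ⟨T, mT, b, hTp, hTf⟩ := hT
  obtain ⟨t, mt, htb, htf⟩ := hb b
  refine ⟨T * (t * outHom _ (m + 3) (swap 0 e)), Subgroup.mul_mem _ mT (Subgroup.mul_mem _ mt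
    (hsw e le_rfl).1), ?_, fun x hx => ?_⟩
  · rw [Perm.mul_apply, Perm.mul_apply, outHom_inr, swap_apply_right, htb, hTp]
  · rw [Perm.mul_apply, Perm.mul_apply, (hsw e le_rfl).2 x hx, htf x hx, hTf x hx]

theorem hook_inter_far {d : ℕ} (hm : Odd m) (hd : 3 ≤ d) (hdm : d < m + 3) :
    itv (hookGen m) 2 (3 + d) ⊓ itv (hookGen m) 3 (3 + d + 1) ≤ itv (hookGen m) 3 (3 + d) := by
  have h := tail_hookGen hm
  have hle : itv (hookGen m) 3 (3 + d) ≤ itv (hookGen m) 3 (3 + d + 1) :=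
    itv_mono le_rfl (by omega)
  have key : ∀ e ≤ d, ∀ g ∈ itv (hookGen m) 3 (3 + d + 1),
      (∀ x : Fin (m + 3) × Bool, e ≤ (x.1 : ℕ) → g (Sum.inr x) = Sum.inr x) →
      g ∈ itv (hookGen m) 3 (3 + d) := by
    intro e
    induction e with
    | zero =>
      intro _ g hg hx
      suffices g = 1 from this ▸ one_mem _
      refine eq_one_of_sign (sign_itv (fun k _ hk => h.sign_eq (by omega)) hg)
        (x := Sum.inl none) (y := Sum.inl (some 0)) ?_
      rintro ((_ | p) | x) h1 h2
      · exact absurd rfl h1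
      · exact apply_hook_some le_rfl hg fun h => h2 (by rw [h])
      · exact hx x (Nat.zero_le _)
    | succ e ih =>
      intro he g hg hx
      have hem : e < m + 3 := by omega
      obtain ⟨t, ht, ht1, ht2⟩ := hook_reach hm hd hdm (e := ⟨e, hem⟩) (show e < d by omega)
        (p := g (Sum.inr (⟨e, hem⟩, true))) (by
          rcases hgp : g (Sum.inr (⟨e, hem⟩, true)) with (_ | p) | x
          · exact Or.inl rfl
          · by_cases hp : p = 0
            · exact Or.inr (Or.inl (by rw [hp]))
            · rw [← apply_hook_some le_rfl hg hp] at hgp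
              exact absurd (g.injective hgp) (by simp)
          · refine Or.inr (Or.inr ⟨x, ?_, rfl⟩)
            by_contra! hlt
            have hlt' : e < x.1 := hlt
            rw [← hx x (by omega)] at hgp
            have := g.injective hgp
            rw [← Sum.inr.inj this] at hlt
            exact absurd hlt (lt_irrefl _))
      rw [← Subgroup.mul_mem_cancel_left _ (Subgroup.inv_mem _ ht)]
      have hmem := Subgroup.mul_mem _ (Subgroup.inv_mem _ (hle ht)) hg
      have h1 : (t⁻¹ * g) (Sum.inr (⟨e, hem⟩, true)) = Sum.inr (⟨e, hem⟩, true) := by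
        rw [Perm.mul_apply, Perm.inv_eq_iff_eq, ht1]
      refine ih (by omega) _ hmem fun x hxe => ?_
      rcases hxe.eq_or_lt with hxe | hxe
      · obtain ⟨x, b⟩ := x
        obtain rfl : x = ⟨e, hem⟩ := Fin.ext hxe.symm
        cases b
        · have := apply_hookFlip le_rfl hmem (Sum.inr (⟨e, hem⟩, true))
          rwa [h1, hookFlip_inr] at this
        · exact h1
      · rw [Perm.mul_apply, hx x (by omega), Perm.inv_eq_iff_eq, ht2 x hxe]
  intro g hg
  obtain ⟨hg1, hg2⟩ := Subgroup.mem_inf.1 hg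
  have mc := hook_flip_mem (m := m) hm hd
  have hA : ActsBy (hookGen m) 2 (3 + d) 4 5
      {y | ∃ x : Fin (m + 3) × Bool, d ≤ (x.1 : ℕ) ∧ y = Sum.inr x} := by
    refine ⟨?_, ?_⟩
    · rintro k h1 h2 _ ⟨x, hx, rfl⟩
      obtain rfl : k = 4 := by omega
      exact ⟨(x.1, !x.2), hx, h.apply_one_far (by omega)⟩
    · rintro k h1 h2 h3 _ ⟨x, hx, rfl⟩
      exact h.apply_far (by omega) h2 hx (by omega)
  obtain ⟨q, hq, hgq⟩ := hA.exists_agree hg1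
  rcases (mem_itv_one (h.isStringC_shift.sq 1 (by omega))).1 hq with rfl | rfl
  · exact key d le_rfl g hg2 fun x hx => hgq _ ⟨x, hx, rfl⟩
  · rw [← Subgroup.mul_mem_cancel_left _ mc]
    refine key d le_rfl _ (Subgroup.mul_mem _ (hle mc) hg2) fun x hx => ?_
    rw [Perm.mul_apply, hgq _ ⟨x, hx, rfl⟩, h.apply_one_far (by omega), Perm.sumCongr_apply,
      Sum.map_inr, rowFlip_apply, Bool.not_not]

end Hook

section Hook

variable {m : ℕ}

/-- The points on which the first generators of the tail act regularly on one side of the hook. -/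
def hookSide (m d : ℕ) : Set (Option (Fin 6) ⊕ Fin (m + 3) × Bool) :=
  {y | y = Sum.inl none ∨ y = Sum.inr (0, true) ∨ (d = 2 ∧ y = Sum.inr (1, false)) ∨
    ∃ x : Fin (m + 3) × Bool, d ≤ (x.1 : ℕ) ∧ y = Sum.inr x}

theorem actsBy_hookSide (hm : Odd m) {i d : ℕ} (hd : d = 1 ∨ d = 2) :
    ActsBy (hookGen m) i (3 + d) 3 (3 + d) (hookSide m d) := by
  have h := tail_hookGen hm
  have hx0 : ∀ x : Fin (m + 3) × Bool, d ≤ (x.1 : ℕ) → x.1 ≠ 0 := fun x hx e => by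
    rw [e] at hx; simp at hx; omega
  refine ⟨fun k h1 h2 y hy => ?_, fun k h1 h2 h3 y hy => ?_⟩
  · obtain rfl | ⟨rfl, rfl⟩ : k = 3 ∨ (k = 4 ∧ d = 2) := by omega
    · rcases hy with rfl | rfl | ⟨hd, rfl⟩ | ⟨x, hx, rfl⟩
      · exact Or.inr (Or.inl hookGen_three_none)
      · exact Or.inl hookGen_three_true
      · exact Or.inr (Or.inr (Or.inl ⟨hd, hookGen_three_inr (by simp)⟩))
      · exact Or.inr (Or.inr (Or.inr ⟨x, hx, hookGen_three_inr (hx0 x hx)⟩))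
    · rcases hy with rfl | rfl | ⟨hd, rfl⟩ | ⟨x, hx, rfl⟩
      · exact Or.inl rfl
      · exact Or.inr (Or.inr (Or.inl ⟨rfl, h.apply_zero true⟩))
      · exact Or.inr (Or.inl (h.apply_one false))
      · exact Or.inr (Or.inr (Or.inr ⟨(x.1, !x.2), hx, h.apply_one_far hx⟩))
  · have hk : k < 3 := by omega
    rcases hy with rfl | rfl | ⟨hd, rfl⟩ | ⟨x, hx, rfl⟩
    · exact hookGen_none hk
    all_goals exact hookGen_inr hk _

theorem notMem_hookSide {d : ℕ} (hd : d = 1 ∨ d = 2) {x : Fin (m + 3) × Bool}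
    (hx : Sum.inr x ∉ hookSide m d) : x = (0, false) ∨ (d = 2 ∧ x = (1, true)) := by
  have h1 : x ≠ (0, true) := fun e => hx (Or.inr (Or.inl (by rw [e])))
  have h2 : ¬ (d = 2 ∧ x = (1, false)) := fun e => hx (Or.inr (Or.inr (Or.inl ⟨e.1, by rw [e.2]⟩)))
  have h3 : ¬ d ≤ (x.1 : ℕ) := fun e => hx (Or.inr (Or.inr (Or.inr ⟨x, e, rfl⟩)))
  rcases cases_col x with hx2 | rfl | rfl | rfl | rfl
  · omega
  · exact Or.inl rfl
  · exact absurd rfl h1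
  · rcases hd with rfl | rfl
    · simp at h3
    · exact absurd ⟨rfl, rfl⟩ h2
  · rcases hd with rfl | rfl
    · simp at h3
    · exact Or.inr ⟨rfl, rfl⟩

theorem hook_inter_two (hm : Odd m) {d : ℕ} (hd : d = 1 ∨ d = 2) :
    itv (hookGen m) 2 (3 + d) ⊓ itv (hookGen m) 3 (3 + d + 1) ≤ itv (hookGen m) 3 (3 + d) := by
  intro g hg
  obtain ⟨hg1, hg2⟩ := Subgroup.mem_inf.1 hg
  obtain ⟨q, hq, hgq⟩ := (actsBy_hookSide hm hd).exists_agree hg1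
  have hn := Subgroup.mul_mem _ (Subgroup.inv_mem _
    (itv_mono (ρ := hookGen m) le_rfl (Nat.le_succ _) hq)) hg2
  have hf : ∀ y ∈ hookSide m d, (q⁻¹ * g) y = y := fun y hy => by
    rw [Perm.mul_apply, Perm.inv_eq_iff_eq, hgq y hy]
  have hf' : ∀ y ∈ hookSide m d, (q⁻¹ * g) (hookFlip m y) = hookFlip m y := fun y hy => by
    rw [apply_hookFlip le_rfl hn, hf y hy]
  suffices q⁻¹ * g = 1 by
    rw [inv_mul_eq_one] at this
    exact this ▸ hq
  refine Equiv.ext fun y => ?_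
  rcases y with (_ | p) | x
  · exact hf _ (Or.inl rfl)
  · by_cases hp : p = 0
    · subst hp
      exact hf' (Sum.inl none) (Or.inl rfl)
    · exact apply_hook_some le_rfl hn hp
  · by_cases hx : Sum.inr x ∈ hookSide m d
    · exact hf _ hx
    · obtain rfl | ⟨h2, rfl⟩ := notMem_hookSide hd hx
      · exact hf' (Sum.inr (0, true)) (Or.inr (Or.inl rfl))
      · exact hf' (Sum.inr (1, false)) (Or.inr (Or.inr (Or.inl ⟨h2, rfl⟩)))

theorem hookHex_mapsTo {i k : ℕ} (hi : i < 2) (h1 : i + 1 ≤ k) (h2 : k < 3) (p : Fin 6)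
    (hp : 3 ≤ i + (p : ℕ)) : 3 ≤ i + (hookHex k p : ℕ) :=
  (by decide +kernel : ∀ i : Fin 2, ∀ k : Fin 3, (i : ℕ) + 1 ≤ k → ∀ p : Fin 6,
    3 ≤ (i : ℕ) + p → 3 ≤ (i : ℕ) + (hookHex k p : ℕ)) ⟨i, hi⟩ ⟨k, h2⟩ h1 p hp

theorem exists_hook (hm : Odd m) :
    StringCGen (alternatingGroup (Option (Fin 6) ⊕ Fin (m + 3) × Bool)) (m + 6) := by
  have h := tail_hookGen hm
  set ρ := hookGen m with hρ
  have s2 : ∀ i, ρ 2 (Sum.inl (some i)) = Sum.inl (some (hookHex 2 i)) := hookGen_some (by omega)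
  have hcyc : ρ 2 * ρ 3 * (ρ 2 * ρ 3) =
      cyc (Sum.inl (some 0)) (Sum.inl (some 1)) (Sum.inr (0, false)) := by
    have e0 : ρ 2 (Sum.inl (some 0)) = Sum.inl (some 1) := s2 0
    have e1 : ρ 2 (Sum.inl (some 1)) = Sum.inl (some 0) := s2 1
    have f0 : ∀ x, ρ 2 (Sum.inr x) = Sum.inr x := hookGen_inr (by omega)
    have f1 : ρ 2 (Sum.inl none) = Sum.inl none := hookGen_none (by omega)
    have f3 : ∀ i : Fin 6, i ≠ 0 → ρ 3 (Sum.inl (some i)) = Sum.inl (some i) := fun i hi =>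
      hookGen_three_some hi
    have t : ρ 3 (Sum.inl none) = Sum.inr (0, true) := hookGen_three_none
    have t' : ρ 3 (Sum.inr (0, true)) = Sum.inl none := hookGen_three_true
    have u : ρ 3 (Sum.inl (some 0)) = Sum.inr (0, false) := hookGen_three_zero
    have u' : ρ 3 (Sum.inr (0, false)) = Sum.inl (some 0) := hookGen_three_false
    refine Equiv.ext fun y => ?_
    simp only [Perm.mul_apply _ (ρ 3), Perm.mul_apply (ρ 2 * ρ 3)]
    rcases y with (_ | i) | x
    · rw [t, f0, t', f1, cyc_apply_of_ne (by simp) (by simp) (by simp)]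
    · by_cases hi : i = 0
      · rw [hi, u, f0, u', e0, cyc_apply_left (by simp) (by simp)]
      by_cases hi1 : i = 1
      · rw [hi1, f3 1 (by decide), e1, u, f0, cyc_apply_mid (by simp) (by simp)]
      have := (by decide +kernel : ∀ i, i ≠ 0 → i ≠ 1 → hookHex 2 i ≠ 0 ∧ 
        hookHex 2 (hookHex 2 i) = i) i hi hi1
      rw [f3 i hi, s2, f3 _ this.1, s2, this.2, cyc_apply_of_ne (by simpa) (by simpa) (by simp)]
    · by_cases hx : x.1 = 0
      · obtain ⟨c, b⟩ := x
        obtain rfl : c = 0 := hx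
        cases b
        · rw [u', e0, f3 1 (by decide), e1, cyc_apply_right]
        · rw [t', f1, t, f0, cyc_apply_of_ne (by simp) (by simp) (by simp)]
      · have : ρ 3 (Sum.inr x) = Sum.inr x := hookGen_three_inr hx
        rw [this, f0, this, f0, cyc_apply_of_ne (by simp) (by simp) fun e => hx (by
          rw [Sum.inr.inj e])]
  have m2 : ρ 2 ∈ itv ρ 2 4 := mem_itv (by omega) (by omega)
  have m3 : ρ 3 ∈ itv ρ 2 4 := mem_itv (by omega) (by omega)
  have mc : cyc (Sum.inl (some 0)) (Sum.inl (some 1)) (Sum.inr (0, false)) ∈ itv ρ 2 4 :=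
    hcyc ▸ Subgroup.mul_mem _ (Subgroup.mul_mem _ m2 m3) (Subgroup.mul_mem _ m2 m3)
  have lz : Linked (itv ρ 2 4) (Sum.inr (0, false)) (Sum.inl (some 1)) :=
    (Linked.of_cyc' (by simp) (by simp) (by simp) mc).symm
  have ly : Linked (itv ρ 2 4) (Sum.inr (0, false)) (Sum.inl (some 0)) :=
    lz.trans (Linked.of_cyc (by simp) (by simp) (by simp) mc).symm
  have lu : Linked (itv ρ 1 4) (Sum.inr (0, false)) (Sum.inl (some 2)) := by
    have := (ly.symm.trans lz).mono (itv_mono (k := 1) (by omega) le_rfl)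
    exact (ly.mono (itv_mono (by omega) le_rfl)).trans
      (this.map (mem_itv (k := 1) le_rfl (by omega)))
  have lc : Linked (itv ρ 2 5) (Sum.inr (0, false)) (Sum.inr (1, true)) := by
    have := (lz.mono (itv_mono (ρ := ρ) le_rfl (show 4 ≤ 5 by omega))).map
      (mem_itv (k := 4) (by omega) (by omega))
    rw [h.apply_zero] at this
    exact (lz.mono (itv_mono le_rfl (by omega))).trans this.symm
  have lcols : ∀ i ≤ 2, ∀ x : Fin (m + 3) × Bool, (x.1 : ℕ) < 2 →
      Linked (itv ρ i (3 + 3)) (Sum.inr (0, false)) (Sum.inr x) := fun i hi =>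
    h.linked_cols (by omega) (lc.mono (itv_mono hi (by omega)))
  have lx : Linked (itv ρ 2 6) (Sum.inr (0, false)) (Sum.inl none) := by
    have := (lcols 2 le_rfl (0, true) (by simp)).map
      (mem_itv (ρ := ρ) (k := 3) (by omega) (by omega))
    rw [show ρ 3 (Sum.inr (0, true)) = _ from hookGen_three_true,
      show ρ 3 (Sum.inr (0, false)) = _ from hookGen_three_false] at this
    exact (ly.mono (itv_mono le_rfl (by omega))).trans this
  have lnear : ∀ i < 2, ∀ p : Fin 6, ¬ 3 ≤ i + (p : ℕ) →
      Linked (itv ρ (i + 1) 4) (Sum.inr (0, false)) (Sum.inl (some p)) := by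
    intro i hi p hp
    obtain rfl | rfl | ⟨rfl, rfl⟩ : p = 0 ∨ p = 1 ∨ (p = 2 ∧ i = 0) := by omega
    · exact ly.mono (itv_mono (by omega) le_rfl)
    · exact lz.mono (itv_mono (by omega) le_rfl)
    · exact lu
  rw [show m + 6 = 3 + (m + 3) by omega]
  refine (h.stringCGen (h.isStringC fun i hi j hij hj => ?_) ?_ (lcols 0 (by omega))).1
  · obtain rfl | hj2 | hj3 : j = i + 1 ∨ (i + 2 ≤ j ∧ j ≤ 3) ∨ (i + 2 ≤ j ∧ 4 ≤ j) := by omega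
    · refine inter_pair (h.sq i (by omega)) (h.sq (i + 1) (by omega)) fun e => ?_
      obtain hi' | rfl : i < 2 ∨ i = 2 := by omega
      · have := congrArg (fun f => f (Sum.inl (some 1))) e
        simp only [hρ] at this
        rw [hookGen_some (by omega), hookGen_some (by omega)] at this
        exact (by decide +kernel : ∀ i : Fin 2, hookHex i 1 ≠ hookHex ((i : ℕ) + 1) 1) ⟨i, hi'⟩
          (by simpa using this)
      · have := congrArg (fun f => f (Sum.inl none)) e
        simp only [hρ] at this
        rw [hookGen_none (by omega), hookGen_three_none] at this
        simp at this
    · exact hookGen_inter hj2.1 hj2.2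
    · obtain ⟨d, rfl⟩ : ∃ d, j = 3 + d := ⟨j - 3, by omega⟩
      obtain hi' | rfl : i < 2 ∨ i = 2 := by omega
      · obtain hd | hd : (d = 1 ∨ d = 2) ∨ 3 ≤ d := by omega
        · refine inter_of_actsBy (fun k _ hk => h.sign_eq (by omega)) (actsBy_hookSide hm hd)
            (a' := i + 1) (b' := 3) (S' := {y | ∃ p : Fin 6, 3 ≤ i + (p : ℕ) ∧ y = Sum.inl (some p)})
            ⟨?_, ?_⟩ (by omega) le_rfl le_rfl (by omega) ?_ ?_ (x₀ := Sum.inr (0, false)) ?_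
          · rintro k h1 h2 _ ⟨p, hp, rfl⟩
            exact ⟨_, hookHex_mapsTo hi' h1 h2 p hp, hookGen_some h2 p⟩
          · rintro k h1 h2 h3 _ ⟨p, hp, rfl⟩
            exact apply_hook_some (i := 3) (j := k + 1) le_rfl (mem_itv (by omega) (by omega))
              (by rintro rfl; simp at hp; omega)
          · rintro k h1 h2 _ ⟨p, hp, rfl⟩
            exact apply_hook_some (i := 3) (j := k + 1) le_rfl (mem_itv (by omega) (by omega))
              (by rintro rfl; simp at hp; omega)
          · exact fun k h1 h2 => (actsBy_hookSide (i := i) hm hd).fix k (by omega) (by omega)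
              (by omega)
          · rintro ((_ | p) | x) h1 h2
            · exact absurd (Or.inl rfl) h1
            · exact (lnear i hi' p fun hp => h2 ⟨p, hp, rfl⟩).mono (itv_mono le_rfl (by omega))
            · obtain rfl | ⟨rfl, rfl⟩ := notMem_hookSide hd h1
              · exact Or.inl rfl
              · exact lc.mono (itv_mono (by omega) (by omega))
        · refine h.inter_far (by omega) hd (by omega) {q | ∃ p : Fin 6, 3 ≤ i + (p : ℕ) ∧ q = some p}
            (fun _ _ => rfl) ?_ ?_ (lcols (i + 1) (by omega))
          · rintro k h1 h2 _ ⟨p, hp, rfl⟩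
            rcases h2.lt_or_eq with h2 | rfl
            · exact ⟨_, ⟨_, hookHex_mapsTo hi' h1 h2 p hp, rfl⟩, hookGen_some h2 p⟩
            · exact ⟨_, ⟨_, hp, rfl⟩, hookGen_three_some (by rintro rfl; simp at hp; omega)⟩
          · rintro (_ | p) hp
            · exact lx.mono (itv_mono (by omega) le_rfl)
            · exact (lnear i hi' p fun hp' => hp ⟨p, hp', rfl⟩).mono (itv_mono le_rfl (by omega))
      · obtain hd | hd : (d = 1 ∨ d = 2) ∨ 3 ≤ d := by omega
        · exact hook_inter_two hm hd
        · exact hook_inter_far hm hd (by omega)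
  · have l4 : ∀ p : Fin 6, Linked (itv ρ 0 4) (Sum.inr (0, false)) (Sum.inl (some p)) := by
      have ly' := ly.mono (itv_mono (ρ := ρ) (show 0 ≤ 2 by omega) (le_refl 4))
      have step : ∀ k < 2, ∀ p, Linked (itv ρ 0 4) (Sum.inr (0, false)) (Sum.inl (some p)) →
          Linked (itv ρ 0 4) (Sum.inr (0, false)) (Sum.inl (some (hookHex k p))) := by
        intro k hk p hp
        have := (ly'.symm.trans hp).map (mem_itv (k := k) (by omega) (by omega))
        simp only [hρ] at this
        rw [hookGen_some (by omega), hookGen_some (by omega),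
          (by decide +kernel : ∀ k : Fin 2, hookHex k 0 = 0) ⟨k, hk⟩] at this
        exact ly'.trans this
      have l1 := lz.mono (itv_mono (ρ := ρ) (show 0 ≤ 2 by omega) (le_refl 4))
      have l2 := lu.mono (itv_mono (ρ := ρ) (show 0 ≤ 1 by omega) (le_refl 4))
      have l3 := step 0 (by omega) 2 l2
      have l4 := step 1 (by omega) 3 l3
      have l5 := step 0 (by omega) 4 l4
      intro p
      fin_cases p
      exacts [ly', l1, l2, l3, l4, l5]
    rintro (_ | p)
    · exact lx.mono (itv_mono (by omega) (by omega))
    · exact (l4 p).mono (itv_mono le_rfl (by omega))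

end Hook

section Words

variable {G : Type*} [Group G] {α : Type*} [DecidableEq α]

/-- The product of the generators indexed by the letters of a word. -/
def wordProd (ρ : ℕ → G) (l : List ℕ) : G := (l.map ρ).prod

theorem wordProd_mem {ρ : ℕ → G} {i j : ℕ} {l : List ℕ} (h : ∀ k ∈ l, i ≤ k ∧ k < j) :
    wordProd ρ l ∈ itv ρ i j :=
  Subgroup.list_prod_mem _ fun x hx => by
    obtain ⟨k, hk, rfl⟩ := List.mem_map.1 hx
    exact mem_itv (h k hk).1 (h k hk).2

/-- The points that are joined to `a` by images of the pair `{a, b}` under the given words. -/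
def wordReach (ρ : ℕ → Perm α) (a b : α) : List (List ℕ) → List α
  | [] => [a]
  | w :: W =>
    if wordProd ρ w a ∈ wordReach ρ a b W ∨ wordProd ρ w b ∈ wordReach ρ a b W then
      wordProd ρ w a :: wordProd ρ w b :: wordReach ρ a b W
    else wordReach ρ a b W

theorem linked_of_mem_wordReach {ρ : ℕ → Perm α} {H : Subgroup (Perm α)} {a b : α}
    (hab : Linked H a b) : ∀ {W : List (List ℕ)}, (∀ w ∈ W, wordProd ρ w ∈ H) →
      ∀ x ∈ wordReach ρ a b W, Linked H a x
  | [], _, x, hx => Or.inl (List.mem_singleton.1 hx).symm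
  | w :: W, hW, x, hx => by
    have ih := linked_of_mem_wordReach hab fun v hv => hW v (List.mem_cons_of_mem _ hv)
    have hw := hab.map (hW w List.mem_cons_self)
    rw [wordReach] at hx
    split_ifs at hx with h
    · have h2 : Linked H a (wordProd ρ w a) ∧ Linked H a (wordProd ρ w b) :=
        h.elim (fun h => ⟨ih _ h, (ih _ h).trans hw⟩) fun h => ⟨(ih _ h).trans hw.symm, ih _ h⟩
      rcases List.mem_cons.1 hx with rfl | hx
      · exact h2.1
      rcases List.mem_cons.1 hx with rfl | hx
      · exact h2.2
      · exact ih x hx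
    · exact ih x hx

theorem itv_eq_alternatingGroup [Fintype α] {ρ : ℕ → Perm α} {r n : ℕ} {a b c : α}
    (hn : a ≠ b ∧ a ≠ c ∧ b ≠ c) {w : List ℕ} {W : List (List ℕ)}
    (hw : wordProd ρ w ^ n = cyc a b c) (hr : ∀ v ∈ w :: W, ∀ k ∈ v, k < r)
    (hW : ∀ x, x ∈ wordReach ρ a b W) (hs : ∀ k < r, sign (ρ k) = 1) :
    itv ρ 0 r = alternatingGroup α := by
  have hm : ∀ v ∈ w :: W, wordProd ρ v ∈ itv ρ 0 r := fun v hv =>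
    wordProd_mem fun k hk => ⟨Nat.zero_le _, hr v hv k hk⟩
  have h := Linked.of_cyc hn.1 hn.2.1 hn.2.2
    (hw ▸ Subgroup.pow_mem _ (hm w List.mem_cons_self) n)
  exact eq_alternatingGroup (fun x => linked_of_mem_wordReach h
    (fun v hv => hm v (List.mem_cons_of_mem _ hv)) x (hW x))
    (itv_le fun k _ hk => mem_alternatingGroup.2 (hs k hk))

end Words

/-- If the stabilizer of the point `x₀` in a subgroup is generated by elements of `H`, as Schreier's
lemma verifies from a transversal `t`, then it is contained in `H`. -/
theorem mem_of_transversal {α : Type*} [Finite α] {ρ : ℕ → Perm α} {i j : ℕ} {H : Subgroup (Perm α)} {S : Set α}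
    (t : α → Perm α) {x₀ : α} (h₀ : x₀ ∈ S) (ht : t x₀ = 1)
    (h : ∀ k, i ≤ k → k < j → ∀ x ∈ S, ρ k x ∈ S ∧ (t (ρ k x))⁻¹ * ρ k * t x ∈ H)
    {g : Perm α} (hg : g ∈ itv ρ i j) (hx : g x₀ = x₀) : g ∈ H := by
  have key : ∀ f ∈ itv ρ i j, ∀ x ∈ S, f x ∈ S ∧ (t (f x))⁻¹ * f * t x ∈ H := by
    intro f hf
    induction hf using Subgroup.closure_induction with
    | mem f hf =>
      obtain ⟨k, hk, rfl⟩ := hf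
      exact h k hk.1 hk.2
    | one => exact fun x hx => ⟨hx, by simp⟩
    | mul f f' _ _ h1 h2 =>
      intro x hx
      obtain ⟨h3, h4⟩ := h2 x hx
      obtain ⟨h5, h6⟩ := h1 _ h3
      refine ⟨h5, ?_⟩
      have := Subgroup.mul_mem _ h6 h4
      rwa [show (t (f (f' x)))⁻¹ * f * t (f' x) * ((t (f' x))⁻¹ * f' * t x) =
        (t (f (f' x)))⁻¹ * (f * f') * t x by group] at this
    | inv f hf h1 =>
      intro x hx
      have hS : ∀ x ∈ S, f⁻¹ x ∈ S := fun x hx =>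
        mapsTo_itv (fun k h2 h3 y hy => (h k h2 h3 y hy).1) (Subgroup.inv_mem _ hf) hx
      obtain ⟨-, h4⟩ := h1 _ (hS x hx)
      refine ⟨hS x hx, ?_⟩
      have := Subgroup.inv_mem _ h4
      rw [show f (f⁻¹ x) = x from f.apply_symm_apply x] at this
      rwa [show ((t x)⁻¹ * f * t (f⁻¹ x))⁻¹ = (t (f⁻¹ x))⁻¹ * f⁻¹ * t x by group] at this
  have := (key g hg x₀ h₀).2
  rwa [hx, ht, inv_one, one_mul, mul_one] at this

/-- Consecutive dihedral subgroups meet in the common generator if their rotations are distinct. -/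
theorem inter_dihedral {G : Type*} [Group G] {ρ : ℕ → G} {i : ℕ} {N N' : ℕ} [NeZero N] [NeZero N']
    (h0 : ρ i * ρ i = 1) (h1 : ρ (i + 1) * ρ (i + 1) = 1) (h2 : ρ (i + 2) * ρ (i + 2) = 1)
    (hN : (ρ i * ρ (i + 1)) ^ N = 1) (hN' : (ρ (i + 2) * ρ (i + 1)) ^ N' = 1)
    (h : ∀ (n : Fin N) (n' : Fin N'), n ≠ 0 →
      (ρ i * ρ (i + 1)) ^ (n : ℕ) ≠ (ρ (i + 2) * ρ (i + 1)) ^ (n' : ℕ) ∧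
      (ρ i * ρ (i + 1)) ^ (n : ℕ) ≠ (ρ (i + 2) * ρ (i + 1)) ^ (n' : ℕ) * ρ (i + 1)) :
    itv ρ i (i + 2) ⊓ itv ρ (i + 1) (i + 1 + 2) ≤ itv ρ (i + 1) (i + 2) := by
  have hz : ∀ {N : ℕ} [NeZero N] {a : G}, a ^ N = 1 → ∀ z : ℤ, ∃ n : Fin N, a ^ z = a ^ (n : ℕ) := by
    intro N _ a ha z
    have hN0 : (0 : ℤ) < N := by exact_mod_cast Nat.pos_of_ne_zero (NeZero.ne N)
    refine ⟨⟨(z % N).toNat, ?_⟩, ?_⟩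
    · have := Int.emod_lt_of_pos z hN0
      have := Int.emod_nonneg z hN0.ne'
      omega
    · rw [← zpow_natCast, Int.toNat_of_nonneg (Int.emod_nonneg z hN0.ne')]
      conv_lhs => rw [← Int.emod_add_mul_ediv z N, zpow_add, zpow_mul, zpow_natCast, ha, one_zpow,
        mul_one]
  have hb : ρ (i + 1) ∈ itv ρ (i + 1) (i + 2) := mem_itv le_rfl (by omega)
  have e1 : itv ρ i (i + 2) ≤ Subgroup.closure {ρ i, ρ (i + 1)} := itv_le fun k h1 h2 =>
    Subgroup.subset_closure (by obtain rfl | rfl : k = i ∨ k = i + 1 := by omega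
                                all_goals simp)
  have e2 : itv ρ (i + 1) (i + 1 + 2) ≤ Subgroup.closure {ρ (i + 2), ρ (i + 1)} :=
    itv_le fun k h1 h2 =>
      Subgroup.subset_closure (by obtain rfl | rfl : k = i + 1 ∨ k = i + 2 := by omega
                                  all_goals simp)
  have key : ∀ z : ℤ, (ρ i * ρ (i + 1)) ^ z ∈ itv ρ (i + 1) (i + 1 + 2) →
      (ρ i * ρ (i + 1)) ^ z = 1 := by
    intro z hg
    obtain ⟨n, hn⟩ := hz hN z
    by_contra hne
    have hn0 : n ≠ 0 := fun e => hne (by rw [hn, e]; simp)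
    obtain ⟨z', h3 | h3⟩ := mem_closure_pair_dihedral h2 h1 (e2 hg)
    all_goals
      obtain ⟨n', hn'⟩ := hz hN' z'
      rw [hn, hn'] at h3
    · exact (h n n' hn0).1 h3
    · exact (h n n' hn0).2 h3
  intro g hg
  obtain ⟨hg1, hg2⟩ := Subgroup.mem_inf.1 hg
  obtain ⟨z, rfl | rfl⟩ := mem_closure_pair_dihedral h0 h1 (e1 hg1)
  · rw [key z hg2]; exact Subgroup.one_mem _
  · rw [key z ((Subgroup.mul_mem_cancel_right _ (itv_mono le_rfl (by omega) hb)).1 hg2), one_mul]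
    exact hb

/-- Generators of rank three for the alternating group on twelve points. -/
def dozenThree : ℕ → Perm (Fin 12)
  | 0 => swap 0 7 * swap 1 4 * swap 3 6 * swap 5 8
  | 1 => swap 0 5 * swap 1 8 * swap 2 11 * swap 3 9
  | _ => swap 0 6 * swap 2 9 * swap 3 7 * swap 10 11

theorem stringCGen_dozenThree : StringCGen (alternatingGroup (Fin 12)) 3 := by
  have hsq : ∀ k < 3, dozenThree k * dozenThree k = 1 := by decide +kernel
  have hne : ∀ k < 3, dozenThree k ≠ 1 := by decide +kernel
  refine ⟨dozenThree, ⟨hsq, hne, ?_, ?_⟩, ?_⟩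
  · intro i j hij hj
    obtain ⟨rfl, rfl⟩ : i = 0 ∧ j = 2 := by omega
    exact (by decide +kernel : dozenThree 0 * dozenThree 2 = dozenThree 2 * dozenThree 0)
  · intro i j hij hj
    obtain ⟨rfl, rfl⟩ | ⟨rfl, rfl⟩ | ⟨rfl, rfl⟩ :
      (i = 0 ∧ j = 1) ∨ (i = 0 ∧ j = 2) ∨ (i = 1 ∧ j = 2) := by omega
    · exact inter_pair (hsq 0 (by omega)) (hsq 1 (by omega)) (by decide +kernel)
    · exact inter_dihedral (i := 0) (N := 6) (N' := 6) (hsq 0 (by omega)) (hsq 1 (by omega))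
        (hsq 2 (by omega)) (by decide +kernel) (by decide +kernel) (by decide +kernel)
    · exact inter_pair (hsq 1 (by omega)) (hsq 2 (by omega)) (by decide +kernel)
  · exact itv_eq_alternatingGroup (a := 0) (b := 7) (c := 9) (n := 10) (w := [0, 1, 2, 1])
      (W := [[2, 1, 2, 1, 2], [1, 2, 1, 2], [0, 1, 0, 1], [2, 1, 2], [1, 0, 1], [1, 2], [2], [2, 1],
        [0, 1], [1], []]) (by decide) (by decide +kernel) (by decide) (by decide +kernel)
      (by decide +kernel)

/-- Generators of rank four for the alternating group on twelve points. -/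
def dozenFour : ℕ → Perm (Fin 12)
  | 0 => swap 1 8 * swap 2 6 * swap 3 11 * swap 4 10
  | 1 => swap 0 2 * swap 1 4 * swap 6 7 * swap 10 11
  | 2 => swap 1 8 * swap 2 4 * swap 5 7 * swap 6 10
  | _ => swap 0 7 * swap 1 11 * swap 2 6 * swap 3 8 * swap 4 10 * swap 5 9

/-- Words in the last three generators that map the point `9` to each point. -/
def dozenWord : Fin 12 → List ℕ := 
  ![[3, 2, 3], [3, 1, 2, 1, 2, 3], [3, 1, 2, 3], [3, 2, 3, 1, 2, 1, 2, 3], [3, 2, 1, 2, 3], [3], [1, 2, 3], [2, 3], [2, 3, 1, 2, 1, 2, 3], [], [2, 1, 2, 3], [1, 2, 1, 2, 3]]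

theorem dozenFour_inter : itv dozenFour 0 3 ⊓ itv dozenFour 1 4 ≤ itv dozenFour 1 3 := by
  intro g hg
  obtain ⟨hg1, hg2⟩ := Subgroup.mem_inf.1 hg
  have h9 : g 9 = 9 := fix_itv
    (fun k _ hk => (by decide +kernel : ∀ k < 3, dozenFour k 9 = 9) k hk) hg1
  refine mem_of_transversal (fun x => wordProd dozenFour (dozenWord x)) (S := Set.univ) trivial rfl
    (fun k h1 h2 x _ => ⟨trivial, ?_⟩) hg2 h9
  have hm : ∀ e < 2, ∀ n : ℕ, (dozenFour 1 * dozenFour 2) ^ n * dozenFour 1 ^ e ∈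
      itv dozenFour 1 3 := fun e _ n =>
    Subgroup.mul_mem _ (Subgroup.pow_mem _ (Subgroup.mul_mem _ (mem_itv le_rfl (by omega))
      (mem_itv (by omega) (by omega))) n) (Subgroup.pow_mem _ (mem_itv le_rfl (by omega)) e)
  obtain ⟨n, -, e, he, h⟩ := (by decide +kernel : ∀ k < 4, 1 ≤ k → ∀ x, ∃ n < 5, ∃ e < 2,
    (wordProd dozenFour (dozenWord (dozenFour k x)))⁻¹ * dozenFour k *
      wordProd dozenFour (dozenWord x) = (dozenFour 1 * dozenFour 2) ^ n * dozenFour 1 ^ e)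
    k h2 h1 x
  rw [h]
  exact hm e he n

theorem stringCGen_dozenFour : StringCGen (alternatingGroup (Fin 12)) 4 := by
  have hsq : ∀ k < 4, dozenFour k * dozenFour k = 1 := by decide +kernel
  have hne : ∀ k < 4, dozenFour k ≠ 1 := by decide +kernel
  refine ⟨dozenFour, ⟨hsq, hne, ?_, ?_⟩, ?_⟩
  · intro i j hij hj
    exact (by decide +kernel : ∀ j < 4, ∀ i < 4, i + 1 < j →
      dozenFour i * dozenFour j = dozenFour j * dozenFour i) j hj i (by omega) hij
  · intro i j hij hj
    by_cases h : j = i + 1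
    · subst h
      exact inter_pair (hsq i (by omega)) (hsq _ hj)
        ((by decide +kernel : ∀ i < 3, dozenFour i ≠ dozenFour (i + 1)) i (by omega))
    obtain ⟨rfl, rfl⟩ | ⟨rfl, rfl⟩ | ⟨rfl, rfl⟩ :
      (i = 0 ∧ j = 2) ∨ (i = 1 ∧ j = 3) ∨ (i = 0 ∧ j = 3) := by omega
    · exact inter_dihedral (i := 0) (N := 12) (N' := 5) (hsq 0 (by omega)) (hsq 1 (by omega))
        (hsq 2 (by omega)) (by decide +kernel) (by decide +kernel) (by decide +kernel)
    · exact inter_dihedral (i := 1) (N := 5) (N' := 4) (hsq 1 (by omega)) (hsq 2 (by omega))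
        (hsq 3 (by omega)) (by decide +kernel) (by decide +kernel) (by decide +kernel)
    · exact dozenFour_inter
  · exact itv_eq_alternatingGroup (a := 2) (b := 5) (c := 9) (n := 7) (w := [0, 1, 2, 1, 3])
      (W := [[0, 1, 2, 0], [0, 1, 2], [1, 2, 0], [1, 2], [2, 0], [2], [1, 0], [3], [1], [0], []]) (by decide) (by decide +kernel) (by decide) (by decide +kernel)
      (by decide +kernel)

theorem mem_itv_of_words {α : Type*} [Finite α] {ρ : ℕ → Perm α} {i j i' j' : ℕ} {S : Set α}
    (t : α → List ℕ) (s : ℕ → α → List ℕ) {x₀ : α} (h₀ : x₀ ∈ S) (ht : t x₀ = [])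
    (hS : ∀ k, i ≤ k → k < j → ∀ x ∈ S, ρ k x ∈ S)
    (h : ∀ k, i ≤ k → k < j → ∀ x ∈ S,
      ρ k * wordProd ρ (t x) = wordProd ρ (t (ρ k x)) * wordProd ρ (s k x) ∧
      ∀ l ∈ s k x, i' ≤ l ∧ l < j')
    {g : Perm α} (hg : g ∈ itv ρ i j) (hx : g x₀ = x₀) : g ∈ itv ρ i' j' := by
  refine mem_of_transversal (fun x => wordProd ρ (t x)) h₀ (by simp [ht, wordProd])
    (fun k h1 h2 x hx => ⟨hS k h1 h2 x hx, ?_⟩) hg hx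
  obtain ⟨h3, h4⟩ := h k h1 h2 x hx
  rw [mul_assoc, h3, inv_mul_cancel_left]
  exact wordProd_mem h4

/-- A system of blocks preserved by involutory generators is preserved by the group. -/
theorem exists_block {α : Type*} {ρ : ℕ → Perm α} {i j : ℕ} {L : List (List α)}
    (hsq : ∀ k, i ≤ k → k < j → ρ k * ρ k = 1)
    (h : ∀ k, i ≤ k → k < j → ∀ B ∈ L, ∃ B' ∈ L, ∀ x ∈ B, ρ k x ∈ B') {g : Perm α}
    (hg : g ∈ itv ρ i j) : ∀ B ∈ L, ∃ B' ∈ L, ∀ x ∈ B, g x ∈ B' := by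
  have mul : ∀ {a b : Perm α}, (∀ B ∈ L, ∃ B' ∈ L, ∀ x ∈ B, a x ∈ B') →
      (∀ B ∈ L, ∃ B' ∈ L, ∀ x ∈ B, b x ∈ B') → ∀ B ∈ L, ∃ B' ∈ L, ∀ x ∈ B, (a * b) x ∈ B' := by
    intro a b ha hb B hB
    obtain ⟨B', hB', h1⟩ := hb B hB
    obtain ⟨C, hC, h2⟩ := ha B' hB'
    exact ⟨C, hC, fun x hx => h2 _ (h1 x hx)⟩
  refine (Subgroup.closure_induction (p := fun g _ => (∀ B ∈ L, ∃ B' ∈ L, ∀ x ∈ B, g x ∈ B') ∧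
    ∀ B ∈ L, ∃ B' ∈ L, ∀ x ∈ B, g⁻¹ x ∈ B') ?_ ?_ ?_ (fun a _ ha => ?_) hg).1
  · rintro _ ⟨k, hk, rfl⟩
    rw [inv_eq_of_mul_eq_one_left (hsq k hk.1 hk.2), and_self]
    exact h k hk.1 hk.2
  · rw [inv_one, and_self]
    exact fun B hB => ⟨B, hB, fun _ hx => hx⟩
  · intro a b _ _ ha hb
    rw [mul_inv_rev]
    exact ⟨mul ha.1 hb.1, mul hb.2 ha.2⟩
  · rw [inv_inv]
    exact ha.symm

/-- The action on columns of the last generators of the representation on fifteen points. -/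
def quindecCol : ℕ → Perm (Fin 7)
  | 1 => swap 0 1 * swap 2 3
  | 2 => swap 1 2 * swap 3 4
  | 3 => swap 4 5
  | _ => swap 5 6

theorem quindecCol_inter_one : itv quindecCol 1 4 ⊓ itv quindecCol 2 5 ≤ itv quindecCol 2 4 := by
  intro g hg
  obtain ⟨hg1, hg2⟩ := Subgroup.mem_inf.1 hg
  have h6 : g 6 = 6 := fix_itv
    (fun k h1 h2 => (by decide +kernel : ∀ k < 4, 1 ≤ k → quindecCol k 6 = 6) k h2 h1) hg1
  refine mem_itv_of_words (S := {x | 3 ≤ x}) ![[], [], [], [2, 3, 4], [3, 4], [4], []]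
    (fun k => match k with
      | 2 => ![[], [], [], [], [], [2], [2]]
      | 3 => ![[], [], [], [3, 2, 3, 2, 3], [], [], [3]]
      | _ => ![[], [], [], [3], [3], [], []]) (x₀ := 6) (by simp) rfl (fun k h1 h2 => ?_)
    (fun k h1 h2 => ?_) hg2 h6
  all_goals obtain rfl | rfl | rfl : k = 2 ∨ k = 3 ∨ k = 4 := by omega
  all_goals simp only [Set.mem_ofPred_eq]; decide +kernel

theorem mem_quindecCol {g : Perm (Fin 7)} (hg : g ∈ itv quindecCol 1 5) (h6 : g 6 = 6) :
    g ∈ itv quindecCol 1 4 := by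
  refine mem_itv_of_words (S := Set.univ) ![[1, 2, 1, 2, 3, 4], [2, 1, 2, 3, 4], [1, 2, 3, 4],
    [2, 3, 4], [3, 4], [4], []]
    (fun k => match k with
      | 1 => ![[], [], [], [], [1], [1], [1]]
      | 2 => ![[1], [], [], [], [], [2], [2]]
      | 3 => ![[3, 2, 1, 2, 3, 2, 1, 2, 3], [3, 2, 1, 2, 3, 2, 1, 2, 3], [3, 2, 3, 2, 3],
          [3, 2, 3, 2, 3], [], [], [3]]
      | _ => ![[3], [3], [3], [3], [3], [], []]) (x₀ := 6) trivial rfl (fun _ _ _ _ _ => trivial)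
    (fun k h1 h2 x _ => ?_) hg h6
  revert x
  obtain rfl | rfl | rfl | rfl : k = 1 ∨ k = 2 ∨ k = 3 ∨ k = 4 := by omega
  all_goals decide +kernel

/-- Permutations of the columns acting on two rows and a fixed point. -/
def quindecHom : Perm (Fin 7) →* Perm (Option (Fin 7 × Bool)) where
  toFun d := optionCongr (colHom 7 d)
  map_one' := by ext x : 1; cases x <;> simp
  map_mul' d e := by ext x : 1; cases x <;> simp

theorem quindecHom_some (d : Perm (Fin 7)) (c : Fin 7) (b : Bool) :
    quindecHom d (some (c, b)) = some (d c, b) := rfl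

theorem quindecHom_injective : Function.Injective quindecHom := fun d e h => by
  ext c : 1
  have := congrArg (fun f : Perm (Option (Fin 7 × Bool)) => f (some (c, false))) h
  simpa [quindecHom_some] using this

/-- Generators of rank five for the alternating group on fifteen points. -/
def quindec : ℕ → Perm (Option (Fin 7 × Bool))
  | 0 => swap (some (1, false)) (some (2, false)) * swap (some (0, true)) none *
      swap (some (3, false)) (some (3, true)) * swap (some (4, false)) (some (4, true)) *
      swap (some (5, false)) (some (5, true)) * swap (some (6, false)) (some (6, true))
  | k + 1 => quindecHom (quindecCol (k + 1))

theorem quindecHom_col {i : ℕ} (hi : 1 ≤ i) {j : ℕ} : ∀ k, i ≤ k → k < j →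
    quindecHom (quindecCol k) = quindec k := fun k h1 _ => by
  obtain ⟨k, rfl⟩ : ∃ l, k = l + 1 := ⟨k - 1, by omega⟩
  rfl

/-- The blocks of a biplane preserved by the first three generators. -/
def quindecBlocks : List (List (Option (Fin 7 × Bool))) := [
  [some (0, false), some (1, false), some (4, false), some (0, true), some (1, true)],
  [some (0, false), some (1, false), some (2, true), some (3, true), none],
  [some (0, false), some (2, false), some (3, false), some (0, true), some (2, true)],
  [some (0, false), some (2, false), some (1, true), some (4, true), none],
  [some (0, false), some (3, false), some (4, false), some (3, true), some (4, true)],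
  [some (1, false), some (2, false), some (3, false), some (1, true), some (3, true)],
  [some (1, false), some (2, false), some (4, false), some (2, true), some (4, true)],
  [some (1, false), some (3, false), some (0, true), some (4, true), none],
  [some (2, false), some (4, false), some (0, true), some (3, true), none],
  [some (3, false), some (4, false), some (1, true), some (2, true), none],
  [some (0, true), some (1, true), some (2, true), some (3, true), some (4, true)]]

/-- The edges of a pentagon. -/
def quindecEdge (u v : Fin 7) : Prop :=
  (u, v) ∈ [(0, 1), (1, 0), (1, 3), (3, 1), (3, 4), (4, 3), (4, 2), (2, 4), (2, 0), (0, 2)]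

instance (u v : Fin 7) : Decidable (quindecEdge u v) :=
  inferInstanceAs (Decidable ((u, v) ∈ [_, _, _, _, _, _, _, _, _, _]))

theorem quindecEdge_map {d : Perm (Fin 7)} (hd : quindecHom d ∈ itv quindec 0 3) {u v : Fin 7}
    (h : quindecEdge u v) : quindecEdge (d u) (d v) := by
  obtain ⟨B, hB, hn, hu, hv⟩ := (by decide +kernel : ∀ u v, quindecEdge u v → ∃ B ∈ quindecBlocks,
    none ∈ B ∧ some (u, false) ∈ B ∧ some (v, false) ∈ B) u v h
  have hne := (by decide +kernel : ∀ u v, quindecEdge u v → u ≠ v) u v h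
  obtain ⟨B', hB', hmem⟩ := exists_block (fun k _ hk => (by decide +kernel : ∀ k : Fin 3,
    quindec k * quindec k = 1) ⟨k, hk⟩) (fun k _ hk => (by decide +kernel : ∀ k : Fin 3,
    ∀ B ∈ quindecBlocks, ∃ B' ∈ quindecBlocks, ∀ x ∈ B, quindec k x ∈ B') ⟨k, hk⟩) hd B hB
  exact (by decide +kernel : ∀ B ∈ quindecBlocks, none ∈ B → ∀ u v, some (u, false) ∈ B →
    some (v, false) ∈ B → u ≠ v → quindecEdge u v) B' hB' (hmem _ hn) _ _ (hmem _ hu) (hmem _ hv)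
    (d.injective.ne hne)

theorem quindec_inter_zero {d : Perm (Fin 7)} (h5 : d 5 = 5) (h6 : d 6 = 6)
    (h : ∀ u v, quindecEdge u v → quindecEdge (d u) (d v)) : d ∈ itv quindecCol 1 3 := by
  have hd : ∀ {x y}, x ≠ y → d x ≠ d y := fun h => d.injective.ne h
  obtain ⟨n, e, h0, h1, h2, h3, h4⟩ := (by decide +kernel : ∀ u v : Fin 7, quindecEdge u v →
    ∀ w, quindecEdge u w → v ≠ w → ∀ x, quindecEdge v x → u ≠ x → ∀ y, quindecEdge w y → u ≠ y →
    ∃ n e : Fin 5, ((quindecCol 1 * quindecCol 2) ^ (n : ℕ) * quindecCol 1 ^ (e : ℕ)) 0 = u ∧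
      ((quindecCol 1 * quindecCol 2) ^ (n : ℕ) * quindecCol 1 ^ (e : ℕ)) 1 = v ∧
      ((quindecCol 1 * quindecCol 2) ^ (n : ℕ) * quindecCol 1 ^ (e : ℕ)) 2 = w ∧
      ((quindecCol 1 * quindecCol 2) ^ (n : ℕ) * quindecCol 1 ^ (e : ℕ)) 3 = x ∧
      ((quindecCol 1 * quindecCol 2) ^ (n : ℕ) * quindecCol 1 ^ (e : ℕ)) 4 = y)
    (d 0) (d 1) (h _ _ (by decide)) (d 2) (h _ _ (by decide)) (hd (by decide)) (d 3)
    (h _ _ (by decide)) (hd (by decide)) (d 4) (h _ _ (by decide)) (hd (by decide))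
  have m1 : quindecCol 1 ∈ itv quindecCol 1 3 := mem_itv le_rfl (by omega)
  have m2 : quindecCol 2 ∈ itv quindecCol 1 3 := mem_itv (by omega) (by omega)
  have m := Subgroup.mul_mem _ (Subgroup.pow_mem _ (Subgroup.mul_mem _ m1 m2) (n : ℕ))
    (Subgroup.pow_mem _ m1 (e : ℕ))
  suffices d = (quindecCol 1 * quindecCol 2) ^ (n : ℕ) * quindecCol 1 ^ (e : ℕ) by
    rw [this]; exact m
  have hf : ∀ c : Fin 7, 5 ≤ c → ((quindecCol 1 * quindecCol 2) ^ (n : ℕ) * quindecCol 1 ^ (e : ℕ)) c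
      = c := fun c hc => fix_itv (fun k h1 h2 =>
    (by decide +kernel : ∀ k < 3, 1 ≤ k → ∀ c, 5 ≤ c → quindecCol k c = c) k h2 h1 c hc) m
  refine Equiv.ext fun c => ?_
  fin_cases c
  exacts [h0.symm, h1.symm, h2.symm, h3.symm, h4.symm, h5.trans (hf 5 (by decide)).symm,
    h6.trans (hf 6 (by decide)).symm]

theorem quindec_fst {j : ℕ} (hj : 3 ≤ j) (hj5 : j < 5) {d : Perm (Fin 7)}
    (hd : quindecHom d ∈ itv quindec 0 j) {c : Fin 7} (hc : j + 2 ≤ (c : ℕ)) : d c = c := by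
  have := mapsTo_itv (S := {x | x = some (c, false) ∨ x = some (c, true)}) (fun k _ hk =>
    (by decide +kernel : ∀ j : Fin 5, 3 ≤ (j : ℕ) → ∀ k : Fin j, ∀ c : Fin 7, j + 2 ≤ (c : ℕ) →
      ∀ x, (x = some (c, false) ∨ x = some (c, true)) →
      (quindec k x = some (c, false) ∨ quindec k x = some (c, true))) ⟨j, hj5⟩ hj ⟨k, hk⟩ c hc)
    hd (Or.inl rfl)
  simpa [quindecHom_some] using this

theorem stringCGen_quindec : StringCGen (alternatingGroup (Option (Fin 7 × Bool))) 5 := by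
  have hsq : ∀ k < 5, quindec k * quindec k = 1 := by decide +kernel
  have hne : ∀ k < 5, quindec k ≠ 1 := by decide +kernel
  refine ⟨quindec, ⟨hsq, hne, ?_, ?_⟩, ?_⟩
  · intro i j hij hj
    exact (by decide +kernel : ∀ i j : Fin 5, (i : ℕ) + 1 < j →
      quindec i * quindec j = quindec j * quindec i) ⟨i, by omega⟩ ⟨j, hj⟩ hij
  · intro i j hij hj
    by_cases h : j = i + 1
    · subst h
      exact inter_pair (hsq i (by omega)) (hsq _ hj)
        ((by decide +kernel : ∀ i < 4, quindec i ≠ quindec (i + 1)) i (by omega))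
    obtain ⟨rfl, rfl⟩ | ⟨rfl, rfl⟩ | ⟨rfl, rfl⟩ | ⟨rfl, rfl⟩ | ⟨rfl, h3, h5⟩ :
      (i = 0 ∧ j = 2) ∨ (i = 1 ∧ j = 3) ∨ (i = 2 ∧ j = 4) ∨ (i = 1 ∧ j = 4) ∨
        (i = 0 ∧ 3 ≤ j ∧ j < 5) := by omega
    · exact inter_dihedral (i := 0) (N := 6) (N' := 5) (hsq 0 (by omega)) (hsq 1 (by omega))
        (hsq 2 (by omega)) (by decide +kernel) (by decide +kernel) (by decide +kernel)
    · exact inter_dihedral (i := 1) (N := 5) (N' := 6) (hsq 1 (by omega)) (hsq 2 (by omega))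
        (hsq 3 (by omega)) (by decide +kernel) (by decide +kernel) (by decide +kernel)
    · exact inter_dihedral (i := 2) (N := 6) (N' := 3) (hsq 2 (by omega)) (hsq 3 (by omega))
        (hsq 4 (by omega)) (by decide +kernel) (by decide +kernel) (by decide +kernel)
    · rintro g ⟨hg1, hg2⟩
      obtain ⟨d, hd, rfl⟩ := exists_of_mem_itv quindecHom (quindecHom_col le_rfl) hg1
      obtain ⟨e, he, h⟩ := exists_of_mem_itv quindecHom (quindecHom_col (by omega)) hg2
      obtain rfl := quindecHom_injective h
      exact map_mem_itv quindecHom (quindecHom_col (by omega))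
        (quindecCol_inter_one (Subgroup.mem_inf.2 ⟨hd, he⟩))
    · rintro g ⟨hg1, hg2⟩
      obtain ⟨d, hd, rfl⟩ := exists_of_mem_itv quindecHom (quindecHom_col le_rfl) hg2
      refine map_mem_itv quindecHom (quindecHom_col le_rfl) ?_
      obtain rfl | rfl : j = 3 ∨ j = 4 := by omega
      · exact quindec_inter_zero (quindec_fst h3 h5 hg1 (by decide))
          (quindec_fst h3 h5 hg1 (by decide)) fun u v => quindecEdge_map hg1
      · exact mem_quindecCol hd (quindec_fst h3 h5 hg1 (by decide))
  · exact itv_eq_alternatingGroup (a := some (4, false)) (b := some (2, true))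
      (c := some (5, true)) (n := 20) (w := [0, 1, 2, 1, 3])
      (W := [[1, 0, 1, 2], [0, 1, 2], [2, 1, 2], [4, 3, 0], [1, 2], [1, 2, 0], [4, 3], [3, 0],
        [2], [2, 0], [3], [1], [0], []]) (by decide) (by decide +kernel) (by decide)
      (by decide +kernel) (by decide +kernel)

/-- For every `n ≥ 12` and every `3 ≤ r ≤ ⌊(n-1)/2⌋`, the alternating group `A_n`
has a string C-group representation of rank `r`. -/
theorem alternatingGroup_exists_all_ranks (n : ℕ) (hn : 12 ≤ n) (r : ℕ)
    (hr3 : 3 ≤ r) (hrn : r ≤ (n - 1) / 2) :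
    ∃ ρ : Fin r → alternatingGroup (Fin n), IsStringCGroupRep ρ := by
  obtain h | h | h | h : n % 4 = 0 ∨ n % 4 = 1 ∨ n % 4 = 2 ∨ n % 4 = 3 := by omega
  · by_cases h4 : r ≤ 4
    · obtain hn' | rfl : 15 ≤ n ∨ n = 12 := by omega
      · exact exists_rep_pairRow (Or.inr h) hn' hr3 h4
      · obtain rfl | rfl : r = 3 ∨ r = 4 := by omega
        · exact stringCGen_dozenThree.exists_rep_fin (by simp)
        · exact stringCGen_dozenFour.exists_rep_fin (by simp)
    · obtain hr | hr : r % 2 = 1 ∨ r % 2 = 0 := by omega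
      · obtain ⟨m, rfl⟩ : ∃ m, r = m + 4 := ⟨r - 4, by omega⟩
        obtain ⟨k, rfl⟩ : ∃ k, n = k + 2 * (m + 3) := ⟨n - 2 * (m + 3), by omega⟩
        have : NeZero k := ⟨by omega⟩
        exact (exists_handle_even (k := k) (by omega) (Nat.odd_iff.2 (by omega))).1.exists_rep_fin
          (by simp; omega)
      · obtain ⟨m, rfl⟩ : ∃ m, r = m + 3 := ⟨r - 3, by omega⟩
        obtain ⟨k, rfl⟩ : ∃ k, n = k + 2 * (m + 3) := ⟨n - 2 * (m + 3), by omega⟩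
        have : NeZero k := ⟨by omega⟩
        exact ((exists_handle_even (k := k) (by omega) (Nat.odd_iff.2 (by omega))).2
          (by omega)).exists_rep_fin (by simp; omega)
  · obtain ⟨m, rfl⟩ : ∃ m, n = 1 + 2 * (m + 3) := ⟨(n - 7) / 2, by omega⟩
    exact exists_rep_twoRows rfl hr3 (by omega) (by decide) (Nat.odd_iff.2 (by omega))
  · obtain ⟨m, rfl⟩ : ∃ m, n = 4 + 2 * (m + 3) := ⟨(n - 10) / 2, by omega⟩
    obtain hr | rfl : r ≤ m + 3 ∨ r = m + 4 := by omega
    · exact exists_rep_twoRows rfl hr3 hr (by decide) (Nat.odd_iff.2 (by omega))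
    · exact (exists_handle_odd (Nat.even_iff.2 (by omega))).exists_rep_fin (by simp; omega)
  · by_cases h4 : r ≤ 4
    · exact exists_rep_pairRow (Or.inl h) (by omega) hr3 h4
    by_cases h5 : r = 5
    · subst h5
      obtain hn' | rfl : 19 ≤ n ∨ n = 15 := by omega
      · exact exists_rep_pairs h hn' hr3 le_rfl
      · exact stringCGen_quindec.exists_rep_fin (by simp)
    obtain hr | hr | hr : r % 2 = 0 ∨ (r % 2 = 1 ∧ r + 2 ≤ (n - 1) / 2) ∨ r = (n - 1) / 2 := by
      omega
    · obtain ⟨m, rfl⟩ : ∃ m, r = m + 5 := ⟨r - 5, by omega⟩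
      obtain ⟨l, rfl⟩ : ∃ l, n = 2 * l + 2 * m + 13 := ⟨(n - 2 * m - 13) / 2, by omega⟩
      exact (exists_ladder l (m := m) (Nat.odd_iff.2 (by omega))).1.exists_rep_fin (by simp; omega)
    · obtain ⟨m, rfl⟩ : ∃ m, r = m + 4 := ⟨r - 4, by omega⟩
      obtain ⟨l, rfl⟩ : ∃ l, n = 2 * l + 2 * m + 13 := ⟨(n - 2 * m - 13) / 2, by omega⟩
      exact ((exists_ladder l (m := m) (Nat.odd_iff.2 (by omega))).2 (by omega)).exists_rep_fin
        (by simp; omega)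
    · obtain ⟨m, rfl⟩ : ∃ m, r = m + 6 := ⟨r - 6, by omega⟩
      obtain rfl : n = 2 * m + 13 := by omega
      exact (exists_hook (m := m) (Nat.odd_iff.2 (by omega))).exists_rep_fin (by simp; omega)
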